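/- Let R be a commutative noetherian ring with a dualizing module D, let E be an injective R-module, and let G be a Gorenstein injective R-module. Then Tor_k^R(E, Hom_R(D,G)) is a Gorenstein injective R-module for every k ≥ 0. -/

import Mathlib

open CategoryTheory

universe u

/-- The `a`-torsion submodule `Γ_a(M) = {x ∈ M | a^n x = 0 for some n}`. -/
def torsionGamma {R : Type u} [CommRing R] (a : Ideal R) (M : Type u)
    [AddCommGroup M] [Module R M] : Submodule R M :=
  ⨆ n : ℕ, Submodule.torsionBySet R M ((a ^ n : Ideal R) : Set R)

/-- Data witnessing that `G` is Gorenstein injective: a ℤ-indexed exact complex of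
injective modules, remaining exact after `Hom_R(E', -)` for every injective `E'`,
with `G ≅ ker(E_0 → E_{-1})`. -/
structure GorensteinInjData (R : Type u) [CommRing R] (G : Type u)
    [AddCommGroup G] [Module R G] where
  E : ℤ → Type u
  [acg : ∀ i, AddCommGroup (E i)]
  [mod : ∀ i, Module R (E i)]
  d : ∀ i : ℤ, E (i + 1) →ₗ[R] E i
  inj : ∀ i, Module.Injective R (E i)
  exact : ∀ i : ℤ, LinearMap.range (d (i + 1)) = LinearMap.ker (d i)
  homExact : ∀ (E' : Type u) [AddCommGroup E'] [Module R E'], Module.Injective R E' →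
      ∀ (i : ℤ) (g : E' →ₗ[R] E (i + 1)),
        (d i).comp g = 0 ↔ ∃ f : E' →ₗ[R] E (i + 1 + 1), (d (i + 1)).comp f = g
  equiv : G ≃ₗ[R] LinearMap.ker (d (-1))

/-- An `R`-module `G` is Gorenstein injective. -/
def IsGorensteinInjective (R : Type u) [CommRing R] (G : Type u)
    [AddCommGroup G] [Module R G] : Prop :=
  Nonempty (GorensteinInjData R G)

/-- Data witnessing that `M` is Gorenstein flat. -/
structure GorensteinFlatData (R : Type u) [CommRing R] (M : Type u)
    [AddCommGroup M] [Module R M] where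
  F : ℤ → Type u
  [acg : ∀ i, AddCommGroup (F i)]
  [mod : ∀ i, Module R (F i)]
  d : ∀ i : ℤ, F (i + 1) →ₗ[R] F i
  flat : ∀ i, Module.Flat R (F i)
  exact : ∀ i : ℤ, LinearMap.range (d (i + 1)) = LinearMap.ker (d i)
  tensorExact : ∀ (E' : Type u) [AddCommGroup E'] [Module R E'], Module.Injective R E' →
      ∀ i : ℤ, LinearMap.range (LinearMap.lTensor E' (d (i + 1)))
        = LinearMap.ker (LinearMap.lTensor E' (d i))
  equiv : M ≃ₗ[R] LinearMap.ker (d (-1))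

/-- An `R`-module `M` is Gorenstein flat. -/
def IsGorensteinFlat (R : Type u) [CommRing R] (M : Type u)
    [AddCommGroup M] [Module R M] : Prop :=
  Nonempty (GorensteinFlatData R M)

/-- `E` is an injective hull of `M`: `E` is injective and admits an injective
linear map from `M` with essential image. -/
def IsInjectiveHull (R : Type u) [CommRing R] (M : Type u) [AddCommGroup M] [Module R M]
    (E : Type u) [AddCommGroup E] [Module R E] : Prop :=
  Module.Injective R E ∧ ∃ f : M →ₗ[R] E, Function.Injective f ∧
    ∀ N : Submodule R E, N ≠ ⊥ → N ⊓ LinearMap.range f ≠ ⊥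

/-- `D` is a dualizing module for `R`: finitely generated, of finite injective dimension,
the homothety map `R → Hom_R(D,D)` is bijective, and `Ext^i_R(D,D) = 0` for `i ≥ 1`. -/
def IsDualizingModule (R : Type u) [CommRing R] (D : Type u)
    [AddCommGroup D] [Module R D] : Prop :=
  Module.Finite R D ∧
  (∃ n : ℕ, ∀ (M : Type u) (_ : AddCommGroup M) (_ : Module R M), ∀ i : ℕ, n < i →
      Limits.IsZero (((Ext R (ModuleCat.{u} R) i).obj
        (Opposite.op (ModuleCat.of R M))).obj (ModuleCat.of R D))) ∧
  Function.Bijective (fun r : R => (r • (LinearMap.id : D →ₗ[R] D))) ∧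
  (∀ i : ℕ, 0 < i →
    Limits.IsZero (((Ext R (ModuleCat.{u} R) i).obj
      (Opposite.op (ModuleCat.of R D))).obj (ModuleCat.of R D)))

/-- The height of a prime ideal, as the `Order.height` of the corresponding
point of the prime spectrum. -/
noncomputable def idealHeight {R : Type u} [CommRing R] (p : Ideal R) (hp : p.IsPrime) : ℕ∞ :=
  Order.height (⟨p, hp⟩ : PrimeSpectrum R)

set_option linter.all false

noncomputable section TorInterface

open CategoryTheory Limits

variable {R : Type u} [CommRing R]

/-- Tor as a type. -/
abbrev TorM (R : Type u) [CommRing R] (k : ℕ) (N X : Type u) [AddCommGroup N] [Module R N]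
    [AddCommGroup X] [Module R X] : Type u :=
  (((Tor (ModuleCat.{u} R) k).obj (ModuleCat.of R N)).obj (ModuleCat.of R X) : ModuleCat.{u} R)

section
variable {N N' N'' X X' X'' : Type u} [AddCommGroup N] [Module R N] [AddCommGroup N'] [Module R N']
  [AddCommGroup N''] [Module R N'']
  [AddCommGroup X] [Module R X] [AddCommGroup X'] [Module R X'] [AddCommGroup X''] [Module R X'']

def torL (k : ℕ) (X : Type u) [AddCommGroup X] [Module R X] (f : N →ₗ[R] N') :
    TorM R k N X →ₗ[R] TorM R k N' X :=
  (((Tor (ModuleCat.{u} R) k).map (ModuleCat.ofHom f)).app (ModuleCat.of R X)).hom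

def torR (k : ℕ) (N : Type u) [AddCommGroup N] [Module R N] (g : X →ₗ[R] X') :
    TorM R k N X →ₗ[R] TorM R k N X' :=
  (((Tor (ModuleCat.{u} R) k).obj (ModuleCat.of R N)).map (ModuleCat.ofHom g)).hom

lemma torL_id (k : ℕ) : torL k X (LinearMap.id : N →ₗ[R] N) = LinearMap.id := by
  unfold torL
  rw [ModuleCat.ofHom_id, CategoryTheory.Functor.map_id]; rfl

lemma torL_comp (k : ℕ) (f : N →ₗ[R] N') (g : N' →ₗ[R] N'') :
    torL k X (g ∘ₗ f) = torL k X g ∘ₗ torL k X f := by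
  unfold torL
  rw [ModuleCat.ofHom_comp, CategoryTheory.Functor.map_comp]; rfl

lemma torR_id (k : ℕ) : torR k N (LinearMap.id : X →ₗ[R] X) = LinearMap.id := by
  unfold torR
  rw [ModuleCat.ofHom_id, CategoryTheory.Functor.map_id]; rfl

lemma torR_comp (k : ℕ) (f : X →ₗ[R] X') (g : X' →ₗ[R] X'') :
    torR k N (g ∘ₗ f) = torR k N g ∘ₗ torR k N f := by
  unfold torR
  rw [ModuleCat.ofHom_comp, CategoryTheory.Functor.map_comp]; rfl

lemma torL_torR (k : ℕ) (f : N →ₗ[R] N') (g : X →ₗ[R] X') (z : TorM R k N X) :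
    torL k X' f (torR k N g z) = torR k N' g (torL k X f z) := by
  have := ((Tor (ModuleCat.{u} R) k).map (ModuleCat.ofHom f)).naturality (ModuleCat.ofHom g)
  exact congrArg (fun h => h.hom z) this

variable (X) in
/-- tensored resolution complex -/
abbrev tcx (N : Type u) [AddCommGroup N] [Module R N]
    (P : ChainComplex (ModuleCat.{u} R) ℕ) : ChainComplex (ModuleCat.{u} R) ℕ :=
  (((MonoidalCategory.tensoringLeft (ModuleCat.{u} R)).obj (ModuleCat.of R N)).mapHomologicalComplex
    (ComplexShape.down ℕ)).obj P

abbrev tcxL (f : N →ₗ[R] N') (P : ChainComplex (ModuleCat.{u} R) ℕ) : tcx N P ⟶ tcx N' P :=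
  (NatTrans.mapHomologicalComplex
    ((MonoidalCategory.tensoringLeft (ModuleCat.{u} R)).map (ModuleCat.ofHom f)) _).app P

abbrev tcxR (N : Type u) [AddCommGroup N] [Module R N] {P Q : ChainComplex (ModuleCat.{u} R) ℕ}
   (φ : P ⟶ Q) : tcx N P ⟶ tcx N Q :=
  (((MonoidalCategory.tensoringLeft (ModuleCat.{u} R)).obj (ModuleCat.of R N)).mapHomologicalComplex
    (ComplexShape.down ℕ)).map φ

def torIso (k : ℕ) (N : Type u) [AddCommGroup N] [Module R N]
    (P : ProjectiveResolution (ModuleCat.of R X)) :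
    TorM R k N X ≃ₗ[R] ((tcx N P.complex).homology k : ModuleCat.{u} R) :=
  (P.isoLeftDerivedObj ((MonoidalCategory.tensoringLeft (ModuleCat.{u} R)).obj
    (ModuleCat.of R N)) k).toLinearEquiv

lemma torIso_torL (k : ℕ) (f : N →ₗ[R] N') (P : ProjectiveResolution (ModuleCat.of R X))
    (z : TorM R k N X) :
    torIso k N' P (torL k X f z) =
      (HomologicalComplex.homologyMap (tcxL f P.complex) k).hom (torIso k N P z) := by
  have := ProjectiveResolution.leftDerived_app_eq
    ((MonoidalCategory.tensoringLeft (ModuleCat.{u} R)).map (ModuleCat.ofHom f)) P k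
  rw [← Category.assoc, Iso.eq_comp_inv] at this
  exact congrArg (fun h => h.hom z) this

lemma torIso_torR (k : ℕ) (f : X →ₗ[R] X') (P : ProjectiveResolution (ModuleCat.of R X))
    (Q : ProjectiveResolution (ModuleCat.of R X')) (φ : P.complex ⟶ Q.complex)
    (comm : φ.f 0 ≫ Q.π.f 0 = P.π.f 0 ≫ ModuleCat.ofHom f)
    (z : TorM R k N X) :
    torIso k N Q (torR k N f z) =
      (HomologicalComplex.homologyMap (tcxR N φ) k).hom (torIso k N P z) := by
  have := ProjectiveResolution.isoLeftDerivedObj_hom_naturality (ModuleCat.ofHom f) P Q φ comm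
    ((MonoidalCategory.tensoringLeft (ModuleCat.{u} R)).obj (ModuleCat.of R N)) k
  exact congrArg (fun h => h.hom z) this

/-- Abstract LES extraction from a short exact sequence of complexes. -/
lemma les_aux {S : ShortComplex (ChainComplex (ModuleCat.{u} R) ℕ)} (hS : S.ShortExact) (k : ℕ) :
    Function.Exact (HomologicalComplex.homologyMap S.f k).hom
      (HomologicalComplex.homologyMap S.g k).hom ∧
    Function.Exact (HomologicalComplex.homologyMap S.g (k+1)).hom
      (hS.δ (k+1) k (by simp)).hom ∧
    Function.Exact (hS.δ (k+1) k (by simp)).hom (HomologicalComplex.homologyMap S.f k).hom := by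
  refine ⟨?_, ?_, ?_⟩
  · have := hS.homology_exact₂ k
    exact (ShortComplex.ShortExact.moduleCat_exact_iff_function_exact _).1 this
  · have := hS.homology_exact₃ (k+1) k (by simp)
    exact (ShortComplex.ShortExact.moduleCat_exact_iff_function_exact _).1 this
  · have := hS.homology_exact₁ (k+1) k (by simp)
    exact (ShortComplex.ShortExact.moduleCat_exact_iff_function_exact _).1 this

lemma les_surj {S : ShortComplex (ChainComplex (ModuleCat.{u} R) ℕ)} (hS : S.ShortExact) :
    Function.Surjective (HomologicalComplex.homologyMap S.g 0).hom := by
  have := hS.epi_g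
  have : Epi (HomologicalComplex.homologyMap S.g 0) := by
    exact HomologicalComplex.epi_homologyMap_of_epi_of_not_rel _ _ (by simp)
  exact (ModuleCat.epi_iff_surjective _).1 this


lemma exact_transport {A B C A' B' C' : Type u} [AddCommGroup A] [Module R A]
    [AddCommGroup B] [Module R B] [AddCommGroup C] [Module R C]
    [AddCommGroup A'] [Module R A'] [AddCommGroup B'] [Module R B'] [AddCommGroup C'] [Module R C']
    (e₁ : A ≃ₗ[R] A') (e₂ : B ≃ₗ[R] B') (e₃ : C ≃ₗ[R] C') {f : A →ₗ[R] B} {g : B →ₗ[R] C}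
    {f' : A' →ₗ[R] B'} {g' : B' →ₗ[R] C'} (h1 : ∀ a, e₂ (f a) = f' (e₁ a))
    (h2 : ∀ b, e₃ (g b) = g' (e₂ b)) (h : Function.Exact f' g') : Function.Exact f g := by
  intro b
  rw [← e₃.map_eq_zero_iff, h2, h (e₂ b)]
  constructor
  · rintro ⟨a, ha⟩
    exact ⟨e₁.symm a, e₂.injective (by rw [h1, e₁.apply_symm_apply, ha])⟩
  · rintro ⟨a, rfl⟩
    exact ⟨e₁ a, (h1 a).symm⟩

/-- tensoring a s.e.s. with a degreewise projective complex -/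
lemma tcxL_shortExact (f : N →ₗ[R] N') (g : N' →ₗ[R] N'') (hf : Function.Injective f)
    (hfg : Function.Exact f g) (hg : Function.Surjective g)
    (P : ProjectiveResolution (ModuleCat.of R X)) :
    ∃ (w : tcxL f P.complex ≫ tcxL g P.complex = 0),
      (ShortComplex.mk (tcxL f P.complex) (tcxL g P.complex) w).ShortExact := by
  have w : tcxL f P.complex ≫ tcxL g P.complex = 0 := by
    ext i : 1
    have hz : g ∘ₗ f = 0 := by ext x; exact hfg.apply_apply_eq_zero x
    have : ModuleCat.ofHom (g ∘ₗ f) = 0 := by rw [hz]; rfl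
    apply ModuleCat.hom_ext
    have h3 := LinearMap.rTensor_comp (P.complex.X i) g f
    rw [hz, LinearMap.rTensor_zero] at h3
    exact h3.symm
  refine ⟨w, ?_⟩
  apply HomologicalComplex.shortExact_of_degreewise_shortExact
  intro i
  have : Module.Projective R (P.complex.X i) := by
    have := P.projective i
    exact (IsProjective.iff_projective (P.complex.X i)).2 this
  refine ShortComplex.ShortExact.mk' ?_ ?_ ?_
  · rw [ShortComplex.ShortExact.moduleCat_exact_iff_function_exact]
    exact rTensor_exact (P.complex.X i) hfg hg
  · rw [ModuleCat.mono_iff_injective]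
    exact Module.Flat.rTensor_preserves_injective_linearMap f hf
  · rw [ModuleCat.epi_iff_surjective]
    exact LinearMap.rTensor_surjective (P.complex.X i) hg

variable (X) in
lemma torL_les (f : N →ₗ[R] N') (g : N' →ₗ[R] N'') (hf : Function.Injective f)
    (hfg : Function.Exact f g) (hg : Function.Surjective g) (k : ℕ) :
    Function.Exact (torL k X f) (torL k X g) ∧
    (∃ δ : TorM R (k+1) N'' X →ₗ[R] TorM R k N X,
      Function.Exact (torL (k+1) X g) δ ∧ Function.Exact δ (torL k X f)) ∧
    Function.Surjective (torL 0 X g) := by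
  let P := projectiveResolution (ModuleCat.of R X)
  obtain ⟨w, hS⟩ := tcxL_shortExact f g hf hfg hg P
  have h1 := les_aux hS k
  refine ⟨?_, ⟨(torIso k N P).symm.toLinearMap ∘ₗ (hS.δ (k+1) k (by simp)).hom ∘ₗ
      (torIso (k+1) N'' P).toLinearMap, ?_, ?_⟩, ?_⟩
  · exact exact_transport (torIso k N P) (torIso k N' P) (torIso k N'' P)
      (torIso_torL k f P) (torIso_torL k g P) h1.1
  · refine exact_transport (torIso _ _ P) (torIso _ _ P) (torIso _ _ P)
      (torIso_torL _ g P) (fun b => ?_) h1.2.1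
    exact (torIso k N P).apply_symm_apply _
  · refine exact_transport (torIso _ _ P) (torIso _ _ P) (torIso _ _ P)
      (fun b => ?_) (torIso_torL _ f P) h1.2.2
    exact (torIso k N P).apply_symm_apply _
  · intro z
    obtain ⟨y, hy⟩ := les_surj hS (torIso 0 N'' P z)
    refine ⟨(torIso 0 N' P).symm y, (torIso 0 N'' P).injective ?_⟩
    rw [torIso_torL, LinearEquiv.apply_symm_apply]
    exact hy

end
end TorInterface

noncomputable section TorInterface2

open CategoryTheory Limits

variable {R : Type u} [CommRing R]

def mkCx (P : ℕ → ModuleCat.{u} R) (d : ∀ k, P (k+1) ⟶ P k)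
    (hd : ∀ k, Function.Exact (d (k+1)).hom (d k).hom) : ChainComplex (ModuleCat.{u} R) ℕ :=
  ChainComplex.of P d (fun k => by
    apply ModuleCat.hom_ext; ext x; exact (hd k).apply_apply_eq_zero x)

lemma mkCx_d (P : ℕ → ModuleCat.{u} R) (d : ∀ k, P (k+1) ⟶ P k)
    (hd : ∀ k, Function.Exact (d (k+1)).hom (d k).hom) (k : ℕ) : (mkCx P d hd).d (k+1) k = d k :=
  ChainComplex.of_d _ _ _


lemma mkRes_w {X : ModuleCat.{u} R} (P : ℕ → ModuleCat.{u} R) (d : ∀ k, P (k+1) ⟶ P k)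
    (hd : ∀ k, Function.Exact (d (k+1)).hom (d k).hom) (ε : P 0 ⟶ X)
    (hε : Function.Exact (d 0).hom ε.hom) : (mkCx P d hd).d 1 0 ≫ (show (mkCx P d hd).X 0 ⟶ X from ε) = 0 := by
  rw [mkCx_d P d hd 0]
  apply ModuleCat.hom_ext; ext x; exact hε.apply_apply_eq_zero x

def mkResπ {X : ModuleCat.{u} R} (P : ℕ → ModuleCat.{u} R) (d : ∀ k, P (k+1) ⟶ P k)
    (hd : ∀ k, Function.Exact (d (k+1)).hom (d k).hom) (ε : P 0 ⟶ X)
    (hε : Function.Exact (d 0).hom ε.hom) : mkCx P d hd ⟶ (ChainComplex.single₀ _).obj X :=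
  (ChainComplex.toSingle₀Equiv _ _).symm ⟨(show (mkCx P d hd).X 0 ⟶ X from ε), mkRes_w P d hd ε hε⟩

lemma mkResπ_f {X : ModuleCat.{u} R} (P : ℕ → ModuleCat.{u} R) (d : ∀ k, P (k+1) ⟶ P k)
    (hd : ∀ k, Function.Exact (d (k+1)).hom (d k).hom) (ε : P 0 ⟶ X)
    (hε : Function.Exact (d 0).hom ε.hom) : (mkResπ P d hd ε hε).f 0 = ε := 
  ChainComplex.toSingle₀Equiv_symm_apply_f_zero (C := mkCx P d hd) ε (mkRes_w P d hd ε hε)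

def mkRes {X : ModuleCat.{u} R} (P : ℕ → ModuleCat.{u} R) (d : ∀ k, P (k+1) ⟶ P k)
    (hd : ∀ k, Function.Exact (d (k+1)).hom (d k).hom) (ε : P 0 ⟶ X)
    (hε : Function.Exact (d 0).hom ε.hom) (hs : Function.Surjective ε.hom)
    (hP : ∀ k, Module.Projective R (P k)) : ProjectiveResolution X where
  complex := mkCx P d hd
  π := mkResπ P d hd ε hε
  projective := fun k => (IsProjective.iff_projective (P k)).1 (hP k)
  quasiIso := by
    constructor
    intro n
    cases n with
    | zero =>
      rw [ChainComplex.quasiIsoAt₀_iff, ShortComplex.quasiIso_iff_of_zeros']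
      · constructor
        · rw [ShortComplex.ShortExact.moduleCat_exact_iff_function_exact]
          have : Function.Exact ((mkCx P d hd).d 1 0).hom ((mkResπ P d hd ε hε).f 0).hom := by
            rw [mkResπ_f, mkCx_d P d hd 0]; exact hε
          exact this
        · rw [ModuleCat.epi_iff_surjective]
          have : Function.Surjective ((mkResπ P d hd ε hε).f 0).hom := by rw [mkResπ_f]; exact hs
          exact this
      · rfl
      · rfl
      · rfl
    | succ n =>
      rw [quasiIsoAt_iff_exactAt' _ _ (ChainComplex.exactAt_succ_single_obj _ _),
        HomologicalComplex.exactAt_iff' _ (n + 1 + 1) (n + 1) n (by simp) (by simp),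
        ShortComplex.ShortExact.moduleCat_exact_iff_function_exact]
      have : Function.Exact ((mkCx P d hd).d (n+1+1) (n+1)).hom ((mkCx P d hd).d (n+1) n).hom := by
        rw [mkCx_d P d hd (n+1), mkCx_d P d hd n]
        exact hd n
      exact this

lemma exists_lift_exact {B A A1 A2 : Type u} [AddCommGroup B] [Module R B] [AddCommGroup A]
    [Module R A] [AddCommGroup A1] [Module R A1] [AddCommGroup A2] [Module R A2]
    [Module.Projective R B] {a : A →ₗ[R] A1} {v : A1 →ₗ[R] A2} (h : Function.Exact a v)
    (t : B →ₗ[R] A1) (ht : v ∘ₗ t = 0) : ∃ l : B →ₗ[R] A, a ∘ₗ l = t := by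
  have hr : ∀ b, t b ∈ LinearMap.range a := fun b => (h (t b)).1 (LinearMap.congr_fun ht b)
  obtain ⟨l, hl⟩ := Module.projective_lifting_property a.rangeRestrict (t.codRestrict _ hr)
    a.surjective_rangeRestrict
  refine ⟨l, ?_⟩
  ext b
  exact congrArg Subtype.val (LinearMap.congr_fun hl b)

lemma exists_dep_seq {S : ℕ → Type u} (p : ∀ k, S k → Prop) (r : ∀ k, S k → S (k+1) → Prop)
    (x0 : S 0) (h0 : p 0 x0) (h : ∀ k x, p k x → ∃ y, p (k+1) y ∧ r k x y) :
    ∃ s : ∀ k, S k, s 0 = x0 ∧ ∀ k, r k (s k) (s (k+1)) := by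
  classical
  let F : ∀ k, {x : S k // p k x} := fun k => Nat.rec ⟨x0, h0⟩
    (fun k x => ⟨(h k x.1 x.2).choose, (h k x.1 x.2).choose_spec.1⟩) k
  exact ⟨fun k => (F k).1, rfl, fun k => (h k (F k).1 (F k).2).choose_spec.2⟩

end TorInterface2

noncomputable section TorInterface3

open CategoryTheory Limits

variable {R : Type u} [CommRing R]

def hsD {A A' B B' : Type u} [AddCommGroup A] [Module R A] [AddCommGroup A'] [Module R A']
    [AddCommGroup B] [Module R B] [AddCommGroup B'] [Module R B']
    (a : A' →ₗ[R] A) (θ : B' →ₗ[R] A) (b : B' →ₗ[R] B) : (A' × B') →ₗ[R] (A × B) :=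
  (a.coprod θ).prod (b ∘ₗ LinearMap.snd R A' B')

lemma hsD_apply {A A' B B' : Type u} [AddCommGroup A] [Module R A] [AddCommGroup A'] [Module R A']
    [AddCommGroup B] [Module R B] [AddCommGroup B'] [Module R B']
    (a : A' →ₗ[R] A) (θ : B' →ₗ[R] A) (b : B' →ₗ[R] B) (x : A') (y : B') :
    hsD a θ b (x, y) = (a x + θ y, b y) := rfl

/-- elementary horseshoe -/
lemma horseshoe_elem {X X' X'' : Type u} [AddCommGroup X] [Module R X]
    [AddCommGroup X'] [Module R X'] [AddCommGroup X''] [Module R X'']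
    (f : X →ₗ[R] X') (g : X' →ₗ[R] X'') (hf : Function.Injective f)
    (hfg : Function.Exact f g) (hg : Function.Surjective g)
    (A B : ℕ → ModuleCat.{u} R) (a : ∀ k, A (k+1) →ₗ[R] A k) (b : ∀ k, B (k+1) →ₗ[R] B k)
    (ε : A 0 →ₗ[R] X) (ε'' : B 0 →ₗ[R] X'')
    (ha : ∀ k, Function.Exact (a (k+1)) (a k)) (hb : ∀ k, Function.Exact (b (k+1)) (b k))
    (ha0 : Function.Exact (a 0) ε) (hb0 : Function.Exact (b 0) ε'')
    (hε : Function.Surjective ε) (hε'' : Function.Surjective ε'')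
    (hB : ∀ k, Module.Projective R (B k)) :
    ∃ (θ : ∀ k, B (k+1) →ₗ[R] A k) (s : B 0 →ₗ[R] X'),
      (∀ x, g (s x) = ε'' x) ∧ (∀ k, Function.Exact (hsD (a (k+1)) (θ (k+1)) (b (k+1)))
        (hsD (a k) (θ k) (b k))) ∧
      Function.Exact (hsD (a 0) (θ 0) (b 0)) ((f ∘ₗ ε).coprod s) ∧
      Function.Surjective ((f ∘ₗ ε).coprod s) := by
  obtain ⟨s, hs⟩ := Module.projective_lifting_property g ε'' hg
  obtain ⟨t, ht⟩ := exists_lift_exact hfg (s ∘ₗ b 0) (by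
    rw [← LinearMap.comp_assoc, hs]; ext x; exact hb0.apply_apply_eq_zero x)
  obtain ⟨θ0, hθ0⟩ := Module.projective_lifting_property ε (-t) hε
  have hbb : ∀ k x, b k (b (k+1) x) = 0 := fun k x => (hb k).apply_apply_eq_zero x
  obtain ⟨θ, hθz, hθ⟩ := exists_dep_seq (S := fun k => (B (k+1) →ₗ[R] A k))
    (fun k θ => ∃ θ' : B (k+2) →ₗ[R] A (k+1), a k ∘ₗ θ' = - (θ ∘ₗ b (k+1)))
    (fun k θ θ' => a k ∘ₗ θ' = - (θ ∘ₗ b (k+1))) θ0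
    (by
      refine exists_lift_exact ha0 _ ?_
      ext x
      apply hf
      have h1 := LinearMap.congr_fun hθ0 (b 1 x)
      have h2 := LinearMap.congr_fun ht (b 1 x)
      simp only [LinearMap.comp_apply, LinearMap.neg_apply] at h1 h2 ⊢
      rw [map_neg, h1, neg_neg, h2, hbb, map_zero, LinearMap.zero_apply, map_zero])
    (by
      rintro k θ ⟨θ', h⟩
      refine ⟨θ', exists_lift_exact (ha k) _ ?_, h⟩
      ext x
      have h1 := LinearMap.congr_fun h (b (k+2) x)
      simp only [LinearMap.comp_apply, LinearMap.neg_apply] at h1 ⊢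
      rw [map_neg, h1, hbb]; simp)
  have hs' : ∀ x, g (s x) = ε'' x := fun x => LinearMap.congr_fun hs x
  have ht' : ∀ x, f (t x) = s (b 0 x) := fun x => LinearMap.congr_fun ht x
  have hθ' : ∀ k x, a k (θ (k+1) x) = - θ k (b (k+1) x) := fun k x => LinearMap.congr_fun (hθ k) x
  have hθ0' : ∀ x, ε (θ 0 x) = - t x := fun x => by
    rw [hθz]; exact LinearMap.congr_fun hθ0 x
  refine ⟨θ, s, hs', ?_, ?_, ?_⟩
  · rintro k ⟨x, y⟩
    simp only [hsD_apply, Prod.mk_eq_zero, Set.mem_range, Prod.exists,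
      Prod.mk.injEq]
    constructor
    · rintro ⟨h1, h2⟩
      obtain ⟨y', rfl⟩ := (hb k y).1 h2
      obtain ⟨x', hx'⟩ := (ha k (x - θ (k+1) y')).1 (by rw [map_sub, hθ', sub_neg_eq_add, h1])
      exact ⟨x', y', by rw [hx']; abel, rfl⟩
    · rintro ⟨x', y', rfl, rfl⟩
      refine ⟨?_, hbb _ _⟩
      rw [map_add, (ha k).apply_apply_eq_zero, hθ']; simp
  · rintro ⟨x, y⟩
    simp only [hsD_apply, LinearMap.coprod_apply, LinearMap.comp_apply, Set.mem_range, Prod.exists,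
      Prod.mk.injEq]
    constructor
    · intro h1
      have h2 : ε'' y = 0 := by
        have := congrArg g h1
        rw [map_add, hfg.apply_apply_eq_zero, hs', map_zero, zero_add] at this
        exact this
      obtain ⟨y', rfl⟩ := (hb0 y).1 h2
      obtain ⟨x', hx'⟩ := (ha0 (x - θ 0 y')).1 (by
        apply hf
        rw [map_sub, hθ0', sub_neg_eq_add, map_add, ht', h1, map_zero])
      exact ⟨x', y', by rw [hx']; abel, rfl⟩
    · rintro ⟨x', y', rfl, rfl⟩
      rw [map_add, ha0.apply_apply_eq_zero, hθ0', zero_add, map_neg, ht']; simp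
  · intro z
    obtain ⟨y, hy⟩ := hε'' (g z)
    obtain ⟨x, hx⟩ := (hfg (z - s y)).1 (by rw [map_sub, hs', hy, sub_self])
    obtain ⟨w, rfl⟩ := hε x
    exact ⟨(w, y), by simp [hx]⟩

lemma res_exact_succ {X : ModuleCat.{u} R} (P : ProjectiveResolution X) (k : ℕ) :
    Function.Exact (P.complex.d (k+1+1) (k+1)).hom (P.complex.d (k+1) k).hom :=
  (ShortComplex.ShortExact.moduleCat_exact_iff_function_exact _).1 (P.exact_succ k)

lemma res_exact_zero {X : ModuleCat.{u} R} (P : ProjectiveResolution X) :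
    Function.Exact (P.complex.d 1 0).hom (show P.complex.X 0 ⟶ X from P.π.f 0).hom :=
  (ShortComplex.ShortExact.moduleCat_exact_iff_function_exact _).1 P.exact₀

lemma res_surj {X : ModuleCat.{u} R} (P : ProjectiveResolution X) :
    Function.Surjective (show P.complex.X 0 ⟶ X from P.π.f 0).hom :=
  (ModuleCat.epi_iff_surjective (show P.complex.X 0 ⟶ X from P.π.f 0)).1
    (inferInstanceAs (Epi (P.π.f 0)))

lemma res_proj {X : ModuleCat.{u} R} (P : ProjectiveResolution X) (i : ℕ) :
    Module.Projective R (P.complex.X i) :=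
  (IsProjective.iff_projective (P.complex.X i)).2 (P.projective i)

lemma horseshoe {X X' X'' : Type u} [AddCommGroup X] [Module R X]
    [AddCommGroup X'] [Module R X'] [AddCommGroup X''] [Module R X'']
    (f : X →ₗ[R] X') (g : X' →ₗ[R] X'') (hf : Function.Injective f)
    (hfg : Function.Exact f g) (hg : Function.Surjective g) :
    ∃ (P : ProjectiveResolution (ModuleCat.of R X)) (P' : ProjectiveResolution (ModuleCat.of R X'))
      (P'' : ProjectiveResolution (ModuleCat.of R X'')) (φ : P.complex ⟶ P'.complex)
      (ψ : P'.complex ⟶ P''.complex),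
      (φ.f 0 ≫ P'.π.f 0 = P.π.f 0 ≫ ModuleCat.ofHom f) ∧
      (ψ.f 0 ≫ P''.π.f 0 = P'.π.f 0 ≫ ModuleCat.ofHom g) ∧
      ∀ k, Function.Exact (φ.f k).hom (ψ.f k).hom ∧ Function.Surjective (ψ.f k).hom ∧
        ∃ r : P'.complex.X k →ₗ[R] P.complex.X k, r ∘ₗ (φ.f k).hom = LinearMap.id := by
  let P := projectiveResolution (ModuleCat.of R X)
  let Q := projectiveResolution (ModuleCat.of R X'')
  obtain ⟨θ, s, h1, h2, h3, h4⟩ := horseshoe_elem f g hf hfg hg P.complex.X Q.complex.X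
    (fun k => (P.complex.d (k+1) k).hom) (fun k => (Q.complex.d (k+1) k).hom)
    (show P.complex.X 0 ⟶ ModuleCat.of R X from P.π.f 0).hom
    (show Q.complex.X 0 ⟶ ModuleCat.of R X'' from Q.π.f 0).hom
    (res_exact_succ P) (res_exact_succ Q) (res_exact_zero P) (res_exact_zero Q)
    (res_surj P) (res_surj Q) (res_proj Q)
  have hp : ∀ k, Module.Projective R (ModuleCat.of R (P.complex.X k × Q.complex.X k)) := fun k => by
    have := res_proj P k
    have := res_proj Q k
    exact inferInstanceAs (Module.Projective R (P.complex.X k × Q.complex.X k))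
  let M := mkRes (X := ModuleCat.of R X') (fun k => ModuleCat.of R (P.complex.X k × Q.complex.X k))
    (fun k => ModuleCat.ofHom (hsD _ _ _)) h2 (ModuleCat.ofHom (LinearMap.coprod _ _)) h3 h4 hp
  refine ⟨P, M, Q, ⟨fun k => ModuleCat.ofHom (LinearMap.inl R _ _), ?_⟩,
    ⟨fun k => ModuleCat.ofHom (LinearMap.snd R _ _), ?_⟩, ?_, ?_, ?_⟩
  · rintro i j rfl
    have : M.complex.d (j+1) j = _ := mkCx_d _ _ h2 j
    rw [this]
    apply ModuleCat.hom_ext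
    apply LinearMap.ext
    intro x
    have e : (((P.complex.d (j+1) j).hom x + θ j 0, (Q.complex.d (j+1) j).hom 0) :
      P.complex.X j × Q.complex.X j) = ((P.complex.d (j+1) j).hom x, 0) := by simp
    exact e
  · rintro i j rfl
    have : M.complex.d (j+1) j = _ := mkCx_d _ _ h2 j
    rw [this]
    rfl
  · have : M.π.f 0 = _ := mkResπ_f _ _ h2 _ h3
    rw [this]
    apply ModuleCat.hom_ext
    apply LinearMap.ext
    intro x
    have e : f ((show P.complex.X 0 ⟶ ModuleCat.of R X from P.π.f 0).hom x) + s 0 =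
      f ((show P.complex.X 0 ⟶ ModuleCat.of R X from P.π.f 0).hom x) := by simp
    exact e
  · have : M.π.f 0 = _ := mkResπ_f _ _ h2 _ h3
    rw [this]
    apply ModuleCat.hom_ext
    apply LinearMap.ext
    rintro ⟨x, y⟩
    have e : (show Q.complex.X 0 ⟶ ModuleCat.of R X'' from Q.π.f 0).hom y =
      g (f ((show P.complex.X 0 ⟶ ModuleCat.of R X from P.π.f 0).hom x) + s y) := by
      rw [map_add, hfg.apply_apply_eq_zero, zero_add, h1 y]
    exact e
  · intro k
    refine ⟨?_, ?_, ?_⟩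
    · rintro ⟨x, y⟩
      constructor
      · rintro (h : y = 0)
        exact ⟨x, by rw [h]; rfl⟩
      · rintro ⟨x, h⟩
        exact (Prod.ext_iff.1 h).2.symm
    · intro y
      exact ⟨(0, y), rfl⟩
    · exact ⟨LinearMap.fst R _ _, rfl⟩

section
variable {N X X' X'' : Type u} [AddCommGroup N] [Module R N]
  [AddCommGroup X] [Module R X] [AddCommGroup X'] [Module R X'] [AddCommGroup X''] [Module R X'']

variable (N) in
lemma torR_les (f : X →ₗ[R] X') (g : X' →ₗ[R] X'') (hf : Function.Injective f)
    (hfg : Function.Exact f g) (hg : Function.Surjective g) (k : ℕ) :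
    Function.Exact (torR k N f) (torR k N g) ∧
    (∃ δ : TorM R (k+1) N X'' →ₗ[R] TorM R k N X,
      Function.Exact (torR (k+1) N g) δ ∧ Function.Exact δ (torR k N f)) ∧
    Function.Surjective (torR 0 N g) := by
  obtain ⟨P, P', P'', φ, ψ, c1, c2, h⟩ := horseshoe f g hf hfg hg
  have w : tcxR N φ ≫ tcxR N ψ = 0 := by
    ext i : 1
    have hz : (ψ.f i).hom ∘ₗ (φ.f i).hom = 0 := by ext x; exact (h i).1.apply_apply_eq_zero x
    apply ModuleCat.hom_ext
    have h3 := LinearMap.lTensor_comp N (ψ.f i).hom (φ.f i).hom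
    rw [hz, LinearMap.lTensor_zero] at h3
    exact h3.symm
  have hS : (ShortComplex.mk (tcxR N φ) (tcxR N ψ) w).ShortExact := by
    apply HomologicalComplex.shortExact_of_degreewise_shortExact
    intro i
    refine ShortComplex.ShortExact.mk' ?_ ?_ ?_
    · rw [ShortComplex.ShortExact.moduleCat_exact_iff_function_exact]
      exact lTensor_exact N (h i).1 (h i).2.1
    · rw [ModuleCat.mono_iff_injective]
      obtain ⟨r, hr⟩ := (h i).2.2
      have h3 := LinearMap.lTensor_comp N r (φ.f i).hom
      rw [hr, LinearMap.lTensor_id] at h3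
      have : Function.Injective (LinearMap.lTensor N (φ.f i).hom) :=
        Function.LeftInverse.injective (g := LinearMap.lTensor N r)
          (fun x => (LinearMap.congr_fun h3 x).symm)
      exact this
    · rw [ModuleCat.epi_iff_surjective]
      exact LinearMap.lTensor_surjective N (h i).2.1
  have h1 := les_aux hS k
  refine ⟨?_, ⟨(torIso k N P).symm.toLinearMap ∘ₗ (hS.δ (k+1) k (by simp)).hom ∘ₗ
      (torIso (k+1) N P'').toLinearMap, ?_, ?_⟩, ?_⟩
  · exact exact_transport (torIso k N P) (torIso k N P') (torIso k N P'')
      (torIso_torR k f P P' φ c1) (torIso_torR k g P' P'' ψ c2) h1.1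
  · refine exact_transport (torIso _ _ P') (torIso _ _ P'') (torIso _ _ P)
      (torIso_torR _ g P' P'' ψ c2) (fun b => ?_) h1.2.1
    exact (torIso k N P).apply_symm_apply _
  · refine exact_transport (torIso _ _ P'') (torIso _ _ P) (torIso _ _ P')
      (fun b => ?_) (torIso_torR _ f P P' φ c1) h1.2.2
    exact (torIso k N P).apply_symm_apply _
  · intro z
    obtain ⟨y, hy⟩ := les_surj hS (torIso 0 N P'' z)
    refine ⟨(torIso 0 N P').symm y, (torIso 0 N P'').injective ?_⟩
    rw [torIso_torR 0 g P' P'' ψ c2, LinearEquiv.apply_symm_apply]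
    exact hy
end

end TorInterface3

noncomputable section TorInterface4

open CategoryTheory Limits
open scoped TensorProduct

variable {R : Type u} [CommRing R]

section cls
variable (K : ChainComplex (ModuleCat.{u} R) ℕ) {L : ChainComplex (ModuleCat.{u} R) ℕ}

def cls0 (k : ℕ) (x : K.X k) (hx : ∀ j, (K.d k j).hom x = 0) : ModuleCat.of R R ⟶ K.cycles k :=
  K.liftCycles (ModuleCat.ofHom (LinearMap.toSpanSingleton R _ x)) _ rfl (by
    apply ModuleCat.hom_ext; apply LinearMap.ext_ring
    simp only [ModuleCat.hom_comp, ModuleCat.hom_ofHom, LinearMap.comp_apply,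
      LinearMap.toSpanSingleton_apply, one_smul]
    exact hx _)

def cls (k : ℕ) (x : K.X k) (hx : ∀ j, (K.d k j).hom x = 0) : (K.homology k : ModuleCat.{u} R) :=
  (cls0 K k x hx ≫ K.homologyπ k).hom (1 : R)

lemma cls0_i (k : ℕ) (x : K.X k) (hx : ∀ j, (K.d k j).hom x = 0) :
    (K.iCycles k).hom ((cls0 K k x hx).hom (1:R)) = x := by
  have : cls0 K k x hx ≫ K.iCycles k = ModuleCat.ofHom (LinearMap.toSpanSingleton R _ x) :=
    K.liftCycles_i _ _ _ _
  have h := congrArg (fun h => h.hom (1:R)) this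
  simp only [ModuleCat.hom_ofHom, LinearMap.toSpanSingleton_apply, one_smul] at h
  exact h

lemma iCycles_inj (k : ℕ) : Function.Injective (K.iCycles k).hom :=
  (ModuleCat.mono_iff_injective _).1 inferInstance

lemma cls_surj (k : ℕ) (z : (K.homology k : ModuleCat.{u} R)) : ∃ x hx, z = cls K k x hx := by
  obtain ⟨y, rfl⟩ := (ModuleCat.epi_iff_surjective (K.homologyπ k)).1 inferInstance z
  refine ⟨(K.iCycles k).hom y, fun j => ?_, ?_⟩
  · have := K.iCycles_d k j
    exact congrArg (fun h => h.hom y) this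
  · unfold cls
    rw [ModuleCat.hom_comp, LinearMap.comp_apply]
    congr 1
    apply iCycles_inj
    rw [cls0_i]

variable {K}
lemma map_cls (φ : K ⟶ L) (k : ℕ) (x : K.X k) (hx : ∀ j, (K.d k j).hom x = 0)
    (hx' : ∀ j, (L.d k j).hom ((φ.f k).hom x) = 0) :
    (HomologicalComplex.homologyMap φ k).hom (cls K k x hx) = cls L k ((φ.f k).hom x) hx' := by
  unfold cls
  have e1 := congrArg (fun h => h.hom ((cls0 K k x hx).hom (1:R)))
    (HomologicalComplex.homologyπ_naturality φ k)
  simp only [ModuleCat.hom_comp, LinearMap.comp_apply] at e1 ⊢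
  rw [e1]
  congr 1
  apply iCycles_inj
  rw [cls0_i]
  have e2 := congrArg (fun h => h.hom ((cls0 K k x hx).hom (1:R)))
    (HomologicalComplex.cyclesMap_i φ k)
  simp only [ModuleCat.hom_comp, LinearMap.comp_apply] at e2
  rw [e2, cls0_i]

lemma cls_zero (k : ℕ) (hx : ∀ j, (K.d k j).hom 0 = 0) : cls K k 0 hx = 0 := by
  unfold cls
  rw [ModuleCat.hom_comp, LinearMap.comp_apply]
  have : (cls0 K k 0 hx).hom (1:R) = 0 := by
    apply iCycles_inj; rw [cls0_i, map_zero]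
  rw [this, map_zero]

end cls

section
variable {N N' X X' : Type u} [AddCommGroup N] [Module R N] [AddCommGroup N'] [Module R N']
  [AddCommGroup X] [Module R X] [AddCommGroup X'] [Module R X']

lemma lr_comm (f : N →ₗ[R] N') (g : X →ₗ[R] X') (x : N ⊗[R] X) :
    LinearMap.lTensor N' g (LinearMap.rTensor X f x) =
      LinearMap.rTensor X' f (LinearMap.lTensor N g x) := by
  rw [← LinearMap.comp_apply, ← LinearMap.comp_apply, LinearMap.lTensor_comp_rTensor,
    LinearMap.rTensor_comp_lTensor]

/-- Tor₀ -/
def tor0 (N X : Type u) [AddCommGroup N] [Module R N] [AddCommGroup X] [Module R X] :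
    TorM R 0 N X ≃ₗ[R] N ⊗[R] X :=
  (((MonoidalCategory.tensoringLeft (ModuleCat.{u} R)).obj
    (ModuleCat.of R N)).leftDerivedZeroIsoSelf.app (ModuleCat.of R X)).toLinearEquiv

lemma tor0_torR (g : X →ₗ[R] X') (z : TorM R 0 N X) :
    tor0 N X' (torR 0 N g z) = LinearMap.lTensor N g (tor0 N X z) := by
  have := ((MonoidalCategory.tensoringLeft (ModuleCat.{u} R)).obj
    (ModuleCat.of R N)).leftDerivedZeroIsoSelf.hom.naturality (ModuleCat.ofHom g)
  exact congrArg (fun h => h.hom z) this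

lemma tor0_cls (P : ProjectiveResolution (ModuleCat.of R X)) (x : (tcx N P.complex).X 0)
    (hx : ∀ j, ((tcx N P.complex).d 0 j).hom x = 0) :
    tor0 N X ((torIso 0 N P).symm (cls _ 0 x hx)) =
      LinearMap.lTensor N (show P.complex.X 0 ⟶ ModuleCat.of R X from P.π.f 0).hom x := by
  have h1 := P.fromLeftDerivedZero_eq ((MonoidalCategory.tensoringLeft (ModuleCat.{u} R)).obj
    (ModuleCat.of R N))
  have h2 := congrArg (fun h => h.hom ((torIso 0 N P).symm (cls _ 0 x hx))) h1
  refine Eq.trans h2 ?_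
  have h3 : (P.isoLeftDerivedObj ((MonoidalCategory.tensoringLeft (ModuleCat.{u} R)).obj
    (ModuleCat.of R N)) 0).hom.hom ((torIso 0 N P).symm (cls _ 0 x hx)) = cls _ 0 x hx :=
    (torIso 0 N P).apply_symm_apply _
  have h4 := congrArg (fun h => h.hom ((cls0 _ 0 x hx).hom (1:R)))
    ((tcx N P.complex).homology_π_ι 0)
  have h5 := P.pOpcycles_comp_fromLeftDerivedZero'
    ((MonoidalCategory.tensoringLeft (ModuleCat.{u} R)).obj (ModuleCat.of R N))
  have h6 := congrArg (fun h => h.hom x) h5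
  refine Eq.trans ?_ h6
  refine Eq.trans (congrArg (fun t => (P.fromLeftDerivedZero'
    ((MonoidalCategory.tensoringLeft (ModuleCat.{u} R)).obj (ModuleCat.of R N))).hom
    ((ChainComplex.isoHomologyι₀ (tcx N P.complex)).hom.hom t)) h3) ?_
  refine congrArg (P.fromLeftDerivedZero'
    ((MonoidalCategory.tensoringLeft (ModuleCat.{u} R)).obj (ModuleCat.of R N))).hom ?_
  refine Eq.trans h4 ?_
  exact congrArg ((tcx N P.complex).pOpcycles 0).hom (cls0_i _ _ _ _)

lemma tor0_torL (f : N →ₗ[R] N') (z : TorM R 0 N X) :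
    tor0 N' X (torL 0 X f z) = LinearMap.rTensor X f (tor0 N X z) := by
  let P := projectiveResolution (ModuleCat.of R X)
  obtain ⟨z, rfl⟩ := (torIso 0 N P).symm.surjective z
  obtain ⟨x, hx, rfl⟩ := cls_surj _ _ z
  rw [tor0_cls]
  have hx' : ∀ j, ((tcx N' P.complex).d 0 j).hom (((tcxL f P.complex).f 0).hom x) = 0 := by
    intro j
    have := congrArg (fun h => h.hom x) ((tcxL f P.complex).comm 0 j)
    refine Eq.trans this ?_
    simp only [ModuleCat.hom_comp, LinearMap.comp_apply, hx, map_zero]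
  have : torL 0 X f ((torIso 0 N P).symm (cls _ 0 x hx)) = (torIso 0 N' P).symm (cls _ 0 _ hx') := by
    apply (torIso 0 N' P).injective
    rw [torIso_torL, LinearEquiv.apply_symm_apply, LinearEquiv.apply_symm_apply, map_cls _ _ _ _ hx']
  rw [this, tor0_cls]
  change LinearMap.lTensor _ _ (LinearMap.rTensor _ f x) = _
  exact lr_comm f _ x

lemma cls_add {K : ChainComplex (ModuleCat.{u} R) ℕ} (k : ℕ) (x y : K.X k) (hx hy hxy) :
    cls K k (x + y) hxy = cls K k x hx + cls K k y hy := by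
  unfold cls
  simp only [ModuleCat.hom_comp, LinearMap.comp_apply]
  rw [← map_add]
  congr 1
  apply iCycles_inj; rw [map_add, cls0_i, cls0_i, cls0_i]

lemma cls_smul {K : ChainComplex (ModuleCat.{u} R) ℕ} (k : ℕ) (r : R) (x : K.X k) (hx hxy) :
    cls K k (r • x) hxy = r • cls K k x hx := by
  unfold cls
  simp only [ModuleCat.hom_comp, LinearMap.comp_apply]
  rw [← map_smul]
  congr 1
  apply iCycles_inj; rw [map_smul, cls0_i, cls0_i]

lemma tcxL_cyc (f : N →ₗ[R] N') (P : ChainComplex (ModuleCat.{u} R) ℕ) (k : ℕ)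
    (x : (tcx N P).X k) (hx : ∀ j, ((tcx N P).d k j).hom x = 0) :
    ∀ j, ((tcx N' P).d k j).hom (((tcxL f P).f k).hom x) = 0 := by
  intro j
  have := congrArg (fun h => h.hom x) ((tcxL f P).comm k j)
  refine Eq.trans this ?_
  simp only [ModuleCat.hom_comp, LinearMap.comp_apply, hx, map_zero]

lemma torL_cls (k : ℕ) (f : N →ₗ[R] N') (P : ProjectiveResolution (ModuleCat.of R X))
    (x : (tcx N P.complex).X k) (hx : ∀ j, ((tcx N P.complex).d k j).hom x = 0) (hx') :
    torL k X f ((torIso k N P).symm (cls _ k x hx)) =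
      (torIso k N' P).symm (cls _ k (((tcxL f P.complex).f k).hom x) hx') := by
  apply (torIso k N' P).injective
  rw [torIso_torL, LinearEquiv.apply_symm_apply, LinearEquiv.apply_symm_apply, map_cls _ _ _ _ hx']

lemma cls_congr {K : ChainComplex (ModuleCat.{u} R) ℕ} {k : ℕ} {x y : K.X k} (h : x = y) (hx hy) :
    cls K k x hx = cls K k y hy := by
  subst h; rfl

lemma tcxL_add (f g : N →ₗ[R] N') (P : ChainComplex (ModuleCat.{u} R) ℕ) :
    tcxL (f + g) P = tcxL f P + tcxL g P := by
  apply HomologicalComplex.hom_ext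
  intro i
  apply ModuleCat.hom_ext
  exact LinearMap.rTensor_add (P.X i) f g

lemma tcxL_smul (r : R) (f : N →ₗ[R] N') (P : ChainComplex (ModuleCat.{u} R) ℕ) (k : ℕ) (x) :
    ((tcxL (r • f) P).f k).hom x = r • ((tcxL f P).f k).hom x := 
  LinearMap.congr_fun (LinearMap.rTensor_smul (P.X k) r f) x

lemma torL_add (k : ℕ) (f g : N →ₗ[R] N') : torL k X (f + g) = torL k X f + torL k X g := by
  apply LinearMap.ext
  intro z
  let P := projectiveResolution (ModuleCat.of R X)
  apply (torIso k N' P).injective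
  rw [LinearMap.add_apply, map_add, torIso_torL, torIso_torL, torIso_torL, tcxL_add,
    HomologicalComplex.homologyMap_add]
  rfl

lemma torL_smul (k : ℕ) (r : R) (f : N →ₗ[R] N') : torL k X (r • f) = r • torL k X f := by
  apply LinearMap.ext
  intro z
  let P := projectiveResolution (ModuleCat.of R X)
  obtain ⟨z, rfl⟩ := (torIso k N P).symm.surjective z
  obtain ⟨x, hx, rfl⟩ := cls_surj _ _ z
  have h1 : ∀ j, ((tcx N' P.complex).d k j).hom (r • ((tcxL f P.complex).f k).hom x) = 0 := by
    intro j
    exact Eq.trans (map_smul ((tcx N' P.complex).d k j).hom r _) (Eq.trans (congrArg (r • ·) (tcxL_cyc f _ k x hx j)) (smul_zero r))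
  rw [LinearMap.smul_apply, torL_cls _ _ _ _ _ (tcxL_cyc f _ k x hx),
    torL_cls _ _ _ _ _ (tcxL_cyc (r • f) _ k x hx), ← map_smul, ← cls_smul _ _ _ _ h1]
  exact congrArg (torIso k N' P).symm (cls_congr (tcxL_smul r f P.complex k x) _ _)

lemma torL_zero (k : ℕ) : torL k X (0 : N →ₗ[R] N') = 0 := by
  have := torL_smul (X := X) k (0:R) (0 : N →ₗ[R] N')
  rwa [zero_smul, zero_smul] at this

lemma torL_sum (k : ℕ) {ι : Type*} (s : Finset ι) (f : ι → (N →ₗ[R] N')) :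
    torL k X (∑ i ∈ s, f i) = ∑ i ∈ s, torL k X (f i) := by
  classical
  induction s using Finset.induction_on with
  | empty => simp [torL_zero]
  | insert a s ha ih => rw [Finset.sum_insert ha, Finset.sum_insert ha, torL_add, ih]

lemma torL_smul_id (k : ℕ) (r : R) (z : TorM R k N X) :
    torL k X (r • (LinearMap.id : N →ₗ[R] N)) z = r • z := by
  rw [torL_smul, torL_id]; rfl

/-- every Tor class comes from a f.g. submodule -/
lemma tor_fg (k : ℕ) (z : TorM R k N X) :
    ∃ U : Submodule R N, Module.Finite R U ∧ z ∈ LinearMap.range (torL k X U.subtype) := by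
  let P := projectiveResolution (ModuleCat.of R X)
  obtain ⟨z, rfl⟩ := (torIso k N P).symm.surjective z
  obtain ⟨x, hx, rfl⟩ := cls_surj _ _ z
  obtain ⟨U, hU, h⟩ := TensorProduct.exists_finite_submodule_left_of_setFinite
    (R := R) (M := N) (N := P.complex.X k) {x} (Set.finite_singleton _)
  obtain ⟨y0, hy⟩ := h (Set.mem_singleton x)
  obtain ⟨y, rfl⟩ : ∃ y : (tcx U P.complex).X k, y = y0 := ⟨y0, rfl⟩
  have h2 : ((tcxL U.subtype P.complex).f k).hom y = x := hy
  have hyc : ∀ j, ((tcx U P.complex).d k j).hom y = 0 := by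
    intro j
    have hp := res_proj P j
    have hi : Function.Injective (LinearMap.rTensor (P.complex.X j) U.subtype) :=
      Module.Flat.rTensor_preserves_injective_linearMap U.subtype U.injective_subtype
    apply hi
    refine Eq.trans ?_ (map_zero _).symm
    have h1 := congrArg (fun h => h.hom y) ((tcxL U.subtype P.complex).comm k j)
    refine Eq.trans h1.symm ?_
    exact (congrArg ((tcx N P.complex).d k j).hom h2).trans (hx j)
  refine ⟨U, hU, (torIso k U P).symm (cls _ k y hyc), ?_⟩
  rw [torL_cls _ _ _ _ _ (tcxL_cyc _ _ k y hyc)]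
  exact congrArg (torIso k N P).symm (cls_congr h2 _ _)

end
end TorInterface4

noncomputable section TorInterface5

open CategoryTheory Limits
open scoped TensorProduct

variable {R : Type u} [CommRing R]

section gen
variable {A B C : Type u} [AddCommGroup A] [Module R A] [AddCommGroup B] [Module R B]
  [AddCommGroup C] [Module R C]

structure SES (f : A →ₗ[R] B) (g : B →ₗ[R] C) : Prop where
  inj : Function.Injective f
  ex : Function.Exact f g
  surj : Function.Surjective g

lemma SES.ker (g : B →ₗ[R] C) (hg : Function.Surjective g) : SES (LinearMap.ker g).subtype g :=
  ⟨Subtype.val_injective, LinearMap.exact_subtype_ker_map g, hg⟩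

lemma SES.quot (N : Submodule R B) : SES N.subtype N.mkQ :=
  ⟨Subtype.val_injective, LinearMap.exact_subtype_mkQ N, N.mkQ_surjective⟩

lemma SES.coker (f : A →ₗ[R] B) (hf : Function.Injective f) : SES f (LinearMap.range f).mkQ :=
  ⟨hf, LinearMap.exact_map_mkQ_range f, Submodule.mkQ_surjective _⟩

lemma kill_exact {f : A →ₗ[R] B} {g : B →ₗ[R] C} (h : Function.Exact f g) {s t : R}
    (hA : ∀ a : A, s • a = 0) (hC : ∀ c : C, t • c = 0) (b : B) : (s * t) • b = 0 := by
  have : g (t • b) = 0 := by rw [map_smul, hC]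
  obtain ⟨a, ha⟩ := (h _).1 this
  rw [mul_smul, ← ha, ← map_smul, hA, map_zero]

lemma zero_exact {f : A →ₗ[R] B} {g : B →ₗ[R] C} (h : Function.Exact f g)
    (hA : ∀ a : A, a = 0) (hC : ∀ c : C, c = 0) (b : B) : b = 0 := by
  obtain ⟨a, ha⟩ := (h b).1 (hC _)
  rw [← ha, hA a, map_zero]

end gen

def TK (s : R) (k : ℕ) (N X : Type u) [AddCommGroup N] [Module R N] [AddCommGroup X] [Module R X] :
    Prop := ∀ z : TorM R k N X, s • z = 0

def TZ (R : Type u) [CommRing R] (k : ℕ) (N X : Type u) [AddCommGroup N] [Module R N]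
    [AddCommGroup X] [Module R X] : Prop := ∀ z : TorM R k N X, z = 0

section
variable {A B C N N' X X' : Type u} [AddCommGroup A] [Module R A] [AddCommGroup B] [Module R B]
  [AddCommGroup C] [Module R C] [AddCommGroup N] [Module R N] [AddCommGroup N'] [Module R N']
  [AddCommGroup X] [Module R X] [AddCommGroup X'] [Module R X']

lemma TK_one {k : ℕ} : TK (1:R) k N X ↔ TZ R k N X := by simp [TK, TZ]

section rules
variable {f : A →ₗ[R] B} {g : B →ₗ[R] C} (h : SES f g) {s t : R} {k : ℕ}
include h

lemma TK.L2 (hA : TK s k A X) (hC : TK t k C X) : TK (s * t) k B X :=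
  kill_exact (torL_les X f g h.inj h.ex h.surj k).1 hA hC
lemma TK.L3 (hB : TK s (k+1) B X) (hA : TK t k A X) : TK (s * t) (k+1) C X := by
  obtain ⟨δ, h1, h2⟩ := (torL_les X f g h.inj h.ex h.surj k).2.1
  exact kill_exact h1 hB hA
lemma TK.L1 (hC : TK s (k+1) C X) (hB : TK t k B X) : TK (s * t) k A X := by
  obtain ⟨δ, h1, h2⟩ := (torL_les X f g h.inj h.ex h.surj k).2.1
  exact kill_exact h2 hC hB
lemma TZ.L2 (hA : TZ R k A X) (hC : TZ R k C X) : TZ R k B X :=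
  zero_exact (torL_les X f g h.inj h.ex h.surj k).1 hA hC
lemma TZ.L3 (hB : TZ R (k+1) B X) (hA : TZ R k A X) : TZ R (k+1) C X := by
  obtain ⟨δ, h1, h2⟩ := (torL_les X f g h.inj h.ex h.surj k).2.1
  exact zero_exact h1 hB hA
lemma TZ.L1 (hC : TZ R (k+1) C X) (hB : TZ R k B X) : TZ R k A X := by
  obtain ⟨δ, h1, h2⟩ := (torL_les X f g h.inj h.ex h.surj k).2.1
  exact zero_exact h2 hC hB
lemma TZ.L3' (hB : TZ R 0 B X) : TZ R 0 C X := by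
  intro z
  obtain ⟨y, rfl⟩ := (torL_les X f g h.inj h.ex h.surj 0).2.2 z
  rw [hB y, map_zero]
lemma TK.R2 (hA : TK s k N A) (hC : TK t k N C) : TK (s * t) k N B :=
  kill_exact (torR_les N f g h.inj h.ex h.surj k).1 hA hC
lemma TK.R3 (hB : TK s (k+1) N B) (hA : TK t k N A) : TK (s * t) (k+1) N C := by
  obtain ⟨δ, h1, h2⟩ := (torR_les N f g h.inj h.ex h.surj k).2.1
  exact kill_exact h1 hB hA
lemma TK.R1 (hC : TK s (k+1) N C) (hB : TK t k N B) : TK (s * t) k N A := by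
  obtain ⟨δ, h1, h2⟩ := (torR_les N f g h.inj h.ex h.surj k).2.1
  exact kill_exact h2 hC hB
lemma TZ.R2 (hA : TZ R k N A) (hC : TZ R k N C) : TZ R k N B :=
  zero_exact (torR_les N f g h.inj h.ex h.surj k).1 hA hC
lemma TZ.R3 (hB : TZ R (k+1) N B) (hA : TZ R k N A) : TZ R (k+1) N C := by
  obtain ⟨δ, h1, h2⟩ := (torR_les N f g h.inj h.ex h.surj k).2.1
  exact zero_exact h1 hB hA
lemma TZ.R1 (hC : TZ R (k+1) N C) (hB : TZ R k N B) : TZ R k N A := by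
  obtain ⟨δ, h1, h2⟩ := (torR_les N f g h.inj h.ex h.surj k).2.1
  exact zero_exact h2 hC hB

/-- Tor₁(N,C)=0 from injectivity -/
lemma TZ.R_one (hB : TZ R 1 N B) : TZ R 1 N C ↔ Function.Injective (LinearMap.lTensor N f) := by
  obtain ⟨δ, h1, h2⟩ := (torR_les N f g h.inj h.ex h.surj 0).2.1
  have key : Function.Injective (torR 0 N f) ↔ Function.Injective (LinearMap.lTensor N f) := by
    have e : (LinearMap.lTensor N f) ∘ₗ (tor0 N A).toLinearMap = (tor0 N B).toLinearMap ∘ₗ torR 0 N f :=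
      LinearMap.ext fun z => (tor0_torR f z).symm
    constructor
    · intro hi x y hxy
      obtain ⟨x, rfl⟩ := (tor0 N A).surjective x
      obtain ⟨y, rfl⟩ := (tor0 N A).surjective y
      rw [← tor0_torR, ← tor0_torR] at hxy
      rw [hi ((tor0 N B).injective hxy)]
    · intro hi x y hxy
      apply (tor0 N A).injective; apply hi
      rw [← tor0_torR, ← tor0_torR, hxy]
  rw [← key]
  constructor
  · intro hz
    rw [injective_iff_map_eq_zero]
    intro a ha
    obtain ⟨c, rfl⟩ := (h2 a).1 ha
    rw [hz c, map_zero]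
  · intro hi c
    have : δ c = 0 := by
      apply hi; rw [map_zero]; exact (h2 _).2 ⟨_, rfl⟩
    obtain ⟨b, rfl⟩ := (h1 c).1 this
    rw [hB b, map_zero]

lemma TZ.L_one (hB : TZ R 1 B X) : TZ R 1 C X ↔ Function.Injective (LinearMap.rTensor X f) := by
  obtain ⟨δ, h1, h2⟩ := (torL_les X f g h.inj h.ex h.surj 0).2.1
  have key : Function.Injective (torL 0 X f) ↔ Function.Injective (LinearMap.rTensor X f) := by
    constructor
    · intro hi x y hxy
      obtain ⟨x, rfl⟩ := (tor0 A X).surjective x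
      obtain ⟨y, rfl⟩ := (tor0 A X).surjective y
      rw [← tor0_torL, ← tor0_torL] at hxy
      rw [hi ((tor0 B X).injective hxy)]
    · intro hi x y hxy
      apply (tor0 A X).injective; apply hi
      rw [← tor0_torL, ← tor0_torL, hxy]
  rw [← key]
  constructor
  · intro hz
    rw [injective_iff_map_eq_zero]
    intro a ha
    obtain ⟨c, rfl⟩ := (h2 a).1 ha
    rw [hz c, map_zero]
  · intro hi c
    have : δ c = 0 := by
      apply hi; rw [map_zero]; exact (h2 _).2 ⟨_, rfl⟩
    obtain ⟨b, rfl⟩ := (h1 c).1 this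
    rw [hB b, map_zero]
end rules

lemma TZ.proj (k : ℕ) (N P : Type u) [AddCommGroup N] [Module R N] [AddCommGroup P] [Module R P]
    [Module.Projective R P] : TZ R (k+1) N P := by
  intro z
  have : Projective (ModuleCat.of R P) := (IsProjective.iff_projective P).1 inferInstance
  have h := isZero_Tor_succ_of_projective (C := ModuleCat.{u} R) (ModuleCat.of R N) (ModuleCat.of R P) k
  have := ModuleCat.subsingleton_of_isZero h
  exact Subsingleton.elim _ _

/-- free cover -/
lemma exists_cover (X : Type u) [AddCommGroup X] [Module R X] :
    ∃ (P : Type u) (_ : AddCommGroup P) (_ : Module R P) (g : P →ₗ[R] X), Module.Free R P ∧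
      Function.Surjective g :=
  ⟨X →₀ R, inferInstance, inferInstance, Finsupp.linearCombination R id, inferInstance,
    Finsupp.linearCombination_id_surjective R X⟩

lemma TZ.flatL (k : ℕ) (F X : Type u) [AddCommGroup F] [Module R F] [AddCommGroup X] [Module R X]
    [Module.Flat R F] : TZ R (k+1) F X := by
  induction k generalizing X with
  | zero =>
    obtain ⟨P, _, _, g, _, hg⟩ := exists_cover (R := R) X
    rw [zero_add, TZ.R_one (SES.ker g hg) (TZ.proj 0 F P)]
    exact Module.Flat.lTensor_preserves_injective_linearMap _ (Subtype.val_injective)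
  | succ k ih =>
    obtain ⟨P, _, _, g, _, hg⟩ := exists_cover (R := R) X
    exact TZ.R3 (SES.ker g hg) (TZ.proj _ F P) (ih _)

lemma TZ.flatR (k : ℕ) (N F : Type u) [AddCommGroup F] [Module R F] [AddCommGroup N] [Module R N]
    [Module.Flat R F] : TZ R (k+1) N F := by
  induction k generalizing N with
  | zero =>
    obtain ⟨P, _, _, g, _, hg⟩ := exists_cover (R := R) N
    rw [zero_add, TZ.L_one (SES.ker g hg) (TZ.flatL 0 P F)]
    exact Module.Flat.rTensor_preserves_injective_linearMap _ (Subtype.val_injective)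
  | succ k ih =>
    obtain ⟨P, _, _, g, _, hg⟩ := exists_cover (R := R) N
    exact TZ.L3 (SES.ker g hg) (TZ.flatL _ P F) (ih _)

lemma flat_of_TZ (Y : Type u) [AddCommGroup Y] [Module R Y]
    (h : ∀ (I : Ideal R), I.FG → TZ R 1 (R ⧸ I) Y) : Module.Flat R Y := by
  rw [Module.Flat.iff_rTensor_injective]
  intro I hI
  exact (TZ.L_one (SES.quot I) (TZ.flatL 0 R Y)).1 (h I hI)

lemma TZ.tensor_flat {N X F : Type u} [AddCommGroup N] [Module R N] [AddCommGroup X] [Module R X]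
    [AddCommGroup F] [Module R F] [Module.Flat R F] (h : ∀ i, TZ R (i+1) N X) (i : ℕ) :
    TZ R (i+1) (N ⊗[R] F) X := by
  induction i generalizing X with
  | zero =>
    obtain ⟨P, _, _, g, _, hg⟩ := exists_cover (R := R) X
    rw [zero_add, TZ.R_one (SES.ker g hg) (TZ.proj 0 _ P)]
    have h1 := (TZ.R_one (SES.ker g hg) (TZ.proj 0 N P)).1 (h 0)
    have h2 := Module.Flat.lTensor_preserves_injective_linearMap (M := F) _ h1
    let e1 (Z : Type u) [AddCommGroup Z] [Module R Z] : (N ⊗[R] F) ⊗[R] Z ≃ₗ[R] F ⊗[R] (N ⊗[R] Z) :=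
      (TensorProduct.congr (TensorProduct.comm R N F) (LinearEquiv.refl R Z)).trans
        (TensorProduct.assoc R F N Z)
    have e2 : (e1 P).toLinearMap ∘ₗ LinearMap.lTensor (N ⊗[R] F) (LinearMap.ker g).subtype =
      LinearMap.lTensor F (LinearMap.lTensor N (LinearMap.ker g).subtype) ∘ₗ
        (e1 (LinearMap.ker g)).toLinearMap := by
      apply TensorProduct.ext_threefold
      intro x y z
      simp [e1]
    have h3 : Function.Injective ((e1 P).toLinearMap ∘ₗ
        LinearMap.lTensor (N ⊗[R] F) (LinearMap.ker g).subtype) := by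
      rw [e2]; exact h2.comp (e1 _).injective
    exact Function.Injective.of_comp (f := (e1 P)) h3
  | succ i ih =>
    obtain ⟨P, _, _, g, _, hg⟩ := exists_cover (R := R) X
    refine TZ.R3 (SES.ker g hg) (TZ.proj _ _ P) (ih ?_)
    intro j
    exact TZ.R1 (SES.ker g hg) (h _) (TZ.proj _ _ P)

def torLE (k : ℕ) (X : Type u) [AddCommGroup X] [Module R X] (e : N ≃ₗ[R] N') :
    TorM R k N X ≃ₗ[R] TorM R k N' X :=
  LinearEquiv.ofLinear (torL k X e.toLinearMap) (torL k X e.symm.toLinearMap)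
    (by rw [← torL_comp]; simp [torL_id]) (by rw [← torL_comp]; simp [torL_id])

def torRE (k : ℕ) (N : Type u) [AddCommGroup N] [Module R N] (e : X ≃ₗ[R] X') :
    TorM R k N X ≃ₗ[R] TorM R k N X' :=
  LinearEquiv.ofLinear (torR k N e.toLinearMap) (torR k N e.symm.toLinearMap)
    (by rw [← torR_comp]; simp [torR_id]) (by rw [← torR_comp]; simp [torR_id])

lemma TZ.congrL {k : ℕ} (e : N ≃ₗ[R] N') (h : TZ R k N X) : TZ R k N' X := fun z => by
  rw [← (torLE k X e).apply_symm_apply z, h ((torLE k X e).symm z), map_zero]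

lemma TZ.congrR {k : ℕ} (e : X ≃ₗ[R] X') (h : TZ R k N X) : TZ R k N X' := fun z => by
  rw [← (torRE k N e).apply_symm_apply z, h ((torRE k N e).symm z), map_zero]

/-- multiplication by s on N kills -/
lemma TZ.of_fg {k : ℕ} (h : ∀ U : Submodule R N, Module.Finite R U →
    ∀ z : TorM R k U X, torL k X U.subtype z = 0) : TZ R k N X := by
  intro z
  obtain ⟨U, hU, y, rfl⟩ := tor_fg k z
  exact h U hU y

open DirectSum in
def torSum (k : ℕ) {ι : Type u} [DecidableEq ι] (J : ι → Type u) [∀ i, AddCommGroup (J i)] [∀ i, Module R (J i)]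
    (X : Type u) [AddCommGroup X] [Module R X] :
    (⨁ i, TorM R k (J i) X) →ₗ[R] TorM R k (⨁ i, J i) X :=
  DirectSum.toModule R ι _ (fun i => torL k X (DirectSum.lof R ι J i))

open DirectSum in
lemma torSum_lof (k : ℕ) {ι : Type u} [DecidableEq ι] (J : ι → Type u) [∀ i, AddCommGroup (J i)] [∀ i, Module R (J i)]
    (X : Type u) [AddCommGroup X] [Module R X] (j : ι) (x : TorM R k (J j) X) :
    torSum k J X (DirectSum.lof R ι (fun i => TorM R k (J i) X) j x) = torL k X (DirectSum.lof R ι J j) x := by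
  unfold torSum
  rw [DirectSum.toModule_lof]

open DirectSum in
lemma torSum_bij (k : ℕ) {ι : Type u} [DecidableEq ι] (J : ι → Type u) [∀ i, AddCommGroup (J i)] [∀ i, Module R (J i)]
    (X : Type u) [AddCommGroup X] [Module R X] : Function.Bijective (torSum (R := R) k J X) := by
  constructor
  · rw [injective_iff_map_eq_zero]
    intro z hz
    ext i
    have h1 : ∀ z, torL k X (DirectSum.component R ι J i) (torSum k J X z) = 
        DirectSum.component R ι (fun i => TorM R k (J i) X) i z := by
      intro z
      induction z using DirectSum.induction_on with
      | zero => simp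
      | add x y hx hy => rw [map_add, map_add, map_add, hx, hy]
      | of j x =>
        have e1 : torSum k J X (DirectSum.of _ j x) = torL k X (DirectSum.lof R ι J j) x :=
          torSum_lof k J X j x
        rw [e1, ← LinearMap.comp_apply, ← torL_comp]
        by_cases hij : j = i
        · subst hij
          have : DirectSum.component R ι J j ∘ₗ DirectSum.lof R ι J j = LinearMap.id := by
            ext x; simp [DirectSum.component.lof_self]
          rw [this, torL_id]
          exact (DirectSum.component.lof_self R (M := fun i => TorM R k (J i) X) j x).symm
        · have : DirectSum.component R ι J i ∘ₗ DirectSum.lof R ι J j = 0 := by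
            ext x; simp [DirectSum.component.of, hij]
          rw [this, torL_zero]
          exact (by
            rw [LinearMap.zero_apply]
            exact (DirectSum.of_eq_of_ne (β := fun i => TorM R k (J i) X) j i x (Ne.symm hij)).symm)
    have h2 := h1 z
    rw [hz, map_zero] at h2
    exact h2.symm
  · intro z
    obtain ⟨U, hU, y, rfl⟩ := tor_fg k z
    classical
    obtain ⟨S, hS⟩ := hU.fg_top
    let T : Finset ι := S.biUnion (fun x => DFinsupp.support (x : ⨁ i, J i))
    have hT : ∀ x : U, ∀ i, i ∉ T → (x : ⨁ i, J i) i = 0 := by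
      intro x i hi
      have hx : x ∈ Submodule.span R (S : Set U) := by rw [hS]; trivial
      induction hx using Submodule.span_induction with
      | mem x hx =>
        by_contra hne
        apply hi
        exact Finset.mem_biUnion.2 ⟨x, hx, by rwa [DFinsupp.mem_support_iff]⟩
      | zero => rfl
      | add x y _ _ hx hy =>
        have : ((x + y : U) : ⨁ i, J i) i = (x : ⨁ i, J i) i + (y : ⨁ i, J i) i := rfl
        rw [this, hx, hy, add_zero]
      | smul r x _ hx =>
        have : ((r • x : U) : ⨁ i, J i) i = r • (x : ⨁ i, J i) i := rfl
        rw [this, hx, smul_zero]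
    have hsub : U.subtype = ∑ i ∈ T, DirectSum.lof R ι J i ∘ₗ (DirectSum.component R ι J i ∘ₗ U.subtype) := by
      apply LinearMap.ext
      intro x
      rw [LinearMap.sum_apply]
      have h1 : (x : ⨁ i, J i) = ∑ i ∈ T, DirectSum.of J i ((x : ⨁ i, J i) i) := by
        apply DFinsupp.ext
        intro j
        have : ((∑ i ∈ T, DirectSum.of J i ((x : ⨁ i, J i) i)) : ⨁ i, J i) j =
          ∑ i ∈ T, (DirectSum.of J i ((x : ⨁ i, J i) i)) j := DFinsupp.finsetSum_apply _ _ _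
        refine Eq.trans ?_ this.symm
        by_cases hj : j ∈ T
        · rw [Finset.sum_eq_single j]
          · rw [DirectSum.of_eq_same]
          · intro i _ hij
            rw [DirectSum.of_eq_of_ne _ _ _ hij.symm]
          · intro h; exact absurd hj h
        · rw [hT x j hj, Finset.sum_eq_zero]
          intro i hi
          rw [DirectSum.of_eq_of_ne]
          rintro rfl; exact hj hi
      exact h1
    rw [hsub, torL_sum, LinearMap.sum_apply]
    refine ⟨∑ i ∈ T, DirectSum.lof R ι (fun i => TorM R k (J i) X) i
      (torL k X (DirectSum.component R ι J i ∘ₗ U.subtype) y), ?_⟩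
    rw [map_sum]
    refine Finset.sum_congr rfl fun i _ => ?_
    rw [torSum_lof, ← LinearMap.comp_apply, ← torL_comp]

end
end TorInterface5

noncomputable section ExtInterface

open CategoryTheory Limits
open scoped TensorProduct

variable {R : Type u} [CommRing R]

abbrev EM (R : Type u) [CommRing R] (k : ℕ) (M N : Type u) [AddCommGroup M] [Module R M]
    [AddCommGroup N] [Module R N] : Type u :=
  Abelian.Ext.{u} (ModuleCat.of R M) (ModuleCat.of R N) k

def EK (s : R) (k : ℕ) (M N : Type u) [AddCommGroup M] [Module R M] [AddCommGroup N] [Module R N] :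
    Prop := ∀ z : EM R k M N, s • z = 0

def EZ (R : Type u) [CommRing R] (k : ℕ) (M N : Type u) [AddCommGroup M] [Module R M]
    [AddCommGroup N] [Module R N] : Prop := ∀ z : EM R k M N, z = 0

section
variable {A B C M N X Y M' N' : Type u} [AddCommGroup A] [Module R A] [AddCommGroup B] [Module R B]
  [AddCommGroup C] [Module R C] [AddCommGroup N] [Module R N] [AddCommGroup M] [Module R M]
  [AddCommGroup X] [Module R X] [AddCommGroup Y] [Module R Y]
  [AddCommGroup N'] [Module R N'] [AddCommGroup M'] [Module R M']

lemma EK_one {k : ℕ} : EK (1:R) k N X ↔ EZ R k N X := by simp [EK, EZ]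

lemma EK.mul {k : ℕ} {s : R} (t : R) (h : EK s k M N) : EK (t * s) k M N := fun z => by
  rw [mul_smul, h z, smul_zero]

lemma EZ.EK {k : ℕ} (s : R) (h : EZ R k M N) : EK s k M N := fun z => by rw [h z, smul_zero]

abbrev sc {f : A →ₗ[R] B} {g : B →ₗ[R] C} (h : SES f g) : ShortComplex (ModuleCat.{u} R) :=
  ShortComplex.mk (ModuleCat.ofHom f) (ModuleCat.ofHom g) (by
    rw [← ModuleCat.ofHom_comp, h.ex.linearMap_comp_eq_zero]; rfl)

lemma sc_shortExact {f : A →ₗ[R] B} {g : B →ₗ[R] C} (h : SES f g) : (sc h).ShortExact where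
  exact := (ShortComplex.ShortExact.moduleCat_exact_iff_function_exact _).2 h.ex
  mono_f := (ModuleCat.mono_iff_injective _).2 h.inj
  epi_g := (ModuleCat.epi_iff_surjective _).2 h.surj

section rules
variable {f : A →ₗ[R] B} {g : B →ₗ[R] C} (h : SES f g) {s t : R} {k : ℕ}
include h

open Abelian Abelian.Ext

lemma EK.R2 (hA : EK s k X A) (hC : EK t k X C) : EK (s * t) k X B := by
  intro z
  obtain ⟨y, hy⟩ := Ext.covariant_sequence_exact₂ _ (sc_shortExact h) (t • z : EM R k X B)
    (by rw [Ext.smul_comp]; exact hC _)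
  rw [mul_smul, ← hy, ← Ext.smul_comp]
  exact (congrArg (fun w => Ext.comp w (mk₀ (sc h).f) (add_zero k)) (hA y)).trans (Ext.zero_comp ..)

lemma EK.R3 (hB : EK s k X B) (hA : EK t (k+1) X A) : EK (s * t) k X C := by
  intro z
  obtain ⟨y, hy⟩ := Ext.covariant_sequence_exact₃ _ (sc_shortExact h) (t • z : EM R k X C) rfl
    (by rw [Ext.smul_comp]; exact hA _)
  rw [mul_smul, ← hy, ← Ext.smul_comp]
  exact (congrArg (fun w => Ext.comp w (mk₀ (sc h).g) (add_zero k)) (hB y)).trans (Ext.zero_comp ..)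

lemma EK.R1 (hC : EK s k X C) (hB : EK t (k+1) X B) : EK (s * t) (k+1) X A := by
  intro z
  obtain ⟨y, hy⟩ := Ext.covariant_sequence_exact₁ _ (sc_shortExact h) (t • z : EM R (k+1) X A)
    (by rw [Ext.smul_comp]; exact hB _) rfl
  rw [mul_smul, ← hy, ← Ext.smul_comp]
  exact (congrArg (fun w => Ext.comp w (sc_shortExact h).extClass rfl) (hC y)).trans (Ext.zero_comp ..)

lemma EK.L2 (hC : EK s k C Y) (hA : EK t k A Y) : EK (s * t) k B Y := by
  intro z
  obtain ⟨y, hy⟩ := Ext.contravariant_sequence_exact₂ (sc_shortExact h) _ (t • z : EM R k B Y)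
    (by rw [Ext.comp_smul]; exact hA _)
  rw [mul_smul, ← hy, ← Ext.comp_smul]
  exact (congrArg (fun w => Ext.comp (mk₀ (sc h).g) w (zero_add k)) (hC y)).trans (Ext.comp_zero ..)

lemma EK.L1 (hB : EK s k B Y) (hC : EK t (k+1) C Y) : EK (s * t) k A Y := by
  intro z
  obtain ⟨y, hy⟩ := Ext.contravariant_sequence_exact₁ (sc_shortExact h) _ (t • z : EM R k A Y)
    (add_comm 1 k) (by rw [Ext.comp_smul]; exact hC _)
  rw [mul_smul, ← hy, ← Ext.comp_smul]
  exact (congrArg (fun w => Ext.comp (mk₀ (sc h).f) w (zero_add k)) (hB y)).trans (Ext.comp_zero ..)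

lemma EK.L3 (hA : EK s k A Y) (hB : EK t (k+1) B Y) : EK (s * t) (k+1) C Y := by
  intro z
  obtain ⟨y, hy⟩ := Ext.contravariant_sequence_exact₃ (sc_shortExact h) _ (t • z : EM R (k+1) C Y)
    (by rw [Ext.comp_smul]; exact hB _) (add_comm 1 k)
  rw [mul_smul, ← hy, ← Ext.comp_smul]
  exact (congrArg (fun w => Ext.comp (sc_shortExact h).extClass w (add_comm 1 k)) (hA y)).trans (Ext.comp_zero ..)

lemma EZ.R2 (hA : EZ R k X A) (hC : EZ R k X C) : EZ R k X B := by
  rw [← EK_one] at *; simpa using EK.R2 h hA hC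
lemma EZ.R3 (hB : EZ R k X B) (hA : EZ R (k+1) X A) : EZ R k X C := by
  rw [← EK_one] at *; simpa using EK.R3 h hB hA
lemma EZ.R1 (hC : EZ R k X C) (hB : EZ R (k+1) X B) : EZ R (k+1) X A := by
  rw [← EK_one] at *; simpa using EK.R1 h hC hB
lemma EZ.L2 (hC : EZ R k C Y) (hA : EZ R k A Y) : EZ R k B Y := by
  rw [← EK_one] at *; simpa using EK.L2 h hC hA
lemma EZ.L1 (hB : EZ R k B Y) (hC : EZ R (k+1) C Y) : EZ R k A Y := by
  rw [← EK_one] at *; simpa using EK.L1 h hB hC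
lemma EZ.L3 (hA : EZ R k A Y) (hB : EZ R (k+1) B Y) : EZ R (k+1) C Y := by
  rw [← EK_one] at *; simpa using EK.L3 h hA hB

lemma EK.ext1 (hC : EK s 1 C Y) (φ : A →ₗ[R] Y) : ∃ ψ : B →ₗ[R] Y, ψ ∘ₗ f = s • φ := by
  obtain ⟨y, hy⟩ := Ext.contravariant_sequence_exact₁ (sc_shortExact h) (ModuleCat.of R Y)
    (s • Ext.mk₀ (ModuleCat.ofHom φ) : EM R 0 A Y) rfl (by rw [Ext.comp_smul]; exact hC _)
  obtain ⟨ψ, rfl⟩ := Ext.homEquiv₀.symm.surjective y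
  refine ⟨ψ.hom, ?_⟩
  have h1 : Ext.mk₀ ((sc h).f ≫ ψ) = (Ext.mk₀ (s • ModuleCat.ofHom φ) : EM R 0 A Y) := by
    rw [Ext.mk₀_smul, ← Ext.mk₀_comp_mk₀]; exact hy
  have h2 := Ext.homEquiv₀.symm.injective h1
  exact congrArg ModuleCat.Hom.hom h2

lemma EK.of_ext1 (hB : EZ R 1 B Y) (H : ∀ φ : A →ₗ[R] Y, ∃ ψ : B →ₗ[R] Y, ψ ∘ₗ f = s • φ) :
    EK s 1 C Y := by
  intro z
  obtain ⟨y, hy⟩ := Ext.contravariant_sequence_exact₃ (sc_shortExact h) _ (z : EM R 1 C Y)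
    (hB _) (add_comm 1 0)
  obtain ⟨φ, rfl⟩ := Ext.homEquiv₀.symm.surjective y
  obtain ⟨ψ, hψ⟩ := H φ.hom
  have h1 : s • φ = (sc h).f ≫ ModuleCat.ofHom ψ := by
    apply ModuleCat.hom_ext; exact hψ.symm
  rw [← hy, ← Ext.comp_smul, Ext.homEquiv₀_symm_apply, ← Ext.mk₀_smul, h1, ← Ext.mk₀_comp_mk₀]
  exact ShortComplex.ShortExact.extClass_comp_assoc (sc_shortExact h) _

lemma EZ.lift (hA : EZ R 1 X A) (φ : X →ₗ[R] C) : ∃ ψ : X →ₗ[R] B, g ∘ₗ ψ = φ := by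
  obtain ⟨y, hy⟩ := Ext.covariant_sequence_exact₃ (ModuleCat.of R X) (sc_shortExact h)
    (Ext.mk₀ (ModuleCat.ofHom φ) : EM R 0 X C) rfl (hA _)
  obtain ⟨ψ, rfl⟩ := Ext.homEquiv₀.symm.surjective y
  refine ⟨ψ.hom, ?_⟩
  have h1 : Ext.mk₀ (ψ ≫ (sc h).g) = (Ext.mk₀ (ModuleCat.ofHom φ) : EM R 0 X C) := by
    rw [← Ext.mk₀_comp_mk₀]; exact hy
  have h2 := Ext.homEquiv₀.symm.injective h1
  exact congrArg ModuleCat.Hom.hom h2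

lemma EZ.of_lift (hB : EZ R 1 X B) (H : ∀ φ : X →ₗ[R] C, ∃ ψ : X →ₗ[R] B, g ∘ₗ ψ = φ) :
    EZ R 1 X A := by
  intro z
  obtain ⟨y, hy⟩ := Ext.covariant_sequence_exact₁ _ (sc_shortExact h) (z : EM R 1 X A)
    (hB _) rfl
  obtain ⟨φ, rfl⟩ := Ext.homEquiv₀.symm.surjective y
  obtain ⟨ψ, hψ⟩ := H φ.hom
  have h1 : φ = ModuleCat.ofHom ψ ≫ (sc h).g := by
    apply ModuleCat.hom_ext; exact hψ.symm
  rw [← hy, Ext.homEquiv₀_symm_apply, h1, ← Ext.mk₀_comp_mk₀,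
    Ext.comp_assoc (a₂ := 0) (a₂₃ := 1) _ _ _ (zero_add 0) (zero_add 1) (by simp),
    ShortComplex.ShortExact.comp_extClass (sc_shortExact h), Ext.comp_zero]

end rules

lemma EZ.proj (k : ℕ) (P Y : Type u) [AddCommGroup P] [Module R P] [AddCommGroup Y] [Module R Y]
    [Module.Projective R P] : EZ R (k+1) P Y := by
  have : Projective (ModuleCat.of R P) := (IsProjective.iff_projective P).1 inferInstance
  intro z; exact Abelian.Ext.eq_zero_of_projective z

lemma EZ.inj (k : ℕ) (X I : Type u) [AddCommGroup X] [Module R X] [AddCommGroup I] [Module R I]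
    (hI : Module.Injective R I) : EZ R (k+1) X I := by
  have : Injective (ModuleCat.of R I) := Module.injective_object_of_injective_module (inj := hI)
  intro z; exact Abelian.Ext.eq_zero_of_injective z

lemma EZ.of_ext1 {f : A →ₗ[R] B} {g : B →ₗ[R] C} (h : SES f g) (hB : EZ R 1 B Y)
    (H : ∀ φ : A →ₗ[R] Y, ∃ ψ : B →ₗ[R] Y, ψ ∘ₗ f = φ) : EZ R 1 C Y := by
  rw [← EK_one]; apply EK.of_ext1 h hB; simpa using H

lemma EZ.ext1 {f : A →ₗ[R] B} {g : B →ₗ[R] C} (h : SES f g) (hB : EZ R 1 C Y) (φ : A →ₗ[R] Y) :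
    ∃ ψ : B →ₗ[R] Y, ψ ∘ₗ f = φ := by
  rw [← EK_one] at hB; simpa using EK.ext1 h hB φ

lemma injective_of_EZ (I : Type u) [AddCommGroup I] [Module R I]
    (h : ∀ J : Ideal R, EZ R 1 (R ⧸ J) I) : Module.Injective R I := by
  apply Module.Baer.injective
  intro J φ
  obtain ⟨ψ, hψ⟩ := EZ.ext1 (SES.quot J) (h J) φ
  exact ⟨ψ, fun x hx => by rw [← hψ]; rfl⟩

/-- enough injectives -/
lemma exists_inj (X : Type u) [AddCommGroup X] [Module R X] :
    ∃ (P : Type u) (_ : AddCommGroup P) (_ : Module R P) (f : X →ₗ[R] P), Module.Injective R P ∧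
      Function.Injective f := by
  let p := Classical.choice (EnoughInjectives.presentation (ModuleCat.of R X))
  refine ⟨p.J, inferInstance, inferInstance, p.f.hom, ?_, (ModuleCat.mono_iff_injective _).1 p.mono⟩
  have := p.injective
  exact Module.injective_module_of_injective_object R p.J

/-- x kills X then kills Ext(X,-). -/
lemma EK.of_kill {x : R} (hx : ∀ m : M, x • m = 0) (k : ℕ) : EK x k M N := by
  intro z
  have h1 : z = Abelian.Ext.comp (Abelian.Ext.mk₀ (𝟙 (ModuleCat.of R M))) z (zero_add k) := by
    rw [Abelian.Ext.mk₀_id_comp]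
  rw [h1, ← Abelian.Ext.smul_comp, ← Abelian.Ext.mk₀_smul]
  have : x • 𝟙 (ModuleCat.of R M) = 0 := by
    apply ModuleCat.hom_ext; apply LinearMap.ext; exact hx
  rw [this, Abelian.Ext.mk₀_zero, Abelian.Ext.zero_comp]

lemma EK.smulL {x s : R} {g : M →ₗ[R] C} (h : SES (x • (LinearMap.id : M →ₗ[R] M)) g) {k : ℕ}
    (hC : EK s (k+1) C Y) (z : EM R k M Y) : ∃ z' : EM R k M Y, s • z = x • z' := by
  obtain ⟨y, hy⟩ := Abelian.Ext.contravariant_sequence_exact₁ (sc_shortExact h) _ (s • z : EM R k M Y)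
    (add_comm 1 k) (by rw [Abelian.Ext.comp_smul]; exact hC _)
  refine ⟨y, ?_⟩
  rw [← hy]
  have : (sc h).f = x • 𝟙 (ModuleCat.of R M) := rfl
  rw [this, Abelian.Ext.mk₀_smul, Abelian.Ext.smul_comp, Abelian.Ext.mk₀_id_comp]

lemma EK.smulR {x s : R} {g : M →ₗ[R] C} (h : SES (x • (LinearMap.id : M →ₗ[R] M)) g) {k : ℕ}
    (hx : ∀ m : X, x • m = 0) (hC : EK s k X C) : EK s (k+1) X M := by
  intro z
  obtain ⟨y, hy⟩ := Abelian.Ext.covariant_sequence_exact₁ _ (sc_shortExact h) z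
    (by
      have : (sc h).f = x • 𝟙 (ModuleCat.of R M) := rfl
      rw [this, ← Abelian.Ext.smul_eq_comp_mk₀]
      exact EK.of_kill hx _ z) rfl
  rw [← hy, ← Abelian.Ext.smul_comp]
  exact (congrArg (fun w => Abelian.Ext.comp w (sc_shortExact h).extClass rfl) (hC y)).trans (Abelian.Ext.zero_comp ..)

lemma EK.congrL {s : R} {k : ℕ} (e : M ≃ₗ[R] M') (h : EK s k M N) : EK s k M' N := by
  intro z
  have h1 : z = Abelian.Ext.comp (Abelian.Ext.mk₀ (ModuleCat.ofHom e.symm.toLinearMap))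
      (Abelian.Ext.comp (Abelian.Ext.mk₀ (ModuleCat.ofHom e.toLinearMap)) z (zero_add k)) (zero_add k) := by
    rw [Abelian.Ext.mk₀_comp_mk₀_assoc]
    have : ModuleCat.ofHom e.symm.toLinearMap ≫ ModuleCat.ofHom e.toLinearMap = 𝟙 _ := by
      rw [← ModuleCat.ofHom_comp]; simp
    rw [this, Abelian.Ext.mk₀_id_comp]
  rw [h1, ← Abelian.Ext.comp_smul]
  exact (congrArg (fun w => Abelian.Ext.comp (Abelian.Ext.mk₀ (ModuleCat.ofHom e.symm.toLinearMap)) w (zero_add k))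
    (h _)).trans (Abelian.Ext.comp_zero ..)

lemma EK.congrR {s : R} {k : ℕ} (e : N ≃ₗ[R] N') (h : EK s k M N) : EK s k M N' := by
  intro z
  have h1 : z = Abelian.Ext.comp (Abelian.Ext.comp z (Abelian.Ext.mk₀ (ModuleCat.ofHom e.symm.toLinearMap)) (add_zero k))
      (Abelian.Ext.mk₀ (ModuleCat.ofHom e.toLinearMap)) (add_zero k) := by
    rw [Abelian.Ext.comp_assoc_of_third_deg_zero, Abelian.Ext.mk₀_comp_mk₀]
    have : ModuleCat.ofHom e.symm.toLinearMap ≫ ModuleCat.ofHom e.toLinearMap = 𝟙 _ := by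
      rw [← ModuleCat.ofHom_comp]; simp
    rw [this, Abelian.Ext.comp_mk₀_id]
  rw [h1, ← Abelian.Ext.smul_comp]
  exact (congrArg (fun w => Abelian.Ext.comp w (Abelian.Ext.mk₀ (ModuleCat.ofHom e.toLinearMap)) (add_zero k))
    (h _)).trans (Abelian.Ext.zero_comp ..)

lemma EZ.congrL {k : ℕ} (e : M ≃ₗ[R] M') (h : EZ R k M N) : EZ R k M' N := by
  rw [← EK_one] at *; exact EK.congrL e h
lemma EZ.congrR {k : ℕ} (e : N ≃ₗ[R] N') (h : EZ R k M N) : EZ R k M N' := by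
  rw [← EK_one] at *; exact EK.congrR e h

/-- zero -/
lemma EZ_of_subsingleton_left [Subsingleton M] (k : ℕ) : EZ R k M N := by
  rw [← EK_one]; exact EK.of_kill (fun m => Subsingleton.elim _ _) k

/-- Bridge from derived functor Ext -/
lemma EZ.of_isZero {k : ℕ} (h : IsZero (((Ext R (ModuleCat.{u} R) (k+1)).obj
        (Opposite.op (ModuleCat.of R M))).obj (ModuleCat.of R N))) : EZ R (k+1) M N := by
  intro z
  let P := projectiveResolution (ModuleCat.of R M)
  have h1 := h.of_iso (P.isoExt (R := R) (k+1) (ModuleCat.of R N)).symm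
  rw [← HomologicalComplex.exactAt_iff_isZero_homology,
    HomologicalComplex.exactAt_iff' _ k (k+1) (k+2) (by simp) (by simp)] at h1
  have h2 := (ShortComplex.ShortExact.moduleCat_exact_iff_function_exact _).1 h1
  obtain ⟨f, hf, rfl⟩ := P.extMk_surjective z (k+2) rfl
  rw [P.extMk_eq_zero_iff f _ _ hf k rfl]
  obtain ⟨g, hg⟩ := (h2 f).1 hf
  exact ⟨g, hg⟩

end
end ExtInterface

noncomputable section SOne

open CategoryTheory Limits
open scoped TensorProduct

variable {R : Type u} [CommRing R]

lemma inj_factor {A B E : Type u} [AddCommGroup A] [Module R A] [AddCommGroup B] [Module R B]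
    [AddCommGroup E] [Module R E] (hE : Module.Injective R E) (a : A →ₗ[R] B) (h : A →ₗ[R] E)
    (hk : ∀ x, a x = 0 → h x = 0) : ∃ h' : B →ₗ[R] E, h' ∘ₗ a = h := by
  have hk' : LinearMap.ker a ≤ LinearMap.ker h := fun x hx => hk x hx
  obtain ⟨h', hh⟩ := hE.out ((LinearMap.ker a).liftQ a le_rfl)
    (by rw [← LinearMap.ker_eq_bot]; exact Submodule.ker_liftQ_eq_bot _ _ _ le_rfl)
    ((LinearMap.ker a).liftQ h hk')
  refine ⟨h', ?_⟩
  ext x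
  exact hh (Submodule.Quotient.mk x)

section
variable {M M' D E W W' : Type u} [AddCommGroup M] [Module R M] [AddCommGroup M'] [Module R M']
  [AddCommGroup D] [Module R D] [AddCommGroup E] [Module R E] [AddCommGroup W] [Module R W]
  [AddCommGroup W'] [Module R W']

variable (M D E) in
def eta : M ⊗[R] (D →ₗ[R] E) →ₗ[R] ((M →ₗ[R] D) →ₗ[R] E) :=
  TensorProduct.lift (LinearMap.mk₂ R (fun m φ => φ ∘ₗ LinearMap.applyₗ m)
    (fun m₁ m₂ φ => by ext f; simp) (fun c m φ => by ext f; simp)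
    (fun m φ₁ φ₂ => by ext f; simp) (fun c m φ => by ext f; simp))

lemma eta_tmul (m : M) (φ : D →ₗ[R] E) (f : M →ₗ[R] D) : eta M D E (m ⊗ₜ φ) f = φ (f m) := by
  simp [eta]

lemma eta_nat (f : M →ₗ[R] M') (z : M ⊗[R] (D →ₗ[R] E)) (g : M' →ₗ[R] D) :
    eta M' D E (LinearMap.rTensor _ f z) g = eta M D E z (g ∘ₗ f) := by
  induction z with
  | zero => simp
  | add x y hx hy => simp only [map_add, LinearMap.add_apply, hx, hy]
  | tmul m φ => simp [eta_tmul]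

lemma eta_free (n : ℕ) : Function.Bijective (eta (R := R) (ULift.{u} (Fin n) → R) D E) := by
  classical
  have form : ∀ z : (ULift.{u} (Fin n) → R) ⊗[R] (D →ₗ[R] E), ∃ φ : ULift.{u} (Fin n) → (D →ₗ[R] E),
      z = ∑ i, (Pi.single i (1:R)) ⊗ₜ φ i := by
    intro z
    induction z with
    | zero => exact ⟨0, by simp⟩
    | add x y hx hy =>
      obtain ⟨φ, rfl⟩ := hx
      obtain ⟨ψ, rfl⟩ := hy
      exact ⟨φ + ψ, by simp [TensorProduct.tmul_add, Finset.sum_add_distrib]⟩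
    | tmul x φ =>
      refine ⟨fun i => x i • φ, ?_⟩
      conv_lhs => rw [pi_eq_sum_univ' x]
      rw [TensorProduct.sum_tmul]
      refine Finset.sum_congr rfl fun i _ => ?_
      rw [← TensorProduct.smul_tmul]
  constructor
  · rw [injective_iff_map_eq_zero]
    intro z hz
    obtain ⟨φ, rfl⟩ := form z
    have : ∀ i, φ i = 0 := by
      intro i
      ext d
      have := LinearMap.congr_fun hz ((LinearMap.proj i : (ULift.{u} (Fin n) → R) →ₗ[R] R).smulRight d)
      rw [map_sum, LinearMap.sum_apply] at this
      simp only [eta_tmul, LinearMap.smulRight_apply, LinearMap.proj_apply, LinearMap.zero_apply] at this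
      rw [Finset.sum_eq_single i] at this
      · simpa using this
      · intro j _ hj; simp [Pi.single_apply, hj.symm]
      · simp
    simp [this]
  · intro h
    refine ⟨∑ i, (Pi.single i (1:R)) ⊗ₜ (h ∘ₗ
      (LinearMap.smulRightₗ (LinearMap.proj i : (ULift.{u} (Fin n) → R) →ₗ[R] R))), ?_⟩
    ext f
    rw [map_sum, LinearMap.sum_apply]
    simp only [eta_tmul, LinearMap.comp_apply]
    rw [← map_sum]
    congr 1
    apply LinearMap.ext; intro x
    rw [LinearMap.sum_apply]
    conv_rhs => rw [LinearMap.pi_apply_eq_sum_univ f x]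
    refine Finset.sum_congr rfl fun i _ => ?_
    simp only [LinearMap.smulRightₗ_apply, LinearMap.proj_apply]
    have e : (Pi.single i (1:R)) = fun j => if i = j then (1:R) else 0 := by
      ext j; simp [Pi.single_apply, eq_comm]
    rw [e]; rfl

lemma exists_fin_cover (M : Type u) [AddCommGroup M] [Module R M] [Module.Finite R M] :
    ∃ (n : ℕ) (g : (ULift.{u} (Fin n) → R) →ₗ[R] M), Function.Surjective g := by
  obtain ⟨n, g, hg⟩ := Module.Finite.exists_fin' R M
  exact ⟨n, g ∘ₗ (LinearEquiv.funCongrLeft R R Equiv.ulift.symm).toLinearMap,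
    hg.comp (LinearEquiv.surjective _)⟩

lemma eta_surj (hE : Module.Injective R E) [Module.Finite R M] : Function.Surjective (eta (R := R) M D E) := by
  intro h
  obtain ⟨n, p, hp⟩ := exists_fin_cover (R := R) M
  obtain ⟨h0, hh⟩ := inj_factor hE (LinearMap.lcomp R D p) h (by
    intro x hx
    have : x = 0 := by
      ext m; obtain ⟨y, rfl⟩ := hp m; exact LinearMap.congr_fun hx y
    rw [this, map_zero])
  obtain ⟨z, rfl⟩ := (eta_free n).2 h0
  refine ⟨LinearMap.rTensor _ p z, ?_⟩
  ext g
  rw [eta_nat, ← hh]; rfl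

lemma eta_bij [IsNoetherianRing R] (hE : Module.Injective R E) [Module.Finite R M] :
    Function.Bijective (eta (R := R) M D E) := by
  refine ⟨?_, eta_surj hE⟩
  rw [injective_iff_map_eq_zero]
  intro z hz
  obtain ⟨n, p, hp⟩ := exists_fin_cover (R := R) M
  obtain ⟨z0, rfl⟩ := LinearMap.rTensor_surjective _ hp z
  obtain ⟨h, hh⟩ := inj_factor hE (LinearMap.lcomp R D (LinearMap.ker p).subtype) (eta _ D E z0) (by
    intro x hx
    have hx' : LinearMap.ker p ≤ LinearMap.ker x := fun y hy =>
      LinearMap.congr_fun hx ⟨y, hy⟩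
    obtain ⟨g, rfl⟩ : ∃ g : M →ₗ[R] D, g ∘ₗ p = x := by
      refine ⟨(LinearMap.ker p).liftQ x hx' ∘ₗ (p.quotKerEquivOfSurjective hp).symm.toLinearMap, ?_⟩
      ext y
      simp [LinearMap.quotKerEquivOfSurjective_symm_apply]
    rw [← eta_nat, hz]; rfl)
  obtain ⟨w, rfl⟩ := eta_surj hE h
  have : LinearMap.rTensor _ (LinearMap.ker p).subtype w = z0 := by
    apply (eta_free n).1
    ext1 g
    rw [eta_nat, ← hh]; rfl
  rw [← this, ← LinearMap.comp_apply, ← LinearMap.rTensor_comp]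
  have : p ∘ₗ (LinearMap.ker p).subtype = 0 := by ext x; exact x.2
  rw [this]; simp

lemma TK_of_EK [IsNoetherianRing R] (hE : Module.Injective R E) {s : R} (i : ℕ) (M : Type u)
    [AddCommGroup M] [Module R M] [Module.Finite R M]
    (h : EK s (i+1) M D) : TK s (i+1) M (D →ₗ[R] E) := by
  induction i generalizing M with
  | zero =>
    obtain ⟨n, p, hp⟩ := exists_fin_cover (R := R) M
    have hS := SES.ker p hp
    obtain ⟨δ, h1, h2⟩ := (torL_les (D →ₗ[R] E) _ p hS.inj hS.ex hS.surj 0).2.1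
    intro z
    have hδ : δ (s • z) = 0 := by
      apply (tor0 _ _).injective
      apply (eta_bij hE).1
      rw [map_zero, map_zero, map_smul, map_smul, map_smul]
      ext φ
      obtain ⟨ψ, hψ⟩ := EK.ext1 hS h φ
      have e1 := eta_nat (LinearMap.ker p).subtype (tor0 _ _ (δ z)) ψ
      rw [← tor0_torL, h2.apply_apply_eq_zero, map_zero, map_zero, hψ, map_smul] at e1
      exact e1.symm
    obtain ⟨b, hb⟩ := (h1 _).1 hδ
    rw [← hb, TZ.flatL 0 _ _ b, map_zero]
  | succ i ih =>
    obtain ⟨n, p, hp⟩ := exists_fin_cover (R := R) M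
    have hS := SES.ker p hp
    have := TK.L3 hS (TK_one.2 (TZ.flatL _ _ _)) (ih (LinearMap.ker p) (by
      have := EK.L1 hS (EK_one.2 (EZ.proj _ _ _)) h
      rwa [one_mul] at this))
    rwa [one_mul] at this

lemma TZ_of_EZ [IsNoetherianRing R] (hE : Module.Injective R E) (i : ℕ) (M : Type u)
    [AddCommGroup M] [Module R M] [Module.Finite R M]
    (h : EZ R (i+1) M D) : TZ R (i+1) M (D →ₗ[R] E) := by
  rw [← TK_one]; exact TK_of_EK hE i M (EK_one.2 h)

variable (D W) in
def ev : D ⊗[R] (D →ₗ[R] W) →ₗ[R] W :=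
  TensorProduct.lift (LinearMap.flip LinearMap.id)

lemma ev_tmul (d : D) (φ : D →ₗ[R] W) : ev D W (d ⊗ₜ φ) = φ d := by simp [ev]

lemma ev_nat (f : W →ₗ[R] W') (z : D ⊗[R] (D →ₗ[R] W)) :
    ev D W' (LinearMap.lTensor D (LinearMap.llcomp R D W W' f) z) = f (ev D W z) := by
  induction z with
  | zero => simp
  | add x y hx hy => simp only [map_add, hx, hy]
  | tmul m φ => simp [ev_tmul]

end

/-- unpacked dualizing module -/
structure DM (R : Type u) [CommRing R] (D : Type u) [AddCommGroup D] [Module R D] (n : ℕ) : Prop where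
  fin : Module.Finite R D
  id : ∀ (M : Type u) [AddCommGroup M] [Module R M] (i : ℕ), n < i → EZ R i M D
  endo : Function.Bijective (fun r : R => (r • (LinearMap.id : D →ₗ[R] D)))
  self : ∀ i, EZ R (i+1) D D

lemma IsDualizingModule.dm {D : Type u} [AddCommGroup D] [Module R D] (h : IsDualizingModule R D) :
    ∃ n, DM R D n := by
  obtain ⟨h1, ⟨n, h2⟩, h3, h4⟩ := h
  refine ⟨n, h1, ?_, h3, fun i => EZ.of_isZero (h4 _ (by omega))⟩
  intro M _ _ i hi
  obtain ⟨j, rfl⟩ : ∃ j, i = j + 1 := ⟨i - 1, by omega⟩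
  exact EZ.of_isZero (h2 M _ _ _ hi)

section
variable [IsNoetherianRing R] {D E : Type u} [AddCommGroup D] [Module R D] [AddCommGroup E] [Module R E] {n : ℕ}

lemma DM.ev_bij (h : DM R D n) (hE : Module.Injective R E) : Function.Bijective (ev (R := R) D E) := by
  have := h.fin
  let a : ((D →ₗ[R] D) →ₗ[R] E) →ₗ[R] E := LinearMap.applyₗ LinearMap.id
  have ha : Function.Bijective a := by
    constructor
    · rw [injective_iff_map_eq_zero]
      intro f hf
      ext g
      obtain ⟨r, rfl⟩ := h.endo.2 g
      have : f LinearMap.id = 0 := hf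
      simp [this]
    · intro e
      let L : R →ₗ[R] (D →ₗ[R] D) := LinearMap.toSpanSingleton R _ LinearMap.id
      let Le : R ≃ₗ[R] (D →ₗ[R] D) := LinearEquiv.ofBijective L h.endo
      refine ⟨(LinearMap.toSpanSingleton R _ e) ∘ₗ Le.symm.toLinearMap, ?_⟩
      change (LinearMap.toSpanSingleton R _ e) (Le.symm LinearMap.id) = e
      have : Le.symm LinearMap.id = 1 := by
        rw [LinearEquiv.symm_apply_eq]
        change LinearMap.id = L 1
        simp [L]
      rw [this]; simp
  have e : ev (R := R) D E = a ∘ₗ eta D D E := by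
    apply TensorProduct.ext'
    intro d φ
    rw [ev_tmul]
    simp [a, eta_tmul]
  rw [e]
  exact ha.comp (eta_bij hE)

lemma DM.fd (h : DM R D n) (hE : Module.Injective R E) (N : Type u) [AddCommGroup N] [Module R N]
    (i : ℕ) (hi : n < i) : TZ R i N (D →ₗ[R] E) := by
  apply TZ.of_fg
  intro U hU z
  obtain ⟨j, rfl⟩ : ∃ j, i = j + 1 := ⟨i - 1, by omega⟩
  rw [TZ_of_EZ hE j U (h.id U _ hi) z, map_zero]

lemma DM.torD (h : DM R D n) (hE : Module.Injective R E) (i : ℕ) : TZ R (i+1) D (D →ₗ[R] E) := by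
  have := h.fin
  exact TZ_of_EZ hE i D (h.self i)
end
end SOne

noncomputable section SFour

open CategoryTheory Limits
open scoped TensorProduct

variable {R : Type u} [CommRing R]

/-- injective dimension ≤ m -/
def ID (R : Type u) [CommRing R] (m : ℕ) (M : Type u) [AddCommGroup M] [Module R M] : Prop :=
  ∀ (N : Type u) [AddCommGroup N] [Module R N] (i : ℕ), m < i → EZ R i N M

lemma ID_of_quot {m : ℕ} {M : Type u} [AddCommGroup M] [Module R M]
    (h : ∀ (J : Ideal R) (i : ℕ), m < i → EZ R i (R ⧸ J) M) : ID R m M := by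
  induction m generalizing M with
  | zero =>
    intro N _ _ i hi
    obtain ⟨j, rfl⟩ : ∃ j, i = j + 1 := ⟨i - 1, by omega⟩
    exact EZ.inj _ _ _ (injective_of_EZ M fun J => h J 1 (by omega))
  | succ m ih =>
    obtain ⟨I, _, _, f, hI, hf⟩ := exists_inj (R := R) M
    have hS := SES.coker f hf
    have hC := ih (M := I ⧸ LinearMap.range f) (by
      intro J i hi
      obtain ⟨j, rfl⟩ : ∃ j, i = j + 1 := ⟨i - 1, by omega⟩
      exact EZ.R3 hS (EZ.inj _ _ _ hI) (h J _ (by omega)))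
    intro N _ _ i hi
    obtain ⟨j, rfl⟩ : ∃ j, i = j + 1 := ⟨i - 1, by omega⟩
    exact EZ.R1 hS (hC N j (by omega)) (EZ.inj _ _ _ hI)

/-- if Ext from injectives to Y vanish then so do those from finite injective dimension. -/
lemma EZ_of_ID {Y : Type u} [AddCommGroup Y] [Module R Y]
    (h : ∀ (I : Type u) [AddCommGroup I] [Module R I], Module.Injective R I → ∀ i, EZ R (i+1) I Y)
    {m : ℕ} {M : Type u} [AddCommGroup M] [Module R M] (hM : ID R m M) (i : ℕ) : EZ R (i+1) M Y := by
  induction m generalizing M i with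
  | zero => exact h M (injective_of_EZ M fun J => hM _ 1 (by omega)) i
  | succ m ih =>
    obtain ⟨I, _, _, f, hI, hf⟩ := exists_inj (R := R) M
    have hS := SES.coker f hf
    refine EZ.L1 hS (h I hI i) (ih ?_ _)
    intro N _ _ i hi
    obtain ⟨j, rfl⟩ : ∃ j, i = j + 1 := ⟨i - 1, by omega⟩
    exact EZ.R3 hS (EZ.inj _ _ _ hI) (hM N _ (by omega))

section theta
variable {N N' M F : Type u} [AddCommGroup N] [Module R N] [AddCommGroup M] [Module R M]
  [AddCommGroup F] [Module R F] [AddCommGroup N'] [Module R N']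

variable (N M F) in
abbrev theta : (N →ₗ[R] M) ⊗[R] F →ₗ[R] (N →ₗ[R] M ⊗[R] F) := TensorProduct.rTensorHomToHomRTensor (RingHom.id R) N M F

lemma theta_nat (p : N →ₗ[R] N') (z : (N' →ₗ[R] M) ⊗[R] F) :
    theta N M F (LinearMap.rTensor F (LinearMap.lcomp R M p) z) = theta N' M F z ∘ₗ p := by
  induction z with
  | zero => simp
  | add x y hx hy => simp only [map_add, hx, hy, LinearMap.add_comp]
  | tmul f x => ext n; simp

lemma theta_free (n : ℕ) : Function.Bijective (theta (R := R) (ULift.{u} (Fin n) → R) M F) := by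
  have h := rTensorHomEquivHomRTensor_toLinearMap (R := R) (M := ULift.{u} (Fin n) → R) (P := M) (Q := F)
  unfold theta; rw [← h]
  exact LinearEquiv.bijective _

lemma theta_inj [Module.Finite R N] [Module.Flat R F] : Function.Injective (theta (R := R) N M F) := by
  obtain ⟨n, p, hp⟩ := exists_fin_cover (R := R) N
  intro x y hxy
  have h1 : Function.Injective (LinearMap.rTensor F (LinearMap.lcomp R M p)) := by
    apply Module.Flat.rTensor_preserves_injective_linearMap
    intro a b hab
    ext m; obtain ⟨y, rfl⟩ := hp m; exact LinearMap.congr_fun hab y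
  apply h1
  apply (theta_free n).1
  rw [theta_nat, theta_nat, hxy]

lemma theta_bij [IsNoetherianRing R] [Module.Finite R N] [Module.Flat R F] :
    Function.Bijective (theta (R := R) N M F) := by
  refine ⟨theta_inj, fun φ => ?_⟩
  obtain ⟨n, p, hp⟩ := exists_fin_cover (R := R) N
  obtain ⟨z, hz⟩ := (theta_free n).2 (φ ∘ₗ p)
  have hS := SES.ker p hp
  have hz0 : LinearMap.rTensor F (LinearMap.lcomp R M (LinearMap.ker p).subtype) z = 0 := by
    apply theta_inj
    rw [theta_nat, hz, map_zero, LinearMap.comp_assoc, hS.ex.linearMap_comp_eq_zero, LinearMap.comp_zero]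
  have hex : Function.Exact (LinearMap.lcomp R M p) (LinearMap.lcomp R M (LinearMap.ker p).subtype) := by
    intro f
    constructor
    · intro hf
      have hx' : LinearMap.ker p ≤ LinearMap.ker f := fun y hy =>
        LinearMap.congr_fun hf ⟨y, hy⟩
      refine ⟨(LinearMap.ker p).liftQ f hx' ∘ₗ (p.quotKerEquivOfSurjective hp).symm.toLinearMap, ?_⟩
      ext y
      simp [LinearMap.quotKerEquivOfSurjective_symm_apply]
    · rintro ⟨g, rfl⟩
      ext ⟨y, hy⟩
      have : p y = 0 := hy
      simp [this]
  obtain ⟨w, rfl⟩ := (Module.Flat.rTensor_exact F hex z).1 hz0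
  refine ⟨w, ?_⟩
  rw [theta_nat] at hz
  ext m; obtain ⟨y, rfl⟩ := hp m; exact LinearMap.congr_fun hz y

lemma EZ.tensor_flat [IsNoetherianRing R] [Module.Finite R N] [Module.Flat R F] (i : ℕ)
    (h : EZ R (i+1) N M) : EZ R (i+1) N (M ⊗[R] F) := by
  induction i generalizing N with
  | zero =>
    obtain ⟨n, p, hp⟩ := exists_fin_cover (R := R) N
    have hS := SES.ker p hp
    refine EZ.of_ext1 hS (EZ.proj _ _ _) fun φ => ?_
    obtain ⟨z, rfl⟩ := (theta_bij).2 φ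
    have h1 : Function.Surjective (LinearMap.lcomp R M (LinearMap.ker p).subtype) := fun f =>
      EZ.ext1 hS h f
    obtain ⟨w, rfl⟩ := LinearMap.rTensor_surjective F h1 z
    exact ⟨theta _ M F w, (theta_nat _ _).symm⟩
  | succ i ih =>
    obtain ⟨n, p, hp⟩ := exists_fin_cover (R := R) N
    have hS := SES.ker p hp
    exact EZ.L3 hS (ih (EZ.L1 hS (EZ.proj _ _ _) h)) (EZ.proj _ _ _)

lemma ID.tensor_flat [IsNoetherianRing R] [Module.Flat R F] {m : ℕ} (h : ID R m M) :
    ID R m (M ⊗[R] F) := by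
  apply ID_of_quot
  intro J i hi
  obtain ⟨j, rfl⟩ : ∃ j, i = j + 1 := ⟨i - 1, by omega⟩
  exact EZ.tensor_flat _ (h _ _ hi)
end theta

section adj
variable {D Y W P : Type u} [AddCommGroup D] [Module R D] [AddCommGroup Y] [Module R Y]
  [AddCommGroup W] [Module R W] [AddCommGroup P] [Module R P]

lemma EZ_tensor_proj [Module.Projective R P] (h : ∀ i, EZ R (i+1) D W) (i : ℕ) :
    EZ R (i+1) (D ⊗[R] P) W := by
  induction i generalizing W with
  | zero =>
    obtain ⟨I, _, _, f, hI, hf⟩ := exists_inj (R := R) W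
    have hS := SES.coker f hf
    refine EZ.of_lift hS (EZ.inj _ _ _ hI) fun φ => ?_
    let φ' : P →ₗ[R] (D →ₗ[R] I ⧸ LinearMap.range f) := (TensorProduct.curry φ).flip
    have hs : Function.Surjective (LinearMap.llcomp R D I (I ⧸ LinearMap.range f) (LinearMap.range f).mkQ) :=
      fun g => EZ.lift hS (h 0) g
    obtain ⟨ψ, hψ⟩ := Module.projective_lifting_property _ φ' hs
    refine ⟨TensorProduct.lift ψ.flip, ?_⟩
    apply TensorProduct.ext'
    intro d p
    have := LinearMap.congr_fun (LinearMap.congr_fun hψ p) d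
    simpa [φ'] using this
  | succ i ih =>
    obtain ⟨I, _, _, f, hI, hf⟩ := exists_inj (R := R) W
    have hS := SES.coker f hf
    exact EZ.R1 hS (ih fun j => EZ.R3 hS (EZ.inj _ _ _ hI) (h _)) (EZ.inj _ _ _ hI)

lemma SES.lTensor {A B C : Type u} [AddCommGroup A] [Module R A] [AddCommGroup B] [Module R B]
    [AddCommGroup C] [Module R C] {f : A →ₗ[R] B} {g : B →ₗ[R] C} (h : SES f g)
    (hi : TZ R 1 D B) (hT : TZ R 1 D C) : SES (LinearMap.lTensor D f) (LinearMap.lTensor D g) :=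
  ⟨(TZ.R_one h hi).1 hT, lTensor_exact D h.ex h.surj, LinearMap.lTensor_surjective D h.surj⟩

lemma EZ_adj (hT : ∀ i, TZ R (i+1) D Y) (hW : ∀ i, EZ R (i+1) D W) (i : ℕ) :
    EZ R (i+1) (D ⊗[R] Y) W ↔ EZ R (i+1) Y (D →ₗ[R] W) := by
  induction i generalizing Y with
  | zero =>
    obtain ⟨P, _, _, p, _, hp⟩ := exists_cover (R := R) Y
    have hS := SES.ker p hp
    have hS' := hS.lTensor (D := D) (TZ.proj _ _ _) (hT 0)
    constructor
    · intro H
      refine EZ.of_ext1 hS (EZ.proj _ _ _) fun φ => ?_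
      obtain ⟨ψ, hψ⟩ := EZ.ext1 hS' H (TensorProduct.lift φ.flip)
      refine ⟨(TensorProduct.curry ψ).flip, ?_⟩
      apply LinearMap.ext; intro k
      apply LinearMap.ext; intro d
      have := LinearMap.congr_fun hψ (d ⊗ₜ k)
      simpa using this
    · intro H
      refine EZ.of_ext1 hS' (EZ_tensor_proj hW _) fun φ => ?_
      obtain ⟨ψ, hψ⟩ := EZ.ext1 hS H (TensorProduct.curry φ).flip
      refine ⟨TensorProduct.lift ψ.flip, ?_⟩
      apply TensorProduct.ext'
      intro d k
      have := LinearMap.congr_fun (LinearMap.congr_fun hψ k) d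
      simpa using this
  | succ i ih =>
    obtain ⟨P, _, _, p, _, hp⟩ := exists_cover (R := R) Y
    have hS := SES.ker p hp
    have hS' := hS.lTensor (D := D) (TZ.proj _ _ _) (hT 0)
    have ih' := ih (Y := LinearMap.ker p) (fun j => TZ.R1 hS (hT _) (TZ.proj _ _ _))
    constructor
    · intro H
      exact EZ.L3 hS (ih'.1 (EZ.L1 hS' (EZ_tensor_proj hW _) H)) (EZ.proj _ _ _)
    · intro H
      exact EZ.L3 hS' (ih'.2 (EZ.L1 hS (EZ.proj _ _ _) H)) (EZ_tensor_proj hW _)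

/-- finite flat dimension plus vanishing into flats gives finite projective dimension -/
lemma pd_of_fd {m : ℕ} {Y : Type u} [AddCommGroup Y] [Module R Y]
    (h : ∀ (N : Type u) [AddCommGroup N] [Module R N] (i : ℕ), m < i → TZ R i N Y)
    (h2 : ∀ (F : Type u) [AddCommGroup F] [Module R F], Module.Flat R F → EZ R (m+1) Y F)
    (V : Type u) [AddCommGroup V] [Module R V] (i : ℕ) (hi : m < i) : EZ R i Y V := by
  induction m generalizing Y i with
  | zero =>
    obtain ⟨P, _, _, p, _, hp⟩ := exists_cover (R := R) Y
    have hS := SES.ker p hp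
    have hK : Module.Flat R (LinearMap.ker p) := flat_of_TZ _ fun I _ =>
      TZ.R1 hS (h _ _ (by omega)) (TZ.proj _ _ _)
    obtain ⟨ψ, hψ⟩ := EZ.lift hS (h2 _ hK) LinearMap.id
    have := Module.Projective.of_split ψ p hψ
    obtain ⟨j, rfl⟩ : ∃ j, i = j + 1 := ⟨i - 1, by omega⟩
    exact EZ.proj _ _ _
  | succ m ih =>
    obtain ⟨P, _, _, p, _, hp⟩ := exists_cover (R := R) Y
    have hS := SES.ker p hp
    obtain ⟨j, rfl⟩ : ∃ j, i = j + 1 := ⟨i - 1, by omega⟩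
    refine EZ.L3 hS (ih (Y := LinearMap.ker p) ?_ ?_ j (by omega)) (EZ.proj _ _ _)
    · intro N _ _ i hi
      obtain ⟨j, rfl⟩ : ∃ j, i = j + 1 := ⟨i - 1, by omega⟩
      exact TZ.R1 hS (h _ _ (by omega)) (TZ.proj _ _ _)
    · intro F _ _ hF
      exact EZ.L1 hS (EZ.proj _ _ _) (h2 F hF)

variable [IsNoetherianRing R] {n : ℕ}

lemma DM.ID (h : DM R D n) : ID R n D := fun N _ _ i hi => h.id N i hi

lemma DM.homD (h : DM R D n) (F : Type u) [AddCommGroup F] [Module R F] [Module.Flat R F] :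
    Nonempty ((D →ₗ[R] D ⊗[R] F) ≃ₗ[R] F) := by
  have := h.fin
  let L : R →ₗ[R] (D →ₗ[R] D) := LinearMap.toSpanSingleton R _ LinearMap.id
  let Le : R ≃ₗ[R] (D →ₗ[R] D) := LinearEquiv.ofBijective L h.endo
  exact ⟨(LinearEquiv.ofBijective _ (theta_bij (R := R) (N := D) (M := D) (F := F))).symm.trans
    ((TensorProduct.congr Le.symm (LinearEquiv.refl R F)).trans (TensorProduct.lid R F))⟩

lemma DM.pd (h : DM R D n) {I : Type u} [AddCommGroup I] [Module R I] (hI : Module.Injective R I)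
    (V : Type u) [AddCommGroup V] [Module R V] (i : ℕ) (hi : n < i) : EZ R i (D →ₗ[R] I) V := by
  have := h.fin
  refine pd_of_fd (fun N _ _ i hi => h.fd hI N i hi) ?_ V i hi
  intro F _ _ hF
  obtain ⟨e⟩ := h.homD F
  refine EZ.congrR e ?_
  rw [← EZ_adj (h.torD hI) (fun i => EZ.tensor_flat i (h.self i))]
  exact (h.ID.tensor_flat) _ _ (by omega)

/-- Bass-class-like vanishing in high degree -/
lemma DM.high (h : DM R D n) {I : Type u} [AddCommGroup I] [Module R I] (hI : Module.Injective R I)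
    {W : Type u} [AddCommGroup W] [Module R W] (hW : ∀ i, EZ R (i+1) D W) (i : ℕ) (hi : n < i) :
    EZ R i I W := by
  obtain ⟨j, rfl⟩ : ∃ j, i = j + 1 := ⟨i - 1, by omega⟩
  refine EZ.congrL (LinearEquiv.ofBijective _ (h.ev_bij hI)) ?_
  rw [EZ_adj (h.torD hI) hW]
  exact h.pd hI _ _ hi
end adj
end SFour

noncomputable section FamSec

open CategoryTheory Limits
open scoped TensorProduct

variable {R : Type u} [CommRing R]

lemma int_shift {P : ℤ → Prop} (h : ∀ j, P (j+1)) (j : ℤ) : P j := by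
  have := h (j-1); rwa [sub_add_cancel] at this

structure Fam (R : Type u) [CommRing R] where
  Z : ℤ → Type u
  E : ℤ → Type u
  [zg : ∀ i, AddCommGroup (Z i)]
  [zm : ∀ i, Module R (Z i)]
  [eg : ∀ i, AddCommGroup (E i)]
  [em : ∀ i, Module R (E i)]
  ι : ∀ i, Z i →ₗ[R] E i
  π : ∀ i, E (i+1) →ₗ[R] Z i
  ses : ∀ i, SES (ι (i+1)) (π i)
  injE : ∀ i, Module.Injective R (E i)

attribute [instance] Fam.zg Fam.zm Fam.eg Fam.em

lemma Fam.ι_inj (F : Fam R) (i : ℤ) : Function.Injective (F.ι i) :=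
  int_shift (P := fun i => Function.Injective (F.ι i)) (fun j => (F.ses j).inj) i

lemma Fam.shift (F : Fam R) {D : Type u} [AddCommGroup D] [Module R D]
    (hD : ∀ j, EZ R 1 D (F.Z j)) (i : ℕ) (j : ℤ) : EZ R (i+1) D (F.Z j) := by
  induction i generalizing j with
  | zero => exact hD j
  | succ i ih =>
    exact int_shift (P := fun j => EZ R (i+1+1) D (F.Z j))
      (fun j => EZ.R1 (F.ses j) (ih j) (EZ.inj _ _ _ (F.injE _))) j

lemma Fam.unshift (F : Fam R) {I : Type u} [AddCommGroup I] [Module R I] {n : ℕ}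
    (hD : ∀ i j, n < i → EZ R i I (F.Z j)) (i : ℕ) (j : ℤ) : EZ R (i+1) I (F.Z j) := by
  obtain ⟨m, hm⟩ : ∃ m, n < m + i := ⟨n+1, by omega⟩
  induction m generalizing i j with
  | zero => exact hD _ _ (by omega)
  | succ m ih =>
    exact EZ.R3 (F.ses j) (EZ.inj _ _ _ (F.injE _)) (ih (i+1) (j+1) (by omega))

/-- criterion -/
lemma Fam.crit [IsNoetherianRing R] (F : Fam R) {D : Type u} [AddCommGroup D] [Module R D] {n : ℕ} (h : DM R D n)
    (hD : ∀ j, EZ R 1 D (F.Z j)) {I : Type u} [AddCommGroup I] [Module R I]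
    (hI : Module.Injective R I) (j : ℤ) : EZ R 1 I (F.Z j) :=
  F.unshift (n := n) (fun i j hi => h.high hI (fun i => F.shift hD i j) i hi) 0 j

lemma Fam.toGI (F : Fam R)
    (h : ∀ (I : Type u) [AddCommGroup I] [Module R I], Module.Injective R I → ∀ j, EZ R 1 I (F.Z j)) :
    IsGorensteinInjective R (F.Z (-1+1)) := by
  have hker : ∀ i, LinearMap.ker (F.ι i ∘ₗ F.π i) = LinearMap.range (F.ι (i+1)) := by
    intro i
    rw [LinearMap.ker_comp_of_ker_eq_bot _ (LinearMap.ker_eq_bot.2 (F.ι_inj i))]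
    exact LinearMap.exact_iff.1 (F.ses i).ex
  refine ⟨{ E := F.E, d := fun i => F.ι i ∘ₗ F.π i, inj := F.injE, exact := ?_, homExact := ?_, equiv := ?_ }⟩
  · intro i
    rw [hker, LinearMap.range_comp_of_range_eq_top _ (LinearMap.range_eq_top.2 (F.ses _).surj)]
  · intro I _ _ hI i g
    constructor
    · intro hg
      have hr : ∀ x, g x ∈ LinearMap.range (F.ι (i+1)) := fun x => by
        rw [← hker]; exact LinearMap.congr_fun hg x
      let e := LinearEquiv.ofInjective (F.ι (i+1)) (F.ι_inj _)
      let g' : I →ₗ[R] F.Z (i+1) := e.symm.toLinearMap ∘ₗ g.codRestrict _ hr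
      have hg' : ∀ x, F.ι (i+1) (g' x) = g x := fun x => by
        have : ((e (e.symm ⟨g x, hr x⟩)) : F.E (i+1)) = g x := by rw [e.apply_symm_apply]
        exact this
      obtain ⟨f, hf⟩ := EZ.lift (F.ses (i+1)) (h I hI _) g'
      refine ⟨f, ?_⟩
      ext x
      have := LinearMap.congr_fun hf x
      simp only [LinearMap.comp_apply] at this ⊢
      rw [this, hg']
    · rintro ⟨f, rfl⟩
      ext x
      simp only [LinearMap.comp_apply, LinearMap.zero_apply]
      rw [(F.ses i).ex.apply_apply_eq_zero, map_zero]
  · exact (LinearEquiv.ofInjective (F.ι (-1+1)) (F.ι_inj _)).trans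
      (LinearEquiv.ofEq _ _ (hker (-1)).symm)

lemma IsGorensteinInjective.congr {G H : Type u} [AddCommGroup G] [Module R G] [AddCommGroup H] [Module R H]
    (e : H ≃ₗ[R] G) (h : IsGorensteinInjective R G) : IsGorensteinInjective R H := by
  obtain ⟨h⟩ := h
  letI := h.acg
  letI := h.mod
  obtain ⟨E, d, inj, ex, he, eq⟩ := h
  exact ⟨⟨E, d, inj, ex, he, e.trans eq⟩⟩

lemma IsGorensteinInjective.fam {G : Type u} [AddCommGroup G] [Module R G] (h : IsGorensteinInjective R G) :
    ∃ F : Fam R, Nonempty (G ≃ₗ[R] F.Z (-1+1)) ∧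
      ∀ (I : Type u) [AddCommGroup I] [Module R I], Module.Injective R I → ∀ j, EZ R 1 I (F.Z j) := by
  obtain ⟨h⟩ := h
  letI := h.acg
  letI := h.mod
  let F : Fam R := 
    { Z := fun i => LinearMap.range (h.d i)
      E := h.E
      ι := fun i => (LinearMap.range (h.d i)).subtype
      π := fun i => (h.d i).rangeRestrict
      ses := fun i => ⟨Subtype.val_injective, by
        rw [LinearMap.exact_iff, LinearMap.ker_rangeRestrict, Submodule.range_subtype, h.exact],
        LinearMap.surjective_rangeRestrict _⟩
      injE := h.inj }
  refine ⟨F, ⟨h.equiv.trans (LinearEquiv.ofEq _ _ (h.exact (-1)).symm)⟩, ?_⟩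
  intro I _ _ hI j
  apply int_shift (P := fun j => EZ R 1 I (F.Z j))
  intro j
  apply int_shift (P := fun j => EZ R 1 I (F.Z (j+1)))
  intro j
  refine EZ.of_lift (F.ses (j+1)) (EZ.inj _ _ _ (F.injE _)) fun φ => ?_
  obtain ⟨f, hf⟩ := (h.homExact I hI j (F.ι (j+1) ∘ₗ φ)).1 (by
    ext x
    have : h.d j (F.ι (j+1) (φ x)) = 0 := by
      have h1 : ((φ x).1) ∈ LinearMap.ker (h.d j) := by rw [← h.exact]; exact (φ x).2
      exact h1
    exact this)
  refine ⟨f, ?_⟩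
  ext x
  exact LinearMap.congr_fun hf x


section Sthree
variable [IsNoetherianRing R] {D : Type u} [AddCommGroup D] [Module R D] {n : ℕ}

abbrev hm (D : Type u) [AddCommGroup D] [Module R D] {W W' : Type u} [AddCommGroup W] [Module R W]
    [AddCommGroup W'] [Module R W'] (f : W →ₗ[R] W') : (D →ₗ[R] W) →ₗ[R] (D →ₗ[R] W') :=
  LinearMap.llcomp R D W W' f

lemma SES.hom {A B C : Type u} [AddCommGroup A] [Module R A] [AddCommGroup B] [Module R B]
    [AddCommGroup C] [Module R C] {f : A →ₗ[R] B} {g : B →ₗ[R] C} (h : SES f g)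
    (hA : EZ R 1 D A) : SES (hm D f) (hm D g) := by
  refine ⟨?_, ?_, fun φ => EZ.lift h hA φ⟩
  · intro a b hab
    ext x
    exact h.inj (LinearMap.congr_fun hab x)
  · intro φ
    constructor
    · intro hφ
      have hr : ∀ x, φ x ∈ LinearMap.range f := fun x => (h.ex _).1 (LinearMap.congr_fun hφ x)
      let e := LinearEquiv.ofInjective f h.inj
      refine ⟨e.symm.toLinearMap ∘ₗ φ.codRestrict _ hr, ?_⟩
      ext x
      have : ((e (e.symm ⟨φ x, hr x⟩)) : B) = φ x := by rw [e.apply_symm_apply]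
      exact this
    · rintro ⟨ψ, rfl⟩
      ext x
      exact h.ex.apply_apply_eq_zero _

lemma Fam.sesH (F : Fam R) (hD : ∀ j, EZ R 1 D (F.Z j)) (j : ℤ) :
    SES (hm D (F.ι (j+1))) (hm D (F.π j)) := (F.ses j).hom (hD _)

lemma Fam.ev_surj (F : Fam R) (h : DM R D n) (hD : ∀ j, EZ R 1 D (F.Z j)) (j : ℤ) :
    Function.Surjective (ev (R := R) D (F.Z j)) := by
  intro z
  obtain ⟨y, rfl⟩ := (F.ses j).surj z
  obtain ⟨w, rfl⟩ := (h.ev_bij (F.injE (j+1))).2 y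
  exact ⟨_, ev_nat (F.π j) w⟩

lemma Fam.lT_inj (F : Fam R) (h : DM R D n) (hD : ∀ j, EZ R 1 D (F.Z j)) (j : ℤ) :
    Function.Bijective (ev (R := R) D (F.Z j)) := by
  refine ⟨?_, F.ev_surj h hD j⟩
  rw [injective_iff_map_eq_zero]
  intro z hz
  have hS := F.sesH hD j
  obtain ⟨w, rfl⟩ := LinearMap.lTensor_surjective D hS.surj z
  have h1 : F.π j (ev D _ w) = 0 := by rw [← hz]; exact (ev_nat _ _).symm
  obtain ⟨y, hy⟩ := ((F.ses j).ex _).1 h1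
  obtain ⟨v, rfl⟩ := F.ev_surj h hD _ y
  have h2 : w = LinearMap.lTensor D (hm D (F.ι (j+1))) v := by
    apply (h.ev_bij (F.injE (j+1))).1
    rw [← hy]; exact (ev_nat _ _).symm
  rw [h2]
  have := lTensor_exact D hS.ex hS.surj
  exact this.apply_apply_eq_zero v

lemma Fam.torD (F : Fam R) (h : DM R D n) (hD : ∀ j, EZ R 1 D (F.Z j)) (i : ℕ) (j : ℤ) :
    TZ R (i+1) D (D →ₗ[R] F.Z j) := by
  induction i generalizing j with
  | zero =>
    rw [TZ.R_one (F.sesH hD j) (h.torD (F.injE _) 0)]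
    intro a b hab
    apply (F.lT_inj h hD (j+1)).1
    apply (F.ses j).inj
    rw [← ev_nat, ← ev_nat]
    exact congrArg _ hab
  | succ i ih => exact TZ.R3 (F.sesH hD j) (h.torD (F.injE _) _) (ih (j+1))
end Sthree
end FamSec

noncomputable section SFive

open CategoryTheory Limits
open scoped TensorProduct

variable {R : Type u} [CommRing R]

lemma fg_filtration [IsNoetherianRing R] (c : Ideal R)
    (P : ∀ (M : Type u) [AddCommGroup M] [Module R M], Prop)
    (hS : ∀ {A B C : Type u} [AddCommGroup A] [Module R A] [AddCommGroup B] [Module R B]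
      [AddCommGroup C] [Module R C] {f : A →ₗ[R] B} {g : B →ₗ[R] C}, SES f g → P A → P C → P B)
    (h0 : ∀ (M : Type u) [AddCommGroup M] [Module R M] [Subsingleton M], P M)
    (hq : ∀ (q : Ideal R) [q.IsPrime], c ≤ q → P (R ⧸ q))
    (M : Type u) [AddCommGroup M] [Module R M] [hM : Module.Finite R M]
    (hc : ∀ r ∈ c, ∀ m : M, r • m = 0) : P M := by
  induction hM using IsNoetherianRing.induction_on_isQuotientEquivQuotientPrime (A := R) with
  | subsingleton N => exact h0 N
  | quotient N p e =>
    refine hS (f := (0 : PUnit.{u+1} →ₗ[R] N)) (g := e.toLinearMap) ?_ (h0 _) (hq p.1 ?_)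
    · exact ⟨fun a b _ => Subsingleton.elim _ _, by
        rw [LinearMap.exact_iff, LinearMap.range_zero, LinearEquiv.ker], e.surjective⟩
    · intro r hr
      have := hc r hr (e.symm 1)
      have h2 : r • (1 : R ⧸ p.1) = 0 := by
        rw [← e.apply_symm_apply (1 : R ⧸ p.1), ← map_smul, this, map_zero]
      rwa [Algebra.smul_def, mul_one, Ideal.Quotient.algebraMap_eq, Ideal.Quotient.eq_zero_iff_mem] at h2
  | exact N₁ N₂ N₃ f g hf hg hfg h1 h3 =>
    refine hS ⟨hf, hfg, hg⟩ (h1 ?_) (h3 ?_)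
    · intro r hr m; apply hf; rw [map_smul, hc r hr, map_zero]
    · intro r hr m; obtain ⟨m, rfl⟩ := hg m; rw [← map_smul, hc r hr, map_zero]

def PK (p : Ideal R) (i : ℕ) (M N : Type u) [AddCommGroup M] [Module R M] [AddCommGroup N] [Module R N] :
    Prop := ∃ s, s ∉ p ∧ EK s i M N

section
variable {A B C M N X Y M' N' : Type u} [AddCommGroup A] [Module R A] [AddCommGroup B] [Module R B]
  [AddCommGroup C] [Module R C] [AddCommGroup N] [Module R N] [AddCommGroup M] [Module R M]
  [AddCommGroup X] [Module R X] [AddCommGroup Y] [Module R Y]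
  [AddCommGroup N'] [Module R N'] [AddCommGroup M'] [Module R M']

variable {p : Ideal R} [hp : p.IsPrime]

lemma nmem_mul {s t : R} (hs : s ∉ p) (ht : t ∉ p) : s * t ∉ p := fun h =>
  (hp.mem_or_mem h).elim hs ht

section rules
variable {f : A →ₗ[R] B} {g : B →ₗ[R] C} (h : SES f g) {k : ℕ}
include h hp
lemma PK.R2 : PK p k X A → PK p k X C → PK p k X B := by
  rintro ⟨s, hs, a⟩ ⟨t, ht, b⟩; exact ⟨_, nmem_mul hs ht, EK.R2 h a b⟩
lemma PK.R3 : PK p k X B → PK p (k+1) X A → PK p k X C := by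
  rintro ⟨s, hs, a⟩ ⟨t, ht, b⟩; exact ⟨_, nmem_mul hs ht, EK.R3 h a b⟩
lemma PK.R1 : PK p k X C → PK p (k+1) X B → PK p (k+1) X A := by
  rintro ⟨s, hs, a⟩ ⟨t, ht, b⟩; exact ⟨_, nmem_mul hs ht, EK.R1 h a b⟩
lemma PK.L2 : PK p k C Y → PK p k A Y → PK p k B Y := by
  rintro ⟨s, hs, a⟩ ⟨t, ht, b⟩; exact ⟨_, nmem_mul hs ht, EK.L2 h a b⟩
lemma PK.L1 : PK p k B Y → PK p (k+1) C Y → PK p k A Y := by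
  rintro ⟨s, hs, a⟩ ⟨t, ht, b⟩; exact ⟨_, nmem_mul hs ht, EK.L1 h a b⟩
lemma PK.L3 : PK p k A Y → PK p (k+1) B Y → PK p (k+1) C Y := by
  rintro ⟨s, hs, a⟩ ⟨t, ht, b⟩; exact ⟨_, nmem_mul hs ht, EK.L3 h a b⟩
end rules

lemma EK.of_killR {x : R} (hx : ∀ m : N, x • m = 0) (k : ℕ) : EK x k M N := by
  intro z
  rw [Abelian.Ext.smul_eq_comp_mk₀]
  have : x • 𝟙 (ModuleCat.of R N) = 0 := by
    apply ModuleCat.hom_ext; apply LinearMap.ext; exact hx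
  rw [this, Abelian.Ext.mk₀_zero, Abelian.Ext.comp_zero]

lemma EK_zero_iff {s : R} : EK s 0 M N ↔ ∀ f : M →ₗ[R] N, s • f = 0 := by
  constructor
  · intro h f
    have := h (Abelian.Ext.mk₀ (ModuleCat.ofHom f))
    rw [← Abelian.Ext.mk₀_smul, ← Abelian.Ext.mk₀_zero] at this
    have h2 := (Abelian.Ext.mk₀_bijective _ _).1 this
    exact congrArg ModuleCat.Hom.hom h2
  · intro h z
    obtain ⟨f, rfl⟩ := (Abelian.Ext.mk₀_bijective _ _).2 z
    rw [← Abelian.Ext.mk₀_smul, ← Abelian.Ext.mk₀_zero]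
    congr 1
    apply ModuleCat.hom_ext
    exact h f.hom

include hp in
lemma kill_fg [Module.Finite R M] (h : ∀ m : M, ∃ s, s ∉ p ∧ s • m = 0) : ∃ s, s ∉ p ∧ ∀ m : M, s • m = 0 := by
  classical
  choose s hs hm using h
  obtain ⟨S, hS⟩ := (Module.Finite.fg_top : (⊤ : Submodule R M).FG)
  refine ⟨∏ v ∈ S, s v, ?_, ?_⟩
  · intro hc
    obtain ⟨v, _, hv⟩ := (Ideal.IsPrime.prod_mem_iff).1 hc
    exact hs v hv
  · intro m
    have hm' : m ∈ Submodule.span R (S : Set M) := by rw [hS]; trivial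
    induction hm' using Submodule.span_induction with
    | mem x hx => rw [← Finset.prod_erase_mul _ _ hx, mul_smul, hm, smul_zero]
    | zero => simp
    | add x y _ _ hx hy => rw [smul_add, hx, hy, add_zero]
    | smul a x _ hx => rw [smul_comm, hx, smul_zero]

include hp in
lemma nak_kill [Module.Finite R M] {s x : R} (hs : s ∉ p) (hx : x ∈ p)
    (h : ∀ m : M, ∃ m' : M, s • m = x • m') : ∃ t, t ∉ p ∧ ∀ m : M, t • m = 0 := by
  obtain ⟨P, hP, _, hc, h0⟩ := LinearMap.exists_monic_and_natDegree_eq_and_coeff_mem_pow_and_aeval_eq_zero R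
    (s • (LinearMap.id : M →ₗ[R] M)) (Ideal.span {x}) (by
      rintro _ ⟨m, rfl⟩
      obtain ⟨m', hm'⟩ := h m
      show s • m ∈ _
      rw [hm']
      exact Submodule.smul_mem_smul (Ideal.mem_span_singleton_self x) trivial)
  refine ⟨P.eval s, ?_, ?_⟩
  · intro hmem
    rw [Polynomial.eval_eq_sum_range, Finset.sum_range_succ, hP.coeff_natDegree, one_mul] at hmem
    have h1 : ∑ i ∈ Finset.range P.natDegree, P.coeff i * s ^ i ∈ p := by
      apply Ideal.sum_mem
      intro i hi
      apply Ideal.mul_mem_right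
      have := hc i
      have h2 : (Ideal.span {x}) ^ (P.natDegree - i) ≤ p := by
        refine (Ideal.pow_le_self ?_).trans ((Ideal.span_singleton_le_iff_mem _).2 hx)
        have := Finset.mem_range.1 hi
        omega
      exact h2 this
    exact hs (hp.mem_of_pow_mem _ ((Ideal.add_mem_iff_right _ h1).1 hmem))
  · intro m
    have : (s • (LinearMap.id : M →ₗ[R] M)) = algebraMap R (Module.End R M) s := rfl
    rw [this, Polynomial.aeval_algebraMap_apply_eq_algebraMap_eval] at h0
    exact LinearMap.congr_fun h0 m

lemma SES.smulQ {x : R} (hx : ∀ m : M, x • m = 0 → m = 0) :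
    SES (x • (LinearMap.id : M →ₗ[R] M)) (LinearMap.range (x • (LinearMap.id : M →ₗ[R] M))).mkQ :=
  SES.coker _ ((injective_iff_map_eq_zero _).2 hx)

variable [IsNoetherianRing R]

include hp in
lemma bass_prime [Module.Finite R N] {b : ℕ} (hb : ∀ i, b < i → PK p i (R ⧸ p) N)
    (q : Ideal R) [hq : q.IsPrime] (i : ℕ) (hi : b < i) : PK p i (R ⧸ q) N := by
  revert hq
  induction q using WellFoundedGT.induction generalizing i with
  | ind q ih =>
    intro hq
    by_cases hqp : q ≤ p
    · rcases hqp.eq_or_lt with rfl | hlt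
      · exact hb i hi
      · obtain ⟨x, hxp, hxq⟩ := SetLike.exists_of_lt hlt
        have hreg : ∀ m : R ⧸ q, x • m = 0 → m = 0 := by
          intro m hm
          obtain ⟨m, rfl⟩ := Ideal.Quotient.mk_surjective m
          rw [Ideal.Quotient.eq_zero_iff_mem]
          have : Ideal.Quotient.mk q (x * m) = 0 := hm
          rw [Ideal.Quotient.eq_zero_iff_mem] at this
          exact (hq.mem_or_mem this).resolve_left hxq
        have hS := SES.smulQ hreg
        obtain ⟨s, hs, hk⟩ : PK p (i+1) ((R ⧸ q) ⧸ LinearMap.range (x • (LinearMap.id : (R ⧸ q) →ₗ[R] (R ⧸ q)))) N := by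
          apply fg_filtration (q ⊔ Ideal.span {x}) (fun M _ _ => PK p (i+1) M N)
          · intro A B C _ _ _ _ _ _ f g h hA hC; exact PK.L2 h hC hA
          · intro M _ _ _
            exact ⟨1, fun h => hp.ne_top ((Ideal.eq_top_iff_one _).2 h), EK.of_kill (fun m => Subsingleton.elim _ _) _⟩
          · intro q' hq' hle
            have h1 : q < q' := by
              refine lt_of_le_of_ne (le_sup_left.trans hle) ?_
              rintro rfl
              exact hxq (hle (Ideal.mem_sup_right (Ideal.mem_span_singleton_self x)))
            exact ih q' h1 (i+1) (by omega)
          · intro r hr m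
            obtain ⟨m, rfl⟩ := Submodule.mkQ_surjective _ m
            obtain ⟨m, rfl⟩ := Ideal.Quotient.mk_surjective m
            obtain ⟨a, ha, c, hc, rfl⟩ := Submodule.mem_sup.1 hr
            obtain ⟨c, rfl⟩ := Ideal.mem_span_singleton'.1 hc
            rw [← map_smul, ← LinearMap.mem_ker, Submodule.ker_mkQ, add_smul]
            refine Submodule.add_mem _ ?_ ⟨c • Ideal.Quotient.mk q m, ?_⟩
            · have : a • Ideal.Quotient.mk q m = 0 := by
                show Ideal.Quotient.mk q (a * m) = 0
                rw [Ideal.Quotient.eq_zero_iff_mem]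
                exact q.mul_mem_right _ ha
              rw [this]; exact Submodule.zero_mem _
            · rw [LinearMap.smul_apply, LinearMap.id_apply, mul_comm, mul_smul]
        have hf : Module.Finite R (EM R i (R ⧸ q) N) := inferInstance
        obtain ⟨t, ht, hk'⟩ := nak_kill (M := EM R i (R ⧸ q) N) hs hxp (fun z => EK.smulL hS hk z)
        exact ⟨t, ht, hk'⟩
    · obtain ⟨x, hxq, hxp⟩ := SetLike.not_le_iff_exists.1 hqp
      refine ⟨x, hxp, EK.of_kill ?_ _⟩
      intro m
      obtain ⟨m, rfl⟩ := Ideal.Quotient.mk_surjective m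
      show Ideal.Quotient.mk q (x * m) = 0
      rw [Ideal.Quotient.eq_zero_iff_mem]
      exact q.mul_mem_right _ hxq

include hp in
lemma bass [Module.Finite R N] [Module.Finite R M] {b : ℕ} (hb : ∀ i, b < i → PK p i (R ⧸ p) N)
    (i : ℕ) (hi : b < i) : PK p i M N := by
  apply fg_filtration (⊥ : Ideal R) (fun M _ _ => PK p i M N)
  · intro A B C _ _ _ _ _ _ f g h hA hC; exact PK.L2 h hC hA
  · intro M _ _ _
    exact ⟨1, fun h => hp.ne_top ((Ideal.eq_top_iff_one _).2 h), EK.of_kill (fun m => Subsingleton.elim _ _) _⟩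
  · intro q' hq' _
    exact bass_prime hb q' i hi
  · intro r hr m
    rw [Ideal.mem_bot.1 hr, zero_smul]

omit [IsNoetherianRing R] in
lemma quot_kill {x : R} (hx : x ∈ p) (m : R ⧸ p) : x • m = 0 := by
  obtain ⟨m, rfl⟩ := Ideal.Quotient.mk_surjective m
  show Ideal.Quotient.mk p (x * m) = 0
  rw [Ideal.Quotient.eq_zero_iff_mem]
  exact p.mul_mem_right _ hx

include hp in
lemma depth_bd [Module.Finite R N] {b : ℕ} (hb : ∀ i, b < i → PK p i (R ⧸ p) N)
    (hb' : ¬ PK p b (R ⧸ p) N) (k : ℕ) (c : ℕ) (M : Type u) [AddCommGroup M] [Module R M] [Module.Finite R M]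
    (h1 : ∀ i, c < i → PK p i M N) (h2 : ∀ i, i < k → PK p i (R ⧸ p) M) (h3 : ¬ PK p k (R ⧸ p) M) :
    b ≤ c + k := by
  induction k generalizing c M with
  | zero =>
    by_contra hlt
    apply hb'
    obtain ⟨m, hm, hms⟩ : ∃ m : M, (∀ x ∈ p, x • m = 0) ∧ ∀ s, s ∉ p → s • m ≠ 0 := by
      by_contra hcon
      push Not at hcon
      apply h3
      let T : Submodule R M := Submodule.torsionBySet R M (p : Set R)
      obtain ⟨s, hs, hk⟩ := kill_fg (p := p) (M := T) (by
        rintro ⟨m, hm⟩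
        rw [Submodule.mem_torsionBySet_iff] at hm
        obtain ⟨s, hs, h⟩ := hcon m (fun x hx => hm ⟨x, hx⟩)
        exact ⟨s, hs, Subtype.ext h⟩)
      refine ⟨s, hs, EK_zero_iff.2 fun f => ?_⟩
      ext
      have := hk ⟨f 1, by
        rw [Submodule.mem_torsionBySet_iff]
        rintro ⟨x, hx⟩
        show x • f 1 = 0
        rw [← map_smul, quot_kill hx, map_zero]⟩
      exact congrArg Subtype.val this
    let φ : (R ⧸ p) →ₗ[R] M := Submodule.liftQ p (LinearMap.toSpanSingleton R M m) (fun x hx => hm x hx)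
    have hφ : Function.Injective φ := by
      rw [injective_iff_map_eq_zero]
      intro r hr
      obtain ⟨r, rfl⟩ := Ideal.Quotient.mk_surjective r
      rw [Ideal.Quotient.eq_zero_iff_mem]
      by_contra hrp
      exact hms r hrp hr
    have hS := SES.coker φ hφ
    exact PK.L1 hS (h1 b (by omega)) (bass hb _ (by omega))
  | succ k ih =>
    let T : Submodule R M :=
      { carrier := {m | ∃ s, s ∉ p ∧ s • m = 0}
        zero_mem' := ⟨1, fun h => hp.ne_top ((Ideal.eq_top_iff_one _).2 h), by simp⟩
        add_mem' := by
          rintro a b ⟨s, hs, ha⟩ ⟨t, ht, hb⟩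
          refine ⟨s * t, nmem_mul hs ht, ?_⟩
          rw [smul_add, mul_smul, mul_smul, hb, smul_comm s t, ha]; simp
        smul_mem' := by
          rintro r a ⟨s, hs, ha⟩
          exact ⟨s, hs, by rw [smul_comm, ha, smul_zero]⟩ }
    obtain ⟨s, hs, hk⟩ := kill_fg (p := p) (M := T) (by
        rintro ⟨m, s, hs, hm⟩
        exact ⟨s, hs, Subtype.ext hm⟩)
    have hS := SES.quot T
    have hTf : ∀ s, s ∉ p → ∀ m : M ⧸ T, s • m = 0 → m = 0 := by
      intro s hs m hm
      obtain ⟨m, rfl⟩ := Submodule.mkQ_surjective _ m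
      rw [← map_smul] at hm
      rw [← LinearMap.mem_ker, Submodule.ker_mkQ] at hm ⊢
      obtain ⟨t, ht, h⟩ := hm
      exact ⟨t * s, nmem_mul ht hs, by rw [mul_smul, h]⟩
    have a1 : ∀ i, c < i → PK p i (M ⧸ T) N := by
      intro i hi
      obtain ⟨j, rfl⟩ : ∃ j, i = j + 1 := ⟨i - 1, by omega⟩
      exact PK.L3 hS ⟨s, hs, EK.of_kill hk _⟩ (h1 _ hi)
    have a2 : ∀ i, i < k + 1 → PK p i (R ⧸ p) (M ⧸ T) := fun i hi =>
      PK.R3 hS (h2 i hi) ⟨s, hs, EK.of_killR hk _⟩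
    have a3 : ¬ PK p (k+1) (R ⧸ p) (M ⧸ T) := fun h =>
      h3 (PK.R2 hS ⟨s, hs, EK.of_killR hk _⟩ h)
    have hsub : Subsingleton ((R ⧸ p) →ₗ[R] (M ⧸ T)) := by
      obtain ⟨t, ht, hkt⟩ := a2 0 (by omega)
      rw [EK_zero_iff] at hkt
      refine ⟨fun f g => ?_⟩
      rw [← sub_eq_zero]
      apply LinearMap.ext
      intro y
      exact hTf t ht _ (LinearMap.congr_fun (hkt (f - g)) y)
    obtain ⟨x, hx, hreg⟩ := IsSMulRegular.subsingleton_linearMap_iff.1 hsub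
    rw [Ideal.annihilator_quotient] at hx
    have hS' := SES.smulQ (M := M ⧸ T) (x := x) (fun m hm => hreg (by simpa using hm))
    have := ih (c+1) _ (fun i hi => by
      obtain ⟨j, rfl⟩ : ∃ j, i = j + 1 := ⟨i - 1, by omega⟩
      exact PK.L3 hS' (a1 j (by omega)) (a1 _ (by omega)))
      (fun i hi => PK.R3 hS' (a2 i (by omega)) (a2 _ (by omega)))
      (by
        rintro ⟨s, hs, h⟩
        exact a3 ⟨s, hs, EK.smulR hS' (fun m => quot_kill hx m) h⟩)
    omega

include hp in
lemma DM.exists_a {D : Type u} [AddCommGroup D] [Module R D] {n : ℕ} (h : DM R D n) :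
    ∃ a, ∀ i, i ≠ a → PK p i (R ⧸ p) D := by
  classical
  have := h.fin
  have one_nmem : (1:R) ∉ p := fun h => hp.ne_top ((Ideal.eq_top_iff_one _).2 h)
  by_cases hex : ∃ i, ¬ PK p i (R ⧸ p) D
  · have hle : ∀ i, ¬ PK p i (R ⧸ p) D → i ≤ n := by
      intro i hi
      by_contra hlt
      exact hi ⟨1, one_nmem, EK_one.2 (h.id _ _ (by omega))⟩
    obtain ⟨i0, hi0⟩ := hex
    let b := Nat.findGreatest (fun i => ¬ PK p i (R ⧸ p) D) n
    have hb : ¬ PK p b (R ⧸ p) D := Nat.findGreatest_spec (P := fun i => ¬ PK p i (R ⧸ p) D) (hle i0 hi0) hi0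
    have hb1 : ∀ i, b < i → PK p i (R ⧸ p) D := by
      intro i hi
      by_contra hc
      exact (Nat.le_findGreatest (P := fun i => ¬ PK p i (R ⧸ p) D) (hle i hc) hc).not_gt hi
    have hex : ∃ i, ¬ PK p i (R ⧸ p) D := ⟨b, hb⟩
    have key := depth_bd hb1 hb (Nat.find hex) 0 D
      (fun i hi => by
        obtain ⟨j, rfl⟩ : ∃ j, i = j + 1 := ⟨i - 1, by omega⟩
        exact ⟨1, one_nmem, EK_one.2 (h.self _)⟩)
      (fun i hi => by_contra fun hc => Nat.find_min hex hi hc) (Nat.find_spec hex)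
    refine ⟨b, fun i hi => ?_⟩
    rcases lt_or_gt_of_ne hi with h1 | h1
    · by_contra hc
      have := Nat.find_min' hex hc
      omega
    · exact hb1 i h1
  · push Not at hex
    exact ⟨0, fun i _ => hex i⟩

include hp in
lemma PK_tors {D U : Type u} [AddCommGroup D] [Module R D] [AddCommGroup U] [Module R U] [Module.Finite R U]
    {i m : ℕ} (h : PK p i (R ⧸ p) D) (hU : ∀ r ∈ p ^ m, ∀ x : U, r • x = 0) : PK p i U D := by
  apply fg_filtration (p ^ m) (fun M _ _ => PK p i M D) _ _ _ _ hU
  · intro A B C _ _ _ _ _ _ f g h hA hC; exact PK.L2 h hC hA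
  · intro M _ _ _
    exact ⟨1, fun h => hp.ne_top ((Ideal.eq_top_iff_one _).2 h), EK.of_kill (fun m => Subsingleton.elim _ _) _⟩
  · intro q hq hle
    have hle' : p ≤ q := Ideal.IsPrime.le_of_pow_le hle
    by_cases hqp : q ≤ p
    · obtain rfl := le_antisymm hqp hle'
      exact h
    · obtain ⟨x, hxq, hxp⟩ := SetLike.not_le_iff_exists.1 hqp
      exact ⟨x, hxp, EK.of_kill (fun m => quot_kill hxq m) _⟩
end
end SFive

noncomputable section SSeven

open CategoryTheory Limits
open scoped TensorProduct

variable {R : Type u} [CommRing R]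

structure PPure (p : Ideal R) (N : Type u) [AddCommGroup N] [Module R N] : Prop where
  tors : ∀ x : N, ∃ m : ℕ, ∀ r ∈ p ^ m, r • x = 0
  bij : ∀ s, s ∉ p → Function.Bijective (fun x : N => s • x)

section
variable {A B C M N X Y J : Type u} [AddCommGroup A] [Module R A] [AddCommGroup B] [Module R B]
  [AddCommGroup C] [Module R C] [AddCommGroup N] [Module R N] [AddCommGroup M] [Module R M]
  [AddCommGroup X] [Module R X] [AddCommGroup Y] [Module R Y] [AddCommGroup J] [Module R J]

variable {p : Ideal R}

lemma PPure.inj (h : PPure p N) {s : R} (hs : s ∉ p) {x : N} (hx : s • x = 0) : x = 0 :=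
  (h.bij s hs).1 (by simpa using hx)

lemma PPure.ker (hA : PPure p A) (hB : PPure p B) (f : A →ₗ[R] B) : PPure p (LinearMap.ker f) := by
  refine ⟨fun x => ?_, fun s hs => ⟨fun x y hxy => ?_, fun x => ?_⟩⟩
  · obtain ⟨m, hm⟩ := hA.tors x.1
    exact ⟨m, fun r hr => Subtype.ext (hm r hr)⟩
  · exact Subtype.ext ((hA.bij s hs).1 (congrArg Subtype.val hxy))
  · obtain ⟨y, hy⟩ := (hA.bij s hs).2 x.1
    refine ⟨⟨y, ?_⟩, Subtype.ext hy⟩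
    apply hB.inj hs
    have : s • y = x.1 := hy
    rw [← map_smul, this]; exact x.2

lemma PPure.range (hA : PPure p A) (hB : PPure p B) (f : A →ₗ[R] B) : PPure p (LinearMap.range f) := by
  refine ⟨fun x => ?_, fun s hs => ⟨fun x y hxy => ?_, fun x => ?_⟩⟩
  · obtain ⟨m, hm⟩ := hB.tors x.1
    exact ⟨m, fun r hr => Subtype.ext (hm r hr)⟩
  · exact Subtype.ext ((hB.bij s hs).1 (congrArg Subtype.val hxy))
  · obtain ⟨_, a, rfl⟩ := x
    obtain ⟨y, hy⟩ := (hA.bij s hs).2 a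
    refine ⟨⟨f y, y, rfl⟩, Subtype.ext ?_⟩
    show s • f y = f a
    rw [← map_smul]; exact congrArg f hy

lemma PPure.coker (hA : PPure p A) (hB : PPure p B) (f : A →ₗ[R] B) : PPure p (B ⧸ LinearMap.range f) := by
  refine ⟨fun x => ?_, fun s hs => ⟨?_, fun x => ?_⟩⟩
  · obtain ⟨x, rfl⟩ := Submodule.mkQ_surjective _ x
    obtain ⟨m, hm⟩ := hB.tors x
    exact ⟨m, fun r hr => by rw [← map_smul, hm r hr, map_zero]⟩
  · have : Function.Injective (s • (LinearMap.id : (B ⧸ LinearMap.range f) →ₗ[R] _)) := by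
      rw [injective_iff_map_eq_zero]
      intro x hx
      obtain ⟨x, rfl⟩ := Submodule.mkQ_surjective _ x
      have hx : s • (LinearMap.range f).mkQ x = 0 := hx
      rw [← map_smul] at hx
      rw [← LinearMap.mem_ker, Submodule.ker_mkQ] at hx ⊢
      obtain ⟨a, ha⟩ := hx
      obtain ⟨y, hy⟩ := (hA.bij s hs).2 a
      refine ⟨y, ?_⟩
      apply (hB.bij s hs).1
      show s • f y = s • x
      rw [← map_smul, ← ha]; exact congrArg f hy
    exact this
  · obtain ⟨x, rfl⟩ := Submodule.mkQ_surjective _ x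
    obtain ⟨y, hy⟩ := (hB.bij s hs).2 x
    exact ⟨(LinearMap.range f).mkQ y, by rw [← hy]; exact (map_smul _ _ _).symm⟩

lemma pow_kill (h : ∀ x : N, ∃ m : ℕ, ∀ r ∈ p ^ m, r • x = 0) (U : Submodule R N) [Module.Finite R U] :
    ∃ m : ℕ, ∀ r ∈ p ^ m, ∀ x : U, r • x = 0 := by
  classical
  choose m hm using h
  obtain ⟨S, hS⟩ := (Module.Finite.iff_fg.1 ‹_› : U.FG)
  refine ⟨S.sup m, fun r hr x => Subtype.ext ?_⟩
  obtain ⟨x, hx⟩ := x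
  show r • x = 0
  rw [← hS] at hx
  induction hx using Submodule.span_induction with
  | mem x hx => exact hm x r (Ideal.pow_le_pow_right (Finset.le_sup hx) hr)
  | zero => simp
  | add x y _ _ hx hy => rw [smul_add, hx, hy, add_zero]
  | smul a x _ hx => rw [smul_comm, hx, smul_zero]

lemma PPure.hom (hJ : PPure p J) [Module.Finite R M] : PPure p (M →ₗ[R] J) := by
  classical
  refine ⟨fun f => ?_, fun s hs => ⟨fun f g hfg => ?_, fun f => ?_⟩⟩
  · obtain ⟨m, hm⟩ := pow_kill hJ.tors (LinearMap.range f)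
    exact ⟨m, fun r hr => LinearMap.ext fun x => congrArg Subtype.val (hm r hr ⟨f x, x, rfl⟩)⟩
  · ext x
    exact (hJ.bij s hs).1 (LinearMap.congr_fun hfg x)
  · let e : J ≃ₗ[R] J := LinearEquiv.ofBijective (s • LinearMap.id) (hJ.bij s hs)
    exact ⟨e.symm.toLinearMap ∘ₗ f, LinearMap.ext fun x => e.apply_symm_apply (f x)⟩

lemma PPure.tor_inj (hN : PPure p N) {s : R} (hs : s ∉ p) {k : ℕ} (z : TorM R k N X) (hz : s • z = 0) : z = 0 := by
  let e : N ≃ₗ[R] N := LinearEquiv.ofBijective (s • LinearMap.id) (hN.bij s hs)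
  apply (torLE k X e).injective
  rw [map_zero, ← hz, ← torL_smul_id]
  rfl

variable [IsNoetherianRing R] {D : Type u} [AddCommGroup D] [Module R D] {n : ℕ} {a : ℕ}

lemma PPure.tz [hp : p.IsPrime] (hN : PPure p N) (h : DM R D n) {E : Type u} [AddCommGroup E] [Module R E]
    (hE : Module.Injective R E) {i : ℕ} (hi : PK p i (R ⧸ p) D) : TZ R i N (D →ₗ[R] E) := by
  have := h.fin
  apply TZ.of_fg
  intro U hU z
  obtain ⟨m, hm⟩ := pow_kill hN.tors U
  obtain ⟨s, hs, hk⟩ := PK_tors hi hm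
  apply hN.tor_inj hs
  rw [← map_smul]
  suffices s • z = 0 by rw [this, map_zero]
  cases i with
  | succ i => exact TK_of_EK hE i U hk z
  | zero =>
    rw [EK_zero_iff] at hk
    apply (tor0 _ _).injective
    apply (eta_bij hE).1
    rw [map_zero, map_zero, map_smul, map_smul]
    ext φ
    rw [LinearMap.smul_apply, ← map_smul, hk φ, map_zero]; rfl

/-- S7 -/
def Bdd (F : Fam R) (D : Type u) [AddCommGroup D] [Module R D] (N : Type u) [AddCommGroup N] [Module R N] : Prop :=
  ∃ B, ∀ i, B < i → ∀ j, TZ R i N (D →ₗ[R] F.Z j)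

section bdd
variable {F : Fam R}
omit [IsNoetherianRing R]
variable {f : A →ₗ[R] B} {g : B →ₗ[R] C}
lemma Bdd.L3 (h : SES f g) : Bdd F D B → Bdd F D A → Bdd F D C := by
  rintro ⟨b, hb⟩ ⟨c, hc⟩
  refine ⟨b + c + 1, fun i hi j => ?_⟩
  obtain ⟨i, rfl⟩ : ∃ j, i = j + 1 := ⟨i - 1, by omega⟩
  exact TZ.L3 h (hb _ (by omega) _) (hc _ (by omega) _)

lemma Bdd.L1 (h : SES f g) : Bdd F D C → Bdd F D B → Bdd F D A := by
  rintro ⟨b, hb⟩ ⟨c, hc⟩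
  refine ⟨b + c + 1, fun i hi j => ?_⟩
  exact TZ.L1 h (hb _ (by omega) _) (hc _ (by omega) _)

lemma Bdd.congr (e : A ≃ₗ[R] B) : Bdd F D A → Bdd F D B := by
  rintro ⟨b, hb⟩
  exact ⟨b, fun i hi j => TZ.congrL e (hb i hi j)⟩
end bdd

omit [IsNoetherianRing R] in
lemma fd_tensor {m : ℕ} {D' X Y : Type u} [AddCommGroup D'] [Module R D'] [AddCommGroup X] [Module R X]
    [AddCommGroup Y] [Module R Y] (hX : ∀ i, TZ R (i+1) D' X) (hY : ∀ i, TZ R (i+1) D' Y)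
    (hfd : ∀ (N : Type u) [AddCommGroup N] [Module R N] (i : ℕ), m < i → TZ R i N Y) (i : ℕ) (hi : m < i) :
    TZ R i (D' ⊗[R] Y) X := by
  induction m generalizing Y i with
  | zero =>
    obtain ⟨j, rfl⟩ : ∃ j, i = j + 1 := ⟨i - 1, by omega⟩
    have : Module.Flat R Y := flat_of_TZ _ fun I _ => hfd _ _ (by omega)
    exact TZ.tensor_flat hX j
  | succ m ih =>
    obtain ⟨P, _, _, g, _, hg⟩ := exists_cover (R := R) Y
    have hS := SES.ker g hg
    have hS' := hS.lTensor (D := D') (TZ.proj _ _ _) (hY 0)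
    obtain ⟨j, rfl⟩ : ∃ j, i = j + 1 := ⟨i - 1, by omega⟩
    refine TZ.L3 hS' (TZ.tensor_flat hX j) (ih ?_ ?_ j (by omega))
    · intro i; exact TZ.R1 hS (hY _) (TZ.proj _ _ _)
    · intro N _ _ i hi
      obtain ⟨j, rfl⟩ : ∃ j, i = j + 1 := ⟨i - 1, by omega⟩
      exact TZ.R1 hS (hfd _ _ (by omega)) (TZ.proj _ _ _)

variable (F : Fam R) (h : DM R D n) (hD : ∀ j, EZ R 1 D (F.Z j))
include h hD

lemma Bdd.inj (hJ : Module.Injective R J) : Bdd F D J := by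
  refine ⟨n, fun i hi j => ?_⟩
  exact TZ.congrL (LinearEquiv.ofBijective _ (h.ev_bij hJ))
    (fd_tensor (fun i => F.torD h hD i j) (fun i => h.torD hJ i) (fun N _ _ i hi => h.fd hJ N i hi) i hi)

omit hD in
lemma Bdd.homD (hJ : Module.Injective R J) : Bdd F D (D →ₗ[R] J) := by
  refine ⟨n, fun i hi j => ?_⟩
  exact TZ.congrL (TensorProduct.lid R _)
    (fd_tensor (D' := R) (fun i => TZ.flatL _ _ _) (fun i => TZ.flatL _ _ _) (fun N _ _ i hi => h.fd hJ N i hi) i hi)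

lemma PPure.tz_lo [hp : p.IsPrime] (ha : ∀ i, i ≠ a → PK p i (R ⧸ p) D) (hN : PPure p N)
    (i : ℕ) (hi : i < a) (j : ℤ) : TZ R i N (D →ₗ[R] F.Z j) := by
  have hS := F.sesH hD
  induction i generalizing j with
  | zero =>
    intro z
    obtain ⟨y, rfl⟩ := (torR_les N _ _ (hS j).inj (hS j).ex (hS j).surj 0).2.2 z
    rw [hN.tz h (F.injE _) (ha 0 (by omega)) y, map_zero]
  | succ i ih =>
    exact TZ.R3 (hS j) (hN.tz h (F.injE _) (ha _ (by omega))) (ih (by omega) (j+1))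

lemma PPure.tz_ne [hp : p.IsPrime] (ha : ∀ i, i ≠ a → PK p i (R ⧸ p) D) (hN : PPure p N) (hb : Bdd F D N)
    (i : ℕ) (hi : i ≠ a) (j : ℤ) : TZ R i N (D →ₗ[R] F.Z j) := by
  rcases lt_or_gt_of_ne hi with hi | hi
  · exact hN.tz_lo F h hD ha i hi j
  · obtain ⟨B, hB⟩ := hb
    obtain ⟨m, hm⟩ : ∃ m, B < i + m := ⟨B+1, by omega⟩
    induction m generalizing i j with
    | zero => exact hB i (by omega) j
    | succ m ih =>
      apply int_shift (P := fun j => TZ R i N (D →ₗ[R] F.Z j))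
      intro j
      exact TZ.R1 (F.sesH hD j) (ih (i+1) (by omega) j (by omega) (by omega)) (hN.tz h (F.injE _) (ha _ (by omega)))
end

end SSeven

noncomputable section STheta
open CategoryTheory Limits
open scoped TensorProduct
variable {R : Type u} [CommRing R]

section
variable {A B C M N X Y J F F' : Type u} [AddCommGroup A] [Module R A] [AddCommGroup B] [Module R B]
  [AddCommGroup C] [Module R C] [AddCommGroup N] [Module R N] [AddCommGroup M] [Module R M]
  [AddCommGroup X] [Module R X] [AddCommGroup Y] [Module R Y] [AddCommGroup J] [Module R J]
  [AddCommGroup F] [Module R F] [AddCommGroup F'] [Module R F']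

/-- the natural map -/
def tau (k : ℕ) (F J X : Type u) [AddCommGroup J] [Module R J]
  [AddCommGroup F] [Module R F] [AddCommGroup X] [Module R X] :
    TorM R k (F →ₗ[R] J) X →ₗ[R] (F →ₗ[R] TorM R k J X) where
  toFun z :=
    { toFun := fun x => torL k X (LinearMap.applyₗ (R := R) x) z
      map_add' := fun x y => by rw [map_add, torL_add]; rfl
      map_smul' := fun r x => by rw [map_smul, torL_smul]; rfl }
  map_add' z w := by ext x; exact map_add (torL k X (LinearMap.applyₗ (R := R) x)) z w
  map_smul' r z := by ext x; exact map_smul (torL k X (LinearMap.applyₗ (R := R) x)) r z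

lemma tau_apply (k : ℕ) (z : TorM R k (F →ₗ[R] J) X) (x : F) :
    tau k F J X z x = torL k X (LinearMap.applyₗ (R := R) x) z := rfl

lemma tau_nat (k : ℕ) (a : F' →ₗ[R] F) (z : TorM R k (F →ₗ[R] J) X) :
    tau k F' J X (torL k X (a.lcomp R J) z) = tau k F J X z ∘ₗ a := by
  ext x
  rw [LinearMap.comp_apply, tau_apply, tau_apply, ← LinearMap.comp_apply, ← torL_comp]
  rfl

lemma tau_bij (k : ℕ) {ι : Type u} [Fintype ι] [DecidableEq ι] :
    Function.Bijective (tau (R := R) k (ι → R) J X) := by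
  let j (i : ι) : J →ₗ[R] ((ι → R) →ₗ[R] J) :=
    LinearMap.flip ((LinearMap.lsmul R J) ∘ₗ LinearMap.proj i)
  have hj : ∀ i y (x : ι → R), j i y x = x i • y := fun i y x => rfl
  constructor
  · rw [injective_iff_map_eq_zero]
    intro z hz
    have h1 : (LinearMap.id : ((ι → R) →ₗ[R] J) →ₗ[R] _) =
        ∑ i, j i ∘ₗ LinearMap.applyₗ (R := R) (Pi.single i (1:R) : ι → R) := by
      ext f i
      simp [hj, LinearMap.sum_apply, Pi.single_apply]
    have h2 : z = torL k X (LinearMap.id : ((ι → R) →ₗ[R] J) →ₗ[R] _) z := by rw [torL_id]; rfl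
    rw [h2, h1, torL_sum, LinearMap.sum_apply]
    refine Finset.sum_eq_zero fun i _ => ?_
    rw [torL_comp, LinearMap.comp_apply, ← tau_apply, hz]
    simp
  · intro ψ
    refine ⟨∑ i, torL k X (j i) (ψ (Pi.single i 1)), ?_⟩
    refine LinearMap.pi_ext' fun i => LinearMap.ext_ring ?_
    rw [LinearMap.comp_apply, LinearMap.comp_apply, tau_apply, map_sum]
    have : ∀ i', torL k X (LinearMap.applyₗ (R := R) (Pi.single i (1:R) : ι → R)) (torL k X (j i') (ψ (Pi.single i' 1)))
       = if i' = i then ψ (Pi.single i 1) else 0 := by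
      intro i'
      rw [← LinearMap.comp_apply, ← torL_comp]
      split_ifs with h
      · subst h
        have : LinearMap.applyₗ (R := R) (Pi.single i' (1:R) : ι → R) ∘ₗ j i' = LinearMap.id := by
          ext y; simp [hj]
        rw [this, torL_id]; rfl
      · have : LinearMap.applyₗ (R := R) (Pi.single i (1:R) : ι → R) ∘ₗ j i' = 0 := by
          ext y; simp [hj, Pi.single_apply, h]
        rw [this, torL_zero]; rfl
    simp [this]

lemma TZ.homFree {k : ℕ} {ι : Type u} [Fintype ι] [DecidableEq ι] (h : TZ R k J X) :
    TZ R k ((ι → R) →ₗ[R] J) X := by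
  intro z
  apply (tau_bij k).1
  ext i
  rw [map_zero]
  exact h _

lemma SES.rangeRestrict (f : A →ₗ[R] B) : SES (LinearMap.ker f).subtype f.rangeRestrict := by
  have := SES.ker f.rangeRestrict f.surjective_rangeRestrict
  refine ⟨Subtype.val_injective, ?_, f.surjective_rangeRestrict⟩
  rw [LinearMap.exact_iff, LinearMap.ker_rangeRestrict, Submodule.range_subtype]

lemma tor_mid_exact {f : A →ₗ[R] B} {g : B →ₗ[R] C} (h : Function.Exact f g) {k : ℕ}
    (h1 : ∀ k', k = k' + 1 → TZ R k' (LinearMap.ker f) X)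
    (h2 : TZ R (k+1) (C ⧸ LinearMap.range g) X) :
    Function.Exact (torL k X f) (torL k X g) := by
  have S1 := SES.rangeRestrict f
  have S2 : SES (LinearMap.range f).subtype g.rangeRestrict := by
    refine ⟨Subtype.val_injective, ?_, g.surjective_rangeRestrict⟩
    rw [LinearMap.exact_iff, LinearMap.ker_rangeRestrict, Submodule.range_subtype]
    exact (LinearMap.exact_iff.1 h)
  have S3 := SES.quot (LinearMap.range g)
  have e1 : f = (LinearMap.range f).subtype ∘ₗ f.rangeRestrict := rfl
  have e2 : g = (LinearMap.range g).subtype ∘ₗ g.rangeRestrict := rfl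
  have hs : Function.Surjective (torL k X f.rangeRestrict) := by
    cases k with
    | zero => exact (torL_les X _ _ S1.inj S1.ex S1.surj 0).2.2
    | succ k =>
      obtain ⟨δ, hδ, _⟩ := (torL_les X _ _ S1.inj S1.ex S1.surj k).2.1
      exact fun z => (hδ z).1 (h1 k rfl _)
  have hi : Function.Injective (torL k X (LinearMap.range g).subtype) := by
    rw [injective_iff_map_eq_zero]
    intro z hz
    obtain ⟨δ, _, hδ⟩ := (torL_les X _ _ S3.inj S3.ex S3.surj k).2.1
    obtain ⟨w, rfl⟩ := (hδ z).1 hz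
    rw [h2 w, map_zero]
  have hm := (torL_les X _ _ S2.inj S2.ex S2.surj k).1
  intro y
  conv_lhs => rw [e2, torL_comp]
  conv_rhs => rw [e1, torL_comp]
  rw [LinearMap.comp_apply]
  constructor
  · intro hy
    have : torL k X g.rangeRestrict y = 0 := hi (by rw [hy, map_zero])
    obtain ⟨w, rfl⟩ := (hm y).1 this
    obtain ⟨v, rfl⟩ := hs w
    exact ⟨v, rfl⟩
  · rintro ⟨v, rfl⟩
    rw [LinearMap.comp_apply, (hm _).2 ⟨_, rfl⟩, map_zero]

lemma thetaL {k : ℕ} (hJ : Module.Injective R J) {ι₀ ι₁ ι₂ : Type u} [Fintype ι₀] [DecidableEq ι₀]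
    [Fintype ι₁] [DecidableEq ι₁] [Fintype ι₂] [DecidableEq ι₂]
    (q : (ι₀ → R) →ₗ[R] C) (hq : Function.Surjective q) (α : (ι₁ → R) →ₗ[R] (ι₀ → R))
    (hα : Function.Exact α q) (β : (ι₂ → R) →ₗ[R] (ι₁ → R)) (hβ : Function.Exact β α)
    (h1 : ∀ k', k = k' + 1 → TZ R k' (LinearMap.ker (α.lcomp R J)) X)
    (h2 : TZ R (k+1) (((ι₂ → R) →ₗ[R] J) ⧸ LinearMap.range (β.lcomp R J)) X) :
    EZ R 1 C (TorM R k J X) := by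
  have hex : Function.Exact (α.lcomp R J) (β.lcomp R J) := by
    intro φ
    constructor
    · intro hφ
      obtain ⟨ψ, hψ⟩ := inj_factor hJ α φ (fun x hx => by
        obtain ⟨w, rfl⟩ := (hβ x).1 hx
        exact LinearMap.congr_fun hφ w)
      exact ⟨ψ, hψ⟩
    · rintro ⟨ψ, rfl⟩
      ext w
      show ψ (α (β _)) = 0
      rw [hβ.apply_apply_eq_zero, map_zero]
  have hT := tor_mid_exact (X := X) hex h1 h2
  refine EZ.of_ext1 (SES.ker q hq) (EZ.proj 0 _ _) ?_
  intro φ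
  let α' : (ι₁ → R) →ₗ[R] LinearMap.ker q := α.codRestrict _ (fun x => hα.apply_apply_eq_zero x)
  have hα' : Function.Surjective α' := by
    rintro ⟨x, hx⟩
    obtain ⟨w, rfl⟩ := (hα x).1 hx
    exact ⟨w, rfl⟩
  obtain ⟨z, hz⟩ := (tau_bij (R := R) (J := J) (X := X) k).2 (φ ∘ₗ α')
  have hz0 : torL k X (β.lcomp R J) z = 0 := by
    apply (tau_bij k).1
    rw [tau_nat, hz, map_zero]
    ext w
    show φ (α' (β _)) = 0
    have : α' (β ((LinearMap.single R (fun _ => R) w) 1)) = 0 := Subtype.ext (hβ.apply_apply_eq_zero _)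
    rw [this, map_zero]
  obtain ⟨y, rfl⟩ := (hT z).1 hz0
  refine ⟨tau k _ J X y, ?_⟩
  rw [tau_nat] at hz
  ext x
  obtain ⟨w, rfl⟩ := hα' x
  exact LinearMap.congr_fun hz w

variable [IsNoetherianRing R]

lemma exists_pres (C : Type u) [AddCommGroup C] [Module R C] [Module.Finite R C] :
    ∃ (n₀ n₁ n₂ : ℕ) (q : (ULift.{u} (Fin n₀) → R) →ₗ[R] C)
      (α : (ULift.{u} (Fin n₁) → R) →ₗ[R] (ULift.{u} (Fin n₀) → R))
      (β : (ULift.{u} (Fin n₂) → R) →ₗ[R] (ULift.{u} (Fin n₁) → R)),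
      Function.Surjective q ∧ Function.Exact α q ∧ Function.Exact β α := by
  obtain ⟨n₀, q, hq⟩ := exists_fin_cover (R := R) C
  obtain ⟨n₁, a, ha⟩ := exists_fin_cover (R := R) (LinearMap.ker q)
  have e : ∀ {V W : Type u} [AddCommGroup V] [Module R V] [AddCommGroup W] [Module R W] (q : V →ₗ[R] W)
    {U : Type u} [AddCommGroup U] [Module R U] (a : U →ₗ[R] LinearMap.ker q), Function.Surjective a →
    Function.Exact ((LinearMap.ker q).subtype ∘ₗ a) q := by
    intro V W _ _ _ _ q U _ _ a ha x
    constructor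
    · intro hx
      obtain ⟨w, hw⟩ := ha ⟨x, hx⟩
      exact ⟨w, by rw [LinearMap.comp_apply, hw]; rfl⟩
    · rintro ⟨w, rfl⟩
      exact (a w).2
  obtain ⟨n₂, b, hb⟩ := exists_fin_cover (R := R) (LinearMap.ker ((LinearMap.ker q).subtype ∘ₗ a))
  exact ⟨n₀, n₁, n₂, q, _, _, hq, e q a ha, e _ b hb⟩

variable {D : Type u} [AddCommGroup D] [Module R D] {n : ℕ} {a : ℕ} {p : Ideal R}

lemma PPure.tor_injective [hp : p.IsPrime] (hN : PPure p J) (hJ : Module.Injective R J) (h : DM R D n)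
    {E : Type u} [AddCommGroup E] [Module R E]
    (hE : Module.Injective R E) (ha : ∀ i, i ≠ a → PK p i (R ⧸ p) D) :
    Module.Injective R (TorM R a J (D →ₗ[R] E)) := by
  apply injective_of_EZ
  intro b
  obtain ⟨n₀, n₁, n₂, q, α, β, hq, hα, hβ⟩ := exists_pres (R := R) (R ⧸ b)
  refine thetaL hJ q hq α hα β hβ ?_ ?_
  · intro k hk
    exact (PPure.ker hN.hom hN.hom _).tz h hE (ha _ (by omega))
  · exact (PPure.coker hN.hom hN.hom _).tz h hE (ha _ (by omega))

lemma PPure.tor_ext [hp : p.IsPrime] (hN : PPure p J) (hJ : Module.Injective R J) (h : DM R D n)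
    (F : Fam R) (hD : ∀ j, EZ R 1 D (F.Z j)) (ha : ∀ i, i ≠ a → PK p i (R ⧸ p) D) (j : ℤ) :
    EZ R 1 D (TorM R a J (D →ₗ[R] F.Z j)) := by
  have := h.fin
  obtain ⟨n₀, n₁, n₂, q, α, β, hq, hα, hβ⟩ := exists_pres (R := R) D
  have hA : ∀ m : ℕ, Bdd F D ((ULift.{u} (Fin m) → R) →ₗ[R] J) := by
    intro m
    obtain ⟨b, hb⟩ := Bdd.inj F h hD hJ
    exact ⟨b, fun i hi j => (hb i hi j).homFree⟩
  have hex : Function.Exact (α.lcomp R J) (β.lcomp R J) := by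
    intro φ
    constructor
    · intro hφ
      obtain ⟨ψ, hψ⟩ := inj_factor hJ α φ (fun x hx => by
        obtain ⟨w, rfl⟩ := (hβ x).1 hx
        exact LinearMap.congr_fun hφ w)
      exact ⟨ψ, hψ⟩
    · rintro ⟨ψ, rfl⟩
      ext w
      show ψ (α (β _)) = 0
      rw [hβ.apply_apply_eq_zero, map_zero]
  have hK : Bdd F D (LinearMap.ker (α.lcomp R J)) := by
    let e : (D →ₗ[R] J) →ₗ[R] LinearMap.ker (α.lcomp R J) := (q.lcomp R J).codRestrict _ (fun φ => by
      ext w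
      show φ (q (α _)) = 0
      rw [hα.apply_apply_eq_zero, map_zero])
    have he : Function.Bijective e := by
      constructor
      · intro φ ψ hφ
        ext x
        obtain ⟨w, rfl⟩ := hq x
        exact LinearMap.congr_fun (congrArg Subtype.val hφ) w
      · rintro ⟨φ, hφ⟩
        obtain ⟨ψ, hψ⟩ := inj_factor hJ q φ (fun x hx => by
          obtain ⟨w, rfl⟩ := (hα x).1 hx
          exact LinearMap.congr_fun hφ w)
        exact ⟨ψ, Subtype.ext hψ⟩
    exact (Bdd.homD F h hJ).congr (LinearEquiv.ofBijective e he)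
  have hI : Bdd F D (LinearMap.range (α.lcomp R J)) := Bdd.L3 (SES.rangeRestrict (α.lcomp R J)) (hA _) hK
  have hL : Bdd F D (LinearMap.range (β.lcomp R J)) := by
    rw [LinearMap.exact_iff] at hex
    rw [← hex] at hI
    exact Bdd.L3 (SES.rangeRestrict (β.lcomp R J)) (hA _) hI
  have hQ := Bdd.L3 (SES.quot (LinearMap.range (β.lcomp R J))) (hA _) hL
  refine thetaL hJ q hq α hα β hβ ?_ ?_
  · intro k hk
    exact (PPure.ker hN.hom hN.hom _).tz_ne F h hD ha hK _ (by omega) j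
  · exact (PPure.coker hN.hom hN.hom _).tz_ne F h hD ha hQ _ (by omega) j

def Good (F : Fam R) (D : Type u) [AddCommGroup D] [Module R D] (k : ℕ)
    (J : Type u) [AddCommGroup J] [Module R J] : Prop :=
  ∀ j, Function.Injective (torR k J (hm D (F.ι (j+1)))) ∧ Function.Surjective (torR k J (hm D (F.π j))) ∧
    Module.Injective R (TorM R k J (D →ₗ[R] F.E j)) ∧ EZ R 1 D (TorM R k J (D →ₗ[R] F.Z j))

lemma subsingleton_injective [Subsingleton A] : Module.Injective R A :=
  ⟨fun X Y _ _ _ _ f hf g => ⟨0, fun x => Subsingleton.elim _ _⟩⟩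

lemma PPure.good [hp : p.IsPrime] (hN : PPure p J) (hJ : Module.Injective R J) (h : DM R D n)
    (F : Fam R) (hD : ∀ j, EZ R 1 D (F.Z j)) (k : ℕ) : Good F D k J := by
  obtain ⟨a, ha⟩ := DM.exists_a (p := p) h
  have hb := Bdd.inj F h hD hJ
  intro j
  by_cases hk : k = a
  · subst hk
    have S := F.sesH hD j
    refine ⟨?_, ?_, hN.tor_injective hJ h (F.injE j) ha, hN.tor_ext hJ h F hD ha j⟩
    · rw [injective_iff_map_eq_zero]
      intro z hz
      obtain ⟨δ, _, hδ⟩ := (torR_les J _ _ S.inj S.ex S.surj k).2.1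
      obtain ⟨w, rfl⟩ := (hδ z).1 hz
      rw [hN.tz_ne F h hD ha hb _ (by omega) j w, map_zero]
    · cases k with
      | zero => exact (torR_les J _ _ S.inj S.ex S.surj 0).2.2
      | succ k =>
        obtain ⟨δ, hδ, _⟩ := (torR_les J _ _ S.inj S.ex S.surj k).2.1
        exact fun z => (hδ z).1 (hN.tz_ne F h hD ha hb _ (by omega) _ _)
  · have hZ := hN.tz_ne F h hD ha hb k hk
    have hE : ∀ j, TZ R k J (D →ₗ[R] F.E j) := fun j => hN.tz h (F.injE j) (ha k hk)
    have s1 : ∀ j, Subsingleton (TorM R k J (D →ₗ[R] F.E j)) := fun j => ⟨fun x y => by rw [hE j x, hE j y]⟩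
    have s2 : ∀ j, Subsingleton (TorM R k J (D →ₗ[R] F.Z j)) := fun j => ⟨fun x y => by rw [hZ j x, hZ j y]⟩
    have := s1 j; have := s2 j; have := s2 (j+1)
    exact ⟨fun x y _ => Subsingleton.elim _ _, fun x => ⟨0, Subsingleton.elim _ _⟩, subsingleton_injective,
      EZ.inj 0 D _ subsingleton_injective⟩
end
end STheta

noncomputable section SSum
open CategoryTheory Limits DirectSum
open scoped TensorProduct
variable {R : Type u} [CommRing R]

section
variable [IsNoetherianRing R] {ι : Type u} [DecidableEq ι] (M : ι → Type u) [∀ i, AddCommGroup (M i)] [∀ i, Module R (M i)]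

lemma EZ.sum (C : Type u) [AddCommGroup C] [Module R C] [Module.Finite R C] (h : ∀ i, EZ R 1 C (M i)) :
    EZ R 1 C (⨁ i, M i) := by
  classical
  obtain ⟨n₀, q, hq⟩ := exists_fin_cover (R := R) C
  refine EZ.of_ext1 (SES.ker q hq) (EZ.proj 0 _ _) ?_
  intro φ
  choose ψ hψ using fun i => EZ.ext1 (SES.ker q hq) (h i) (DirectSum.component R ι M i ∘ₗ φ)
  obtain ⟨T, hT⟩ : (⊤ : Submodule R (LinearMap.ker q)).FG := Module.Finite.fg_top
  let S : Finset ι := T.biUnion (fun t => DFinsupp.support (φ t))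
  have hS : ∀ i, i ∉ S → DirectSum.component R ι M i ∘ₗ φ = 0 := by
    intro i hi
    have : (⊤ : Submodule R (LinearMap.ker q)) ≤ LinearMap.ker (DirectSum.component R ι M i ∘ₗ φ) := by
      rw [← hT, Submodule.span_le]
      intro t ht
      show (φ t) i = 0
      by_contra hne
      exact hi (Finset.mem_biUnion.2 ⟨t, ht, DFinsupp.mem_support_iff.2 hne⟩)
    ext x
    exact this (Submodule.mem_top (x := x))
  refine ⟨∑ i ∈ S, DirectSum.lof R ι M i ∘ₗ ψ i, ?_⟩
  refine LinearMap.ext fun x => DirectSum.ext_component R fun j => ?_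
  rw [LinearMap.comp_apply, LinearMap.sum_apply, map_sum]
  have hx : ∀ i, DirectSum.component R ι M j ((DirectSum.lof R ι M i ∘ₗ ψ i) ((LinearMap.ker q).subtype x))
      = if j = i then DirectSum.component R ι M j (φ x) else 0 := by
    intro i
    have := LinearMap.congr_fun (hψ i) x
    rw [LinearMap.comp_apply] at this
    rw [LinearMap.comp_apply, this]
    split_ifs with hij
    · subst hij
      rw [DirectSum.component.lof_self]; rfl
    · exact DirectSum.of_eq_of_ne _ _ _ hij
  rw [Finset.sum_congr rfl (fun i _ => hx i), Finset.sum_ite_eq]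
  split_ifs with hj
  · rfl
  · exact (LinearMap.congr_fun (hS j hj) x).symm

lemma injective_sum (h : ∀ i, Module.Injective R (M i)) : Module.Injective R (⨁ i, M i) :=
  injective_of_EZ _ fun J => EZ.sum M _ fun i => EZ.inj 0 _ _ (h i)

lemma injective_congr {A B : Type u} [AddCommGroup A] [Module R A] [AddCommGroup B] [Module R B]
    (e : A ≃ₗ[R] B) (h : Module.Injective R A) : Module.Injective R B :=
  injective_of_EZ _ fun J => EZ.congrR e (EZ.inj 0 _ _ h)

omit [IsNoetherianRing R] in
lemma torSum_nat {X X' : Type u} [AddCommGroup X] [Module R X] [AddCommGroup X'] [Module R X'] (k : ℕ) (g : X →ₗ[R] X')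
    (x : ⨁ i, TorM R k (M i) X) : torR k (⨁ i, M i) g (torSum k M X x) =
      torSum k M X' (DirectSum.lmap (fun i => torR k (M i) g) x) := by
  suffices torR k (⨁ i, M i) g ∘ₗ torSum k M X = torSum k M X' ∘ₗ (DirectSum.lmap (fun i => torR k (M i) g)) from
    LinearMap.congr_fun this x
  refine DirectSum.linearMap_ext _ fun i => LinearMap.ext fun y => ?_
  simp only [LinearMap.comp_apply]
  rw [torSum_lof, DirectSum.lmap_lof, torSum_lof, torL_torR]

lemma Good.sum {F : Fam R} {D : Type u} [AddCommGroup D] [Module R D] [Module.Finite R D] {k : ℕ}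
    (h : ∀ i, Good F D k (M i)) : Good F D k (⨁ i, M i) := by
  intro j
  have hb := fun (X : Type u) [AddCommGroup X] [Module R X] => torSum_bij (R := R) k M X
  let e := fun (X : Type u) [AddCommGroup X] [Module R X] => LinearEquiv.ofBijective _ (torSum_bij (R := R) k M X)
  refine ⟨?_, ?_, ?_, ?_⟩
  · rw [injective_iff_map_eq_zero]
    intro z hz
    obtain ⟨x, rfl⟩ := (hb _).2 z
    rw [torSum_nat] at hz
    have := (hb _).1 (hz.trans (map_zero _).symm)
    rw [(DirectSum.lmap_injective _).2 (fun i => (h i j).1) (this.trans (map_zero _).symm), map_zero]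
  · intro z
    obtain ⟨x, rfl⟩ := (hb _).2 z
    obtain ⟨y, rfl⟩ := (DirectSum.lmap_surjective _).2 (fun i => (h i j).2.1) x
    exact ⟨_, torSum_nat M k _ y⟩
  · exact injective_congr (e _) (injective_sum _ fun i => (h i j).2.2.1)
  · exact EZ.congrR (e _) (EZ.sum _ _ fun i => (h i j).2.2.2)

lemma Good.congr {F : Fam R} {D : Type u} [AddCommGroup D] [Module R D] {k : ℕ}
    {A B : Type u} [AddCommGroup A] [Module R A] [AddCommGroup B] [Module R B]
    (e : A ≃ₗ[R] B) (h : Good F D k A) : Good F D k B := by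
  intro j
  obtain ⟨h1, h2, h3, h4⟩ := h j
  have hn : ∀ {X X' : Type u} [AddCommGroup X] [Module R X] [AddCommGroup X'] [Module R X'] (g : X →ₗ[R] X') z,
      torR k B g (torLE k X e z) = torLE k X' e (torR k A g z) := fun g z => (torL_torR k _ g z).symm
  refine ⟨?_, ?_, injective_congr (torLE k _ e) h3, EZ.congrR (torLE k _ e) h4⟩
  · rw [injective_iff_map_eq_zero]
    intro z hz
    obtain ⟨x, rfl⟩ := (torLE k _ e).surjective z
    rw [hn, LinearEquiv.map_eq_zero_iff] at hz
    rw [h1 (hz.trans (map_zero _).symm), map_zero]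
  · intro z
    obtain ⟨x, rfl⟩ := (torLE k _ e).surjective z
    obtain ⟨y, rfl⟩ := h2 x
    exact ⟨_, hn _ y⟩
end
end SSum

noncomputable section SMatlis
open CategoryTheory Limits DirectSum
variable {R : Type u} [CommRing R]

section
variable {E : Type u} [AddCommGroup E] [Module R E]

lemma injective_retract {A B : Type u} [AddCommGroup A] [Module R A] [AddCommGroup B] [Module R B]
    (i : A →ₗ[R] B) (r : B →ₗ[R] A) (h : ∀ x, r (i x) = x) (hB : Module.Injective R B) : Module.Injective R A := by
  refine ⟨fun X Y _ _ _ _ f hf g => ?_⟩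
  obtain ⟨g', hg'⟩ := hB.out f hf (i ∘ₗ g)
  exact ⟨r ∘ₗ g', fun x => by rw [LinearMap.comp_apply, hg', LinearMap.comp_apply, h]⟩

/-- J is an essential extension of the span of x -/
def EssX (x : E) (J : Submodule R E) : Prop :=
  x ∈ J ∧ ∀ y ∈ J, y ≠ 0 → ∃ r : R, r • y ≠ 0 ∧ r • y ∈ Submodule.span R {x}

lemma exists_hull (hE : Module.Injective R E) (x : E) : ∃ J : Submodule R E, EssX x J ∧ Module.Injective R J := by
  obtain ⟨J, hxJ, hJ⟩ := zorn_le_nonempty₀ {J : Submodule R E | EssX x J} (by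
    intro c hc hch y hy
    have hd := hch.directedOn
    refine ⟨sSup c, ⟨le_sSup hy (hc hy).1, ?_⟩, fun z hz => le_sSup hz⟩
    intro z hz hz0
    obtain ⟨K, hK, hzK⟩ := (Submodule.mem_sSup_of_directed ⟨y, hy⟩ hd).1 hz
    exact (hc hK).2 z hzK hz0) (Submodule.span R {x}) ⟨Submodule.mem_span_singleton_self x,
      fun y hy h0 => ⟨1, by rwa [one_smul], by rwa [one_smul]⟩⟩
  obtain ⟨C, _, hC⟩ := zorn_le_nonempty₀ {C : Submodule R E | ∀ y ∈ J, y ∈ C → y = 0} (by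
    intro c hc hch y hy
    have hd := hch.directedOn
    refine ⟨sSup c, ?_, fun z hz => le_sSup hz⟩
    intro z hzJ hz
    obtain ⟨K, hK, hzK⟩ := (Submodule.mem_sSup_of_directed ⟨y, hy⟩ hd).1 hz
    exact hc hK z hzJ hzK) ⊥ (fun y _ h => h)
  have key : ∀ y : E, y ∉ C → ∃ r : R, ∃ j ∈ J, j ≠ 0 ∧ C.mkQ (r • y) = C.mkQ j := by
    intro y hy
    by_contra hcon
    push Not at hcon
    have hle : C ⊔ Submodule.span R {y} ≤ C := by
      refine hC.2 ?_ le_sup_left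
      intro j hj hjm
      obtain ⟨c, hc, w, hw, rfl⟩ := Submodule.mem_sup.1 hjm
      obtain ⟨r, rfl⟩ := Submodule.mem_span_singleton.1 hw
      by_contra h0
      refine hcon r _ hj h0 ?_
      rw [map_add, (Submodule.Quotient.mk_eq_zero C).2 hc |> fun h => (show C.mkQ c = 0 from h), zero_add]
    exact hy (hle (Submodule.mem_sup_right (Submodule.mem_span_singleton_self y)))
  obtain ⟨θ, hθ⟩ := inj_factor hE (C.mkQ ∘ₗ J.subtype) J.subtype (by
    rintro ⟨y, hy⟩ h0
    have : y ∈ C := (Submodule.Quotient.mk_eq_zero C).1 h0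
    exact hC.1 y hy this)
  have hθ' : ∀ j ∈ J, θ (C.mkQ j) = j := fun j hj => LinearMap.congr_fun hθ ⟨j, hj⟩
  have hle : LinearMap.range θ ≤ J := by
    refine hJ.2 ⟨?_, ?_⟩ ?_
    · exact ⟨_, hθ' x hJ.1.1⟩
    · rintro _ ⟨z, rfl⟩ h0
      obtain ⟨y, rfl⟩ := C.mkQ_surjective z
      have hy : y ∉ C := fun hy => h0 (by
        rw [show C.mkQ y = 0 from (Submodule.Quotient.mk_eq_zero C).2 hy, map_zero])
      obtain ⟨r, j, hj, hj0, hrj⟩ := key y hy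
      have : r • θ (C.mkQ y) = j := by rw [← map_smul, ← map_smul, hrj, hθ' j hj]
      obtain ⟨t, ht, ht'⟩ := hJ.1.2 j hj hj0
      exact ⟨t * r, by rwa [mul_smul, this], by rwa [mul_smul, this]⟩
    · intro j hj
      exact ⟨_, hθ' j hj⟩
  refine ⟨J, hJ.1, injective_retract J.subtype ((θ ∘ₗ C.mkQ).codRestrict J (fun y => hle ⟨_, rfl⟩)) ?_ hE⟩
  rintro ⟨j, hj⟩
  exact Subtype.ext (hθ' j hj)

variable [IsNoetherianRing R]

lemma EssX.pure {p : Ideal R} [hp : p.IsPrime] {x : E} (hx : ∀ r : R, r ∈ p ↔ r • x = 0) {J : Submodule R E}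
    (h : EssX x J) (hJ : Module.Injective R J) : PPure p J := by
  have hinj : ∀ s, s ∉ p → ∀ y : J, s • y = 0 → y = 0 := by
    rintro s hs ⟨y, hy⟩ hsy
    by_contra h0
    obtain ⟨r, hr, hr'⟩ := h.2 y hy (fun h => h0 (Subtype.ext h))
    obtain ⟨t, ht⟩ := Submodule.mem_span_singleton.1 hr'
    have hsy : s • y = 0 := congrArg Subtype.val hsy
    have h1 : (s * t) • x = 0 := by rw [mul_smul, ht, smul_comm, hsy, smul_zero]
    have h2 := (hp.mem_or_mem ((hx _).2 h1)).resolve_left hs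
    exact hr (by rw [← ht]; exact (hx t).1 h2)
  refine ⟨?_, ?_⟩
  · rintro ⟨y, hy⟩
    let I : Ideal R := LinearMap.ker (LinearMap.toSpanSingleton R E y)
    have hI : ∀ r, r ∈ I ↔ r • y = 0 := fun r => Iff.rfl
    have hrad : p ≤ I.radical := by
      intro a ha
      let f : ℕ →o Ideal R := ⟨fun n => LinearMap.ker (LinearMap.toSpanSingleton R E (a ^ n • y)), by
        apply monotone_nat_of_le_succ
        intro n r hr
        have hr : r • a ^ n • y = 0 := hr
        show r • a ^ (n+1) • y = 0
        rw [pow_succ', mul_smul, smul_comm, hr, smul_zero]⟩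
      obtain ⟨n, hn⟩ := (monotone_stabilizes_iff_noetherian (R := R) (M := R)).2 inferInstance f
      refine ⟨n, ?_⟩
      rw [hI]
      by_contra h0
      obtain ⟨t, ht, ht'⟩ := h.2 _ (J.smul_mem (a ^ n) hy) h0
      obtain ⟨u, hu⟩ := Submodule.mem_span_singleton.1 ht'
      have h1 : t ∈ f (n+1) := by
        show t • a ^ (n+1) • y = 0
        rw [pow_succ', mul_smul, smul_comm, ← hu, smul_comm, (hx a).1 ha, smul_zero]
      rw [← hn (n+1) (by omega)] at h1
      exact ht h1
    obtain ⟨m, hm⟩ := Ideal.exists_pow_le_of_le_radical_of_fg hrad (IsNoetherian.noetherian p)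
    exact ⟨m, fun r hr => Subtype.ext ((hI r).1 (hm hr))⟩
  · intro s hs
    have hi : Function.Injective (s • (LinearMap.id : J →ₗ[R] J)) := by
      rw [injective_iff_map_eq_zero]
      intro y hy
      exact hinj s hs y hy
    obtain ⟨g, hg⟩ := hJ.out _ hi LinearMap.id
    refine ⟨hi, fun y => ⟨g y, ?_⟩⟩
    have := hg y
    rw [LinearMap.smul_apply, map_smul] at this
    exact this

def PInj (J : Submodule R E) : Prop := Module.Injective R J ∧ ∃ p : Ideal R, p.IsPrime ∧ PPure p J

omit [IsNoetherianRing R] in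
lemma PPure.congr {A B : Type u} [AddCommGroup A] [Module R A] [AddCommGroup B] [Module R B] {p : Ideal R}
    (e : A ≃ₗ[R] B) (h : PPure p A) : PPure p B := by
  refine ⟨fun x => ?_, fun s hs => ⟨fun x y hxy => ?_, fun x => ?_⟩⟩
  · obtain ⟨m, hm⟩ := h.tors (e.symm x)
    exact ⟨m, fun r hr => e.symm.injective (by rw [map_smul, hm r hr, map_zero])⟩
  · apply e.symm.injective
    apply (h.bij s hs).1
    have hxy : s • x = s • y := hxy
    show s • e.symm x = s • e.symm y
    rw [← map_smul, hxy, map_smul]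
  · obtain ⟨y, hy⟩ := (h.bij s hs).2 (e.symm x)
    refine ⟨e y, ?_⟩
    have hy : s • y = e.symm x := hy
    show s • e y = x
    rw [← map_smul, hy, e.apply_symm_apply]

lemma exists_pinj (hE : Module.Injective R E) (h0 : ∃ x : E, x ≠ 0) : ∃ J : Submodule R E, J ≠ ⊥ ∧ PInj J := by
  obtain ⟨x, hx⟩ := h0
  obtain ⟨p, hp, _⟩ := exists_le_isAssociatedPrime_of_isNoetherianRing R x hx
  obtain ⟨hp, y, rfl⟩ := isAssociatedPrime_iff.1 hp
  have hy : ∀ r : R, r ∈ (⊥ : Submodule R E).colon {y} ↔ r • y = 0 := by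
    intro r; rw [Submodule.mem_colon_singleton, Submodule.mem_bot]
  obtain ⟨J, hJ, hJi⟩ := exists_hull hE y
  refine ⟨J, ?_, hJi, _, hp, hJ.pure hy hJi⟩
  rintro rfl
  have : y = 0 := hJ.1
  apply hp.ne_top
  rw [Ideal.eq_top_iff_one, hy, this, smul_zero]

lemma exists_decomp (hE : Module.Injective R E) : ∃ s : Set (Submodule R E), (∀ J ∈ s, PInj J) ∧
    ∀ [DecidableEq s], Function.Bijective (DirectSum.coeLinearMap (fun J : s => (J : Submodule R E))) := by
  classical
  obtain ⟨s, hs⟩ := zorn_subset {s : Set (Submodule R E) | sSupIndep s ∧ ∀ J ∈ s, PInj J} (by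
    intro c hc hch
    exact ⟨⋃₀ c, ⟨iSupIndep_sUnion_of_directed hch.directedOn fun s hs => (hc hs).1,
      fun a ⟨s, sc, as⟩ => (hc sc).2 a as⟩, fun _ => Set.subset_sUnion_of_mem⟩)
  refine ⟨s, hs.1.2, ?_⟩
  intro dec
  set φ := DirectSum.coeLinearMap (fun J : s => (J : Submodule R E)) with hφ
  have hind : iSupIndep (fun J : s => (J : Submodule R E)) := (sSupIndep_iff s).1 hs.1.1
  have hinj : Function.Injective φ := hind.dfinsupp_lsum_injective
  have hS : Module.Injective R (⨁ J : s, (J : Submodule R E)) := injective_sum _ fun J => (hs.1.2 J J.2).1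
  obtain ⟨r, hr⟩ := hS.out φ hinj LinearMap.id
  have hr : ∀ x, r (φ x) = x := hr
  refine ⟨hinj, fun y => ?_⟩
  by_contra hy
  have hC : Module.Injective R (LinearMap.ker r) := by
    refine injective_retract (LinearMap.ker r).subtype ((LinearMap.id - φ ∘ₗ r).codRestrict _ ?_) ?_ hE
    case refine_2 =>
      intro c
      rw [LinearMap.mem_ker]
      show r (c - φ (r c)) = 0
      rw [map_sub, hr, sub_self]
    · rintro ⟨x, hx⟩
      apply Subtype.ext
      show x - φ (r x) = x
      rw [LinearMap.mem_ker.1 hx, map_zero, sub_zero]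
  obtain ⟨J, hJ0, hJi, p, hp, hJp⟩ := exists_pinj hC ⟨⟨y - φ (r y), by
      rw [LinearMap.mem_ker, map_sub, hr, sub_self]⟩, fun h => hy ⟨r y, by
      have := congrArg Subtype.val h
      exact (sub_eq_zero.1 this).symm⟩⟩
  let e := Submodule.equivMapOfInjective (LinearMap.ker r).subtype Subtype.val_injective J
  set J' := J.map (LinearMap.ker r).subtype with hJ'
  have hJ'0 : J' ≠ ⊥ := by
    intro hb
    apply hJ0
    rw [eq_bot_iff]
    intro z hz
    have : (z : E) ∈ J' := ⟨z, hz, rfl⟩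
    rw [hb] at this
    exact Subtype.ext this
  have hJ'p : PInj J' := ⟨injective_congr e hJi, p, hp, hJp.congr e⟩
  have hrange : ∀ z ∈ sSup s, ∃ w, φ w = z := by
    intro z hz
    rw [sSup_eq_iSup', Submodule.iSup_eq_range_dfinsupp_lsum] at hz
    obtain ⟨w, hw⟩ := hz
    exact ⟨w, hw⟩
  have hdis : Disjoint (sSup s) J' := by
    rw [Submodule.disjoint_def]
    intro z hz hzJ
    obtain ⟨w, rfl⟩ := hrange z hz
    obtain ⟨v, hv, hv'⟩ := hzJ
    have : r (φ w) = 0 := by rw [← hv']; exact v.2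
    rw [hr] at this
    rw [this, map_zero]
  have hmem : insert J' s ⊆ s := by
    refine hs.2 ⟨?_, ?_⟩ (Set.subset_insert _ _)
    · intro x hx
      rcases eq_or_ne x J' with rfl | hne
      · refine hdis.symm.mono_right (sSup_le_sSup ?_)
        rintro z ⟨hz, hz'⟩
        exact hz.resolve_left hz'
      · have hxs : x ∈ s := hx.resolve_left hne
        have h1 := hs.1.1 hxs
        have h2 : Disjoint (x ⊔ sSup (s \ {x})) J' :=
          hdis.mono_left (sup_le (le_sSup hxs) (sSup_le_sSup Set.diff_subset))
        refine (h1.disjoint_sup_right_of_disjoint_sup_left h2).mono_right ?_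
        apply sSup_le
        rintro z ⟨rfl | hz, hz'⟩
        · exact le_sup_right
        · exact le_sup_of_le_left (le_sSup ⟨hz, hz'⟩)
    · rintro K (rfl | hK)
      · exact hJ'p
      · exact hs.1.2 K hK
  have := hdis.mono_left (le_sSup (hmem (Set.mem_insert _ _)))
  exact hJ'0 (disjoint_self.1 this)

lemma good_all (hE : Module.Injective R E) {D : Type u} [AddCommGroup D] [Module R D] {n : ℕ} (h : DM R D n)
    (F : Fam R) (hD : ∀ j, EZ R 1 D (F.Z j)) (k : ℕ) : Good F D k E := by
  classical
  have := h.fin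
  obtain ⟨s, hs, hb⟩ := exists_decomp hE
  refine Good.congr (LinearEquiv.ofBijective _ hb) (Good.sum _ fun J => ?_)
  obtain ⟨hJ, p, hp, hJp⟩ := hs J J.2
  exact hJp.good hJ h F hD k
end
end SMatlis

noncomputable section SFinal
variable {R : Type u} [CommRing R] [IsNoetherianRing R]

def torFam (F : Fam R) (D : Type u) [AddCommGroup D] [Module R D] (E : Type u) [AddCommGroup E] [Module R E] (k : ℕ)
    (hD : ∀ j, EZ R 1 D (F.Z j)) (hg : Good F D k E) : Fam R where
  Z j := TorM R k E (D →ₗ[R] F.Z j)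
  E j := TorM R k E (D →ₗ[R] F.E j)
  ι j := torR k E (hm D (F.ι j))
  π j := torR k E (hm D (F.π j))
  ses j := ⟨(hg j).1, (torR_les E _ _ (F.sesH hD j).inj (F.sesH hD j).ex (F.sesH hD j).surj k).1, (hg j).2.1⟩
  injE j := (hg j).2.2.1

end SFinal

/-- `Tor_k^R(E, Hom_R(D,G))` is Gorenstein injective for all `k`. -/
theorem isGorensteinInjective_tor_hom_dualizing
    {R : Type u} [CommRing R] [IsNoetherianRing R]
    (D : Type u) [AddCommGroup D] [Module R D] (hD : IsDualizingModule R D)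
    (E : Type u) [AddCommGroup E] [Module R E] (hE : Module.Injective R E)
    (G : Type u) [AddCommGroup G] [Module R G] (hG : IsGorensteinInjective R G) :
    ∀ k : ℕ, IsGorensteinInjective R
      (((Tor (ModuleCat.{u} R) k).obj (ModuleCat.of R E)).obj
        (ModuleCat.of R (D →ₗ[R] G))) := by
  intro k
  obtain ⟨n, h⟩ := hD.dm
  obtain ⟨F, ⟨e⟩, hF⟩ := hG.fam
  have hDF : ∀ j, EZ R 1 D (F.Z j) := fun j =>
    EZ_of_ID (fun I _ _ hI i => F.shift (hF I hI) i j) h.ID 0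
  have hg := good_all hE h F hDF k
  have hT := (torFam F D E k hDF hg).toGI
    (fun I _ _ hI j => (torFam F D E k hDF hg).crit h (fun j => (hg j).2.2.2) hI j)
  exact IsGorensteinInjective.congr (torRE k E (LinearEquiv.congrRight e)) hT
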